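/- Let ℓ ∈ {11, 12} and let a be a fixed real number with 0.478287 ≤ a < 1/2. Then there exist real constants c_0, c_1, c_2, c_3 and c'_0, …, c'_{ℓ−1} such that for every ε > 0 there is a constant C(ε) > 0 with |∑_{n ≤ X} d_{4,ℓ}(n;a) − X·∑_{k=0}^{3} c_k (log X)^k − X^{1−a}·∑_{k=0}^{ℓ−1} c'_k (log X)^k| ≤ C(ε) X^{1/2+ε} for all X ≥ 2. -/

import Mathlib

open Real

/-- `d_k(n)`, the number of ordered ways of writing `n` as a product of `k` positive
integer factors: the `k`-th power of `ArithmeticFunction.zeta` under Dirichlet convolution. -/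
def dk (k : ℕ) (n : ℕ) : ℕ := (ArithmeticFunction.zeta ^ k : ArithmeticFunction ℕ) n

/-- The weighted divisor function `d_{4,ℓ}(n;a) = ∑_{n = n₁n₂} d₄(n₁) d_ℓ(n₂) n₂^{-a}`. -/
noncomputable def dWeighted (ℓ : ℕ) (a : ℝ) (n : ℕ) : ℝ :=
  ∑ p ∈ n.divisorsAntidiagonal, (dk 4 p.1 : ℝ) * (dk ℓ p.2 : ℝ) * (p.2 : ℝ) ^ (-a)

namespace WeightedDivisor

lemma add_one_le_rpow {η : ℝ} (hη : 0 < η) {p : ℕ} (hp : 2 ≤ p) (e : ℕ) :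
    (e + 1 : ℝ) ≤ (1 / (η * Real.log 2) + 1) * ((p : ℝ) ^ e) ^ η := by
  have hl : 0 < Real.log 2 := Real.log_pos (by norm_num)
  have h2 : (1 : ℝ) + e * (η * Real.log 2) ≤ ((p : ℝ) ^ e) ^ η := by
    have h3 : ((2 : ℝ) ^ e) ^ η ≤ ((p : ℝ) ^ e) ^ η := by
      gcongr
      exact_mod_cast hp
    refine le_trans ?_ h3
    rw [← Real.rpow_natCast, ← Real.rpow_mul (by norm_num), Real.rpow_def_of_pos (by norm_num)]
    have := Real.add_one_le_exp (Real.log 2 * (e * η))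
    linarith
  have h4 : (1 : ℝ) ≤ ((p : ℝ) ^ e) ^ η := by
    have : (0 : ℝ) ≤ e * (η * Real.log 2) := by positivity
    linarith
  have h5 : (e : ℝ) ≤ 1 / (η * Real.log 2) * ((p : ℝ) ^ e) ^ η := by
    rw [one_div, inv_mul_eq_div, le_div_iff₀ (by positivity)]
    linarith
  linarith

lemma add_one_le_rpow_of_large {η : ℝ} {p : ℕ} (hp : (2 : ℝ) ≤ (p : ℝ) ^ η) (e : ℕ) :
    (e + 1 : ℝ) ≤ ((p : ℝ) ^ e) ^ η := by
  have h1 : ((p : ℝ) ^ e) ^ η = ((p : ℝ) ^ η) ^ e := by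
    rw [← Real.rpow_natCast, ← Real.rpow_natCast, ← Real.rpow_mul (by positivity),
      ← Real.rpow_mul (by positivity), mul_comm]
  rw [h1]
  calc (e + 1 : ℝ) ≤ 2 ^ e := by exact_mod_cast Nat.succ_le_of_lt (Nat.lt_two_pow_self)
    _ ≤ _ := by gcongr

/-- The divisor bound. -/
lemma exists_card_divisors_le {η : ℝ} (hη : 0 < η) :
    ∃ C : ℝ, 1 ≤ C ∧ ∀ n : ℕ, 1 ≤ n → (n.divisors.card : ℝ) ≤ C * (n : ℝ) ^ η := by
  have hl : 0 < Real.log 2 := Real.log_pos (by norm_num)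
  set B : ℝ := 1 / (η * Real.log 2) + 1 with hB
  have hB1 : 1 ≤ B := by
    have : 0 < 1 / (η * Real.log 2) := by positivity
    linarith
  set M : ℕ := ⌈(2 : ℝ) ^ (1 / η)⌉₊ with hM
  have hlarge : ∀ p : ℕ, M ≤ p → (2 : ℝ) ≤ (p : ℝ) ^ η := by
    intro p hp
    have h1 : (2 : ℝ) ^ (1 / η) ≤ p := (Nat.le_ceil _).trans (by exact_mod_cast hp)
    calc (2 : ℝ) = ((2 : ℝ) ^ (1 / η)) ^ η := by
          rw [← Real.rpow_mul (by norm_num), one_div, inv_mul_cancel₀ hη.ne', Real.rpow_one]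
      _ ≤ _ := by gcongr
  refine ⟨B ^ M, one_le_pow₀ hB1, fun n hn => ?_⟩
  have hn0 : n ≠ 0 := by omega
  rw [Nat.card_divisors hn0]
  have hprod : (n : ℝ) ^ η = ∏ p ∈ n.primeFactors, ((p : ℝ) ^ n.factorization p) ^ η := by
    rw [Real.finsetProd_rpow _ _ (fun _ _ => by positivity)]
    congr 1
    conv_lhs => rw [← Nat.prod_factorization_pow_eq_self hn0]
    simp [Finsupp.prod]
  rw [hprod]
  push_cast
  calc ∏ p ∈ n.primeFactors, ((n.factorization p : ℝ) + 1)
      ≤ ∏ p ∈ n.primeFactors, ((if p < M then B else 1) * ((p : ℝ) ^ n.factorization p) ^ η) := by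
        refine Finset.prod_le_prod (fun _ _ => by positivity) fun p hp => ?_
        split_ifs with h
        · exact add_one_le_rpow hη (Nat.prime_of_mem_primeFactors hp).two_le _
        · rw [one_mul]
          exact add_one_le_rpow_of_large (hlarge p (by omega)) _
    _ = (∏ p ∈ n.primeFactors, (if p < M then B else 1)) * _ := Finset.prod_mul_distrib
    _ ≤ _ := by
        refine mul_le_mul_of_nonneg_right ?_ (Finset.prod_nonneg fun _ _ => by positivity)
        rw [Finset.prod_ite, Finset.prod_const_one, mul_one, Finset.prod_const]
        refine pow_le_pow_right₀ hB1 ?_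
        calc _ ≤ (Finset.range M).card := Finset.card_le_card fun p hp => by
              simpa using (Finset.mem_filter.mp hp).2
          _ = M := by simp

lemma dk_le (k n : ℕ) : dk k n ≤ n.divisors.card ^ k := by
  induction k generalizing n with
  | zero =>
    rw [dk, pow_zero, pow_zero, ArithmeticFunction.one_apply]
    split_ifs <;> simp
  | succ k ih =>
    rw [dk, pow_succ, ArithmeticFunction.mul_apply, pow_succ']
    calc _ ≤ ∑ x ∈ n.divisorsAntidiagonal, n.divisors.card ^ k := by
          refine Finset.sum_le_sum fun x hx => ?_
          have hx' := Nat.mem_divisorsAntidiagonal.mp hx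
          have h1 : (ArithmeticFunction.zeta x.2 : ℕ) ≤ 1 := by
            rw [ArithmeticFunction.zeta_apply]; split_ifs <;> simp
          calc _ ≤ dk k x.1 * 1 := Nat.mul_le_mul le_rfl h1
            _ ≤ x.1.divisors.card ^ k := by simpa using ih x.1
            _ ≤ _ := Nat.pow_le_pow_left (Finset.card_le_card
              (Nat.divisors_subset_of_dvd hx'.2 (Dvd.intro _ hx'.1))) _
      _ = _ := by
        rw [Finset.sum_const, smul_eq_mul, ← Nat.map_div_right_divisors, Finset.card_map]

lemma exists_card_divisors_pow_le (k : ℕ) {η : ℝ} (hη : 0 < η) :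
    ∃ C : ℝ, 1 ≤ C ∧ ∀ n : ℕ, 1 ≤ n → ((n.divisors.card : ℝ)) ^ k ≤ C * (n : ℝ) ^ η := by
  obtain ⟨C, hC, h⟩ := exists_card_divisors_le (η := η / (k + 1)) (by positivity)
  refine ⟨C ^ k, one_le_pow₀ hC, fun n hn => ?_⟩
  calc _ ≤ (C * (n : ℝ) ^ (η / (k + 1))) ^ k := by gcongr; exact h n hn
    _ = C ^ k * (n : ℝ) ^ (η / (k + 1) * k) := by
      rw [mul_pow, ← Real.rpow_natCast ((n : ℝ) ^ _), ← Real.rpow_mul (by positivity)]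
    _ ≤ _ := by
      gcongr
      · exact_mod_cast hn
      · rw [div_mul_eq_mul_div, div_le_iff₀ (by positivity)]
        nlinarith

lemma exists_dk_le (k : ℕ) {η : ℝ} (hη : 0 < η) :
    ∃ C : ℝ, 1 ≤ C ∧ ∀ n : ℕ, 1 ≤ n → (dk k n : ℝ) ≤ C * (n : ℝ) ^ η := by
  obtain ⟨C, hC, h⟩ := exists_card_divisors_pow_le k hη
  exact ⟨C, hC, fun n hn => le_trans (by exact_mod_cast dk_le k n) (h n hn)⟩

lemma dWeighted_nonneg (ℓ : ℕ) (a : ℝ) (n : ℕ) : 0 ≤ dWeighted ℓ a n :=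
  Finset.sum_nonneg fun _ _ => by positivity

lemma dWeighted_le (ℓ : ℕ) {a : ℝ} (ha : 0 ≤ a) (n : ℕ) : dWeighted ℓ a n ≤ dk (4 + ℓ) n := by
  rw [dk, pow_add, ArithmeticFunction.mul_apply, dWeighted]
  push_cast
  refine Finset.sum_le_sum fun x hx => ?_
  have hx' := Nat.mem_divisorsAntidiagonal.mp hx
  have h2 : 1 ≤ x.2 := by
    rcases Nat.eq_zero_or_pos x.2 with h | h
    · rw [h, mul_zero] at hx'; exact absurd hx'.1.symm hx'.2
    · exact h
  exact mul_le_of_le_one_right (by positivity)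
    (Real.rpow_le_one_of_one_le_of_nonpos (by exact_mod_cast h2) (by linarith))

lemma exists_dWeighted_le (ℓ : ℕ) {a : ℝ} (ha : 0 ≤ a) {η : ℝ} (hη : 0 < η) :
    ∃ C : ℝ, 1 ≤ C ∧ ∀ n : ℕ, 1 ≤ n → dWeighted ℓ a n ≤ C * (n : ℝ) ^ η := by
  obtain ⟨C, hC, h⟩ := exists_dk_le (4 + ℓ) hη
  exact ⟨C, hC, fun n hn => (dWeighted_le ℓ ha n).trans (h n hn)⟩

/-- `(s - 1)` times the truncated zeta sum with its main correction term. -/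
noncomputable def zetaTrunc (N : ℕ) (s : ℂ) : ℂ :=
  (s - 1) * ∑ n ∈ Finset.Icc 1 N, (n : ℂ) ^ (-s) + (N : ℂ) ^ (1 - s)

lemma hasDerivAt_ofReal_cpow_one_sub (s : ℂ) {x : ℝ} (hx : x ≠ 0) :
    HasDerivAt (fun y : ℝ => (y : ℂ) ^ (1 - s)) ((1 - s) * (x : ℂ) ^ (-s)) x := by
  rcases eq_or_ne s 1 with rfl | h
  · simpa using hasDerivAt_const x (1 : ℂ)
  · have := hasDerivAt_ofReal_cpow_const (r := 1 - s) hx (sub_ne_zero.2 h.symm)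
    rwa [show 1 - s - 1 = -s by ring] at this

lemma norm_zetaTrunc_succ_sub_le {s : ℂ} (hs : 0 < s.re) {n : ℕ} (hn : 1 ≤ n) :
    ‖zetaTrunc (n + 1) s - zetaTrunc n s‖ ≤
      ‖s - 1‖ * ‖s‖ / s.re * ((n : ℝ) ^ (-s.re) - ((n + 1 : ℕ) : ℝ) ^ (-s.re)) := by
  set φ : ℝ → ℂ := fun x => ((x : ℂ) ^ (1 - s) - (n : ℂ) ^ (1 - s)) +
    (s - 1) * ((x - n) * (x : ℂ) ^ (-s)) with hφ
  set K : ℝ := ‖s - 1‖ * ‖s‖ with hK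
  have hn0 : (0 : ℝ) < n := by exact_mod_cast hn
  have hs0 : -s ≠ 0 := by
    intro h; have := congrArg Complex.re h; simp at this; linarith
  have hd : ∀ x : ℝ, 0 < x → HasDerivAt φ ((s - 1) * ((x - n) * (-s * (x : ℂ) ^ (-s - 1)))) x := by
    intro x hx
    have h3 : HasDerivAt (fun y : ℝ => ((y : ℂ) - n)) 1 x := by
      simpa using (Complex.ofRealCLM.hasDerivAt (x := x)).sub_const (n : ℂ)
    have := ((hasDerivAt_ofReal_cpow_one_sub s hx.ne').sub_const ((n : ℂ) ^ (1 - s))).add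
      ((h3.mul (hasDerivAt_ofReal_cpow_const hx.ne' hs0)).const_mul (s - 1))
    exact this.congr_deriv (by ring)
  have hB : ∀ x : ℝ, 0 < x → HasDerivAt
      (fun y : ℝ => K / s.re * ((n : ℝ) ^ (-s.re) - y ^ (-s.re))) (K * x ^ (-s.re - 1)) x := by
    intro x hx
    have := ((hasDerivAt_rpow_const (p := -s.re) (Or.inl hx.ne')).const_sub
      ((n : ℝ) ^ (-s.re))).const_mul (K / s.re)
    exact this.congr_deriv (by field_simp)
  have key := image_norm_le_of_norm_deriv_right_le_deriv_boundary' (f := φ) (a := n) (b := n + 1)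
    (f' := fun x => (s - 1) * ((x - n) * (-s * (x : ℂ) ^ (-s - 1))))
    (B := fun y : ℝ => K / s.re * ((n : ℝ) ^ (-s.re) - y ^ (-s.re)))
    (B' := fun x => K * x ^ (-s.re - 1))
    (fun x hx => (hd x (hn0.trans_le hx.1)).continuousAt.continuousWithinAt)
    (fun x hx => (hd x (hn0.trans_le hx.1)).hasDerivWithinAt) (by simp [φ])
    (fun x hx => (hB x (hn0.trans_le hx.1)).continuousAt.continuousWithinAt)
    (fun x hx => (hB x (hn0.trans_le hx.1)).hasDerivWithinAt) (by
      rintro x ⟨hx1, hx2⟩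
      have hx := hn0.trans_le hx1
      have hxn : ‖(x : ℂ) - n‖ ≤ 1 := by
        rw [← Complex.ofReal_natCast, ← Complex.ofReal_sub, Complex.norm_real, Real.norm_eq_abs,
          abs_le]
        constructor <;> linarith
      have hp : ‖(x : ℂ) ^ (-s - 1)‖ = x ^ (-s.re - 1) := by
        rw [Complex.norm_cpow_eq_rpow_re_of_pos hx]; simp
      rw [norm_mul, norm_mul, norm_mul, hp, norm_neg, hK]
      have : 0 ≤ ‖s - 1‖ * ‖s‖ * x ^ (-s.re - 1) := by positivity
      calc _ = ‖(x : ℂ) - n‖ * (‖s - 1‖ * ‖s‖ * x ^ (-s.re - 1)) := by ring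
        _ ≤ 1 * (‖s - 1‖ * ‖s‖ * x ^ (-s.re - 1)) := by gcongr
        _ = _ := by ring) (x := (n : ℝ) + 1) ⟨by linarith, le_rfl⟩
  have e : zetaTrunc (n + 1) s - zetaTrunc n s = φ ((n : ℝ) + 1) := by
    simp only [zetaTrunc, φ, Finset.sum_Icc_succ_top (Nat.le_add_left 1 n)]
    push_cast
    ring
  rw [e]
  simpa using key

lemma norm_zetaTrunc_sub_le {s : ℂ} (hs : 0 < s.re) {m n : ℕ} (hm : 1 ≤ m) (hmn : m ≤ n) :
    ‖zetaTrunc n s - zetaTrunc m s‖ ≤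
      ‖s - 1‖ * ‖s‖ / s.re * ((m : ℝ) ^ (-s.re) - (n : ℝ) ^ (-s.re)) := by
  induction n, hmn using Nat.le_induction with
  | base => simp
  | succ k hk ih =>
    have h1 := norm_zetaTrunc_succ_sub_le hs (hm.trans hk)
    have h2 := norm_add_le (zetaTrunc (k + 1) s - zetaTrunc k s) (zetaTrunc k s - zetaTrunc m s)
    rw [sub_add_sub_cancel] at h2
    refine (h2.trans (add_le_add h1 ih)).trans (le_of_eq ?_)
    ring

lemma norm_zetaTrunc_sub_le' {s : ℂ} (hs : 0 < s.re) {m n : ℕ} (hm : 1 ≤ m) (hmn : m ≤ n) :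
    ‖zetaTrunc n s - zetaTrunc m s‖ ≤ ‖s - 1‖ * ‖s‖ / s.re * (m : ℝ) ^ (-s.re) := by
  refine (norm_zetaTrunc_sub_le hs hm hmn).trans ?_
  gcongr
  have : 0 ≤ (n : ℝ) ^ (-s.re) := by positivity
  linarith

lemma differentiable_zetaTrunc {N : ℕ} (hN : 1 ≤ N) : Differentiable ℂ (zetaTrunc N) := by
  unfold zetaTrunc
  have h : ∀ n : ℕ, 1 ≤ n → (n : ℂ) ≠ 0 := fun n hn => by exact_mod_cast (by omega : n ≠ 0)
  refine ((differentiable_id.sub_const 1).mul ?_).add ?_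
  · refine Differentiable.fun_sum fun n hn => ?_
    exact differentiable_id.neg.const_cpow (Or.inl (h n (Finset.mem_Icc.1 hn).1))
  · exact (differentiable_id.const_sub 1).const_cpow (Or.inl (h N hN))

open Filter Topology in
lemma tendsto_zetaTrunc_of_one_lt_re {s : ℂ} (hs : 1 < s.re) :
    Tendsto (fun N => zetaTrunc N s) atTop (𝓝 (riemannZeta₁ s)) := by
  have hs1 : s ≠ 1 := by rintro rfl; simp at hs
  have h1 : Tendsto (fun N : ℕ => ∑ n ∈ Finset.range N, 1 / (n + 1 : ℂ) ^ s) atTop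
      (𝓝 (riemannZeta s)) := by
    rw [zeta_eq_tsum_one_div_nat_add_one_cpow hs]
    refine (Summable.hasSum ?_).tendsto_sum_nat
    have := (summable_nat_add_iff 1).2 (Complex.summable_one_div_nat_cpow.2 hs)
    simpa using this
  have h2 : Tendsto (fun N : ℕ => (N : ℂ) ^ (1 - s)) atTop (𝓝 0) := by
    rw [tendsto_zero_iff_norm_tendsto_zero]
    have h := (tendsto_rpow_neg_atTop (y := s.re - 1) (by linarith)).comp
      (tendsto_natCast_atTop_atTop (R := ℝ))
    refine h.congr' ?_
    filter_upwards [eventually_gt_atTop 0] with N hN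
    rw [← Complex.ofReal_natCast, Complex.norm_cpow_eq_rpow_re_of_pos (by exact_mod_cast hN)]
    simp
  have h3 := (h1.const_mul (s - 1)).add h2
  have e : (s - 1) * riemannZeta s + 0 = riemannZeta₁ s := by
    rw [riemannZeta_eq_inv_sub_mul hs1, add_zero, mul_inv_cancel_left₀ (sub_ne_zero.2 hs1)]
  rw [e] at h3
  refine h3.congr fun N => ?_
  have : ∑ n ∈ Finset.range N, 1 / (n + 1 : ℂ) ^ s = ∑ n ∈ Finset.Icc 1 N, (n : ℂ) ^ (-s) := by
    induction N with
    | zero => simp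
    | succ N ih =>
      rw [Finset.sum_range_succ, ih, Finset.sum_Icc_succ_top (Nat.le_add_left 1 N)]
      simp [Complex.cpow_neg]
  rw [zetaTrunc, this]

open Filter Topology in
lemma exists_tendsto_zetaTrunc {s : ℂ} (hs : 0 < s.re) :
    ∃ L, Tendsto (fun N => zetaTrunc N s) atTop (𝓝 L) ∧ ∀ N : ℕ, 1 ≤ N →
      ‖L - zetaTrunc N s‖ ≤ ‖s - 1‖ * ‖s‖ / s.re * (N : ℝ) ^ (-s.re) := by
  set b : ℕ → ℝ := fun m => ‖s - 1‖ * ‖s‖ / s.re * (m : ℝ) ^ (-s.re) with hb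
  have hb0 : Tendsto b atTop (𝓝 0) := by
    have := ((tendsto_rpow_neg_atTop hs).comp (tendsto_natCast_atTop_atTop (R := ℝ))).const_mul
      (‖s - 1‖ * ‖s‖ / s.re)
    simpa using this
  have hc : CauchySeq (fun N => zetaTrunc (N + 1) s) := by
    refine cauchySeq_of_le_tendsto_0' (fun N => b (N + 1)) (fun n m hnm => ?_)
      (hb0.comp (tendsto_add_atTop_nat 1))
    rw [dist_comm, dist_eq_norm]
    exact norm_zetaTrunc_sub_le' hs (Nat.le_add_left 1 n) (by omega)
  obtain ⟨L, hL⟩ := cauchySeq_tendsto_of_complete hc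
  have hL' := (tendsto_add_atTop_iff_nat 1 (f := fun N => zetaTrunc N s)).1 hL
  refine ⟨L, hL', fun N hN => ?_⟩
  refine le_of_tendsto (hL'.sub_const (zetaTrunc N s)).norm ?_
  filter_upwards [eventually_ge_atTop N] with n hn
  exact norm_zetaTrunc_sub_le' hs hN hn

open Filter Topology in
lemma norm_riemannZeta₁_sub_zetaTrunc_le {s : ℂ} (hs : 0 < s.re) {N : ℕ} (hN : 1 ≤ N) :
    ‖riemannZeta₁ s - zetaTrunc N s‖ ≤ ‖s - 1‖ * ‖s‖ / s.re * (N : ℝ) ^ (-s.re) := by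
  choose! L hL hLb using fun (s : ℂ) (hs : s ∈ {s : ℂ | 0 < s.re}) => exists_tendsto_zetaTrunc hs
  have hopen : IsOpen {s : ℂ | 0 < s.re} := isOpen_lt continuous_const Complex.continuous_re
  have hloc : TendstoLocallyUniformlyOn zetaTrunc L atTop {s : ℂ | 0 < s.re} := by
    rw [tendstoLocallyUniformlyOn_iff_forall_isCompact hopen]
    intro K hK hKc
    rcases K.eq_empty_or_nonempty with rfl | hne
    · exact tendstoUniformlyOn_empty
    obtain ⟨z, hz, hzmin⟩ := hKc.exists_isMinOn hne Complex.continuous_re.continuousOn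
    obtain ⟨R, hR⟩ := (hKc.image_of_continuousOn (f := fun s : ℂ => ‖s - 1‖ * ‖s‖ / s.re) (by
      refine ContinuousOn.div (by fun_prop) (by fun_prop) fun s hs => ?_
      exact (hK hs : 0 < s.re).ne')).bddAbove
    have hz0 : 0 < z.re := hK hz
    have hb0 : Tendsto (fun m : ℕ => R * (m : ℝ) ^ (-z.re)) atTop (𝓝 0) := by
      have := ((tendsto_rpow_neg_atTop hz0).comp (tendsto_natCast_atTop_atTop (R := ℝ))).const_mul R
      simpa using this
    rw [Metric.tendstoUniformlyOn_iff]
    intro ε hε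
    filter_upwards [hb0.eventually_lt_const hε, eventually_ge_atTop 1] with m hm hm1 s hsK
    have hs0 : 0 < s.re := hK hsK
    rw [dist_eq_norm]
    refine lt_of_le_of_lt ((hLb s hs0 m hm1).trans ?_) hm
    have h1 : ‖s - 1‖ * ‖s‖ / s.re ≤ R := hR ⟨s, hsK, rfl⟩
    have h2 : z.re ≤ s.re := hzmin hsK
    have h3 : (1 : ℝ) ≤ m := by exact_mod_cast hm1
    have h4 : 0 ≤ R := le_trans (by positivity) h1
    gcongr
  have hdiff : DifferentiableOn ℂ L {s : ℂ | 0 < s.re} := by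
    refine hloc.differentiableOn ?_ hopen
    filter_upwards [eventually_ge_atTop 1] with m hm using
        (differentiable_zetaTrunc hm).differentiableOn
  have hEq : Set.EqOn L riemannZeta₁ {s : ℂ | 0 < s.re} := by
    refine (hdiff.analyticOnNhd hopen).eqOn_of_preconnected_of_eventuallyEq
      (differentiable_riemannZeta₁.differentiableOn.analyticOnNhd hopen)
      (convex_halfSpace_re_gt 0).isPreconnected (z₀ := 2) (by simp) ?_
    have : {s : ℂ | 1 < s.re} ∈ 𝓝 (2 : ℂ) :=
      (isOpen_lt continuous_const Complex.continuous_re).mem_nhds (by simp)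
    filter_upwards [this] with s hs
    have hs : 1 < s.re := hs
    exact tendsto_nhds_unique (hL s (by simp; linarith)) (tendsto_zetaTrunc_of_one_lt_re hs)
  rw [← hEq hs]
  exact hLb s hs N hN

/-- The Euler–Maclaurin approximation to `ζ` at first order. -/
lemma norm_riemannZeta_sub_sum_le {s : ℂ} (hs : 0 < s.re) (hs1 : s ≠ 1) {N : ℕ} (hN : 1 ≤ N) :
    ‖riemannZeta s - ∑ n ∈ Finset.Icc 1 N, (n : ℂ) ^ (-s) - (N : ℂ) ^ (1 - s) / (s - 1)‖ ≤
      ‖s‖ / s.re * (N : ℝ) ^ (-s.re) := by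
  have h0 : s - 1 ≠ 0 := sub_ne_zero.2 hs1
  have h := norm_riemannZeta₁_sub_zetaTrunc_le hs hN
  have e : riemannZeta₁ s - zetaTrunc N s = (s - 1) * (riemannZeta s -
      ∑ n ∈ Finset.Icc 1 N, (n : ℂ) ^ (-s) - (N : ℂ) ^ (1 - s) / (s - 1)) := by
    rw [riemannZeta_eq_inv_sub_mul hs1, zetaTrunc]
    field_simp
    ring
  rw [e, norm_mul, mul_div_assoc, mul_assoc] at h
  exact le_of_mul_le_mul_left h (norm_pos_iff.2 h0)

/-- `e x = exp (2 * π * i * x)`. -/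
noncomputable def e (x : ℝ) : ℂ := Complex.exp ((2 * π * x : ℝ) * Complex.I)

@[simp] lemma norm_e (x : ℝ) : ‖e x‖ = 1 := Complex.norm_exp_ofReal_mul_I _

lemma e_add (x y : ℝ) : e (x + y) = e x * e y := by
  rw [e, e, e, ← Complex.exp_add]
  congr 1
  push_cast
  ring

lemma e_neg (x : ℝ) : e (-x) = (starRingEnd ℂ) (e x) := by
  rw [e, e, ← Complex.exp_conj, map_mul, Complex.conj_ofReal, Complex.conj_I]
  congr 1
  push_cast
  ring

lemma e_int (n : ℤ) : e n = 1 := by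
  rw [e, Complex.exp_eq_one_iff]
  exact ⟨n, by push_cast; ring⟩

lemma e_sub_int (x : ℝ) (n : ℤ) : e (x - n) = e x := by
  have := e_add (x - n) n
  rw [sub_add_cancel, e_int, mul_one] at this
  exact this.symm

lemma norm_sum_e_le (f : ℕ → ℝ) (s : Finset ℕ) : ‖∑ n ∈ s, e (f n)‖ ≤ s.card := by
  simpa using norm_sum_le s fun n => e (f n)

/-- `cot (π x)`. -/
noncomputable def cotPi (x : ℝ) : ℝ := cos (π * x) / sin (π * x)

lemma two_mul_le_sin_pi_mul {θ x : ℝ} (hθ : 0 < θ) (h1 : θ ≤ x) (h2 : x ≤ 1 - θ) :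
    2 * θ ≤ sin (π * x) := by
  rcases le_total x (1 / 2) with h | h
  · have := mul_le_sin (x := π * x) (by have := pi_pos; nlinarith) (by have := pi_pos; nlinarith)
    have e : 2 / π * (π * x) = 2 * x := by have := pi_ne_zero; field_simp
    linarith
  · have := mul_le_sin (x := π * (1 - x)) (by have := pi_pos; nlinarith)
      (by have := pi_pos; nlinarith)
    have e : 2 / π * (π * (1 - x)) = 2 * (1 - x) := by have := pi_ne_zero; field_simp
    have e2 : sin (π * (1 - x)) = sin (π * x) := by rw [mul_sub, mul_one, sin_pi_sub]
    linarith

lemma abs_cotPi_le {θ x : ℝ} (hθ : 0 < θ) (h1 : θ ≤ x) (h2 : x ≤ 1 - θ) :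
    |cotPi x| ≤ 1 / (2 * θ) := by
  have h := two_mul_le_sin_pi_mul hθ h1 h2
  rw [cotPi, abs_div, abs_of_pos (a := sin (π * x)) (by linarith)]
  gcongr
  exact abs_cos_le_one _

lemma cotPi_antitone {x y : ℝ} (h1 : 0 < x) (h2 : x ≤ y) (h3 : y < 1) : cotPi y ≤ cotPi x := by
  have hp := pi_pos
  have sx : 0 < sin (π * x) := sin_pos_of_pos_of_lt_pi (by positivity) (by nlinarith)
  have sy : 0 < sin (π * y) := sin_pos_of_pos_of_lt_pi (by nlinarith) (by nlinarith)
  rw [cotPi, cotPi, div_le_div_iff₀ sy sx]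
  have : 0 ≤ sin (π * y - π * x) := sin_nonneg_of_nonneg_of_le_pi (by nlinarith) (by nlinarith)
  rw [sin_sub] at this
  linarith

lemma one_sub_e_mul {x : ℝ} (h1 : 0 < x) (h3 : x < 1) :
    (1 - e x) * (1 / 2 + Complex.I / 2 * cotPi x) = 1 := by
  have hp := pi_pos
  have sx : (Complex.sin (π * x) : ℂ) ≠ 0 := by
    have : 0 < sin (π * x) := sin_pos_of_pos_of_lt_pi (by positivity) (by nlinarith)
    exact_mod_cast this.ne'
  have he : e x = (Complex.cos (π * x) + Complex.sin (π * x) * Complex.I) ^ 2 := by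
    rw [Complex.cos_add_sin_I, ← Complex.exp_nat_mul, e]
    congr 1
    push_cast
    ring
  rw [he, cotPi]
  push_cast
  have h := Complex.sin_sq_add_cos_sq (π * x : ℂ)
  set s := Complex.sin (π * x)
  set c := Complex.cos (π * x)
  field_simp
  have hI := Complex.I_sq
  have : s ^ 2 = 1 - c ^ 2 := by linear_combination h
  ring_nf
  simp only [show Complex.I ^ 3 = -Complex.I by rw [pow_succ, hI]; ring, hI]
  have h3 : s ^ 3 = s * (1 - c ^ 2) := by rw [← this]; ring
  rw [h3, this]
  ring

/-- The Kusmin–Landau inequality. -/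
lemma norm_sum_e_le_of_monotone {f : ℕ → ℝ} {L : ℕ} {θ : ℝ} (ν : ℤ) (hθ : 0 < θ)
    (h1 : ∀ n < L, ν + θ ≤ f (n + 1) - f n) (h2 : ∀ n < L, f (n + 1) - f n ≤ ν + 1 - θ)
    (hm : ∀ n, n + 1 < L → f (n + 1) - f n ≤ f (n + 2) - f (n + 1)) :
    ‖∑ n ∈ Finset.range L, e (f n)‖ ≤ 2 / θ := by
  set c : ℕ → ℂ := fun n => 1 / 2 + Complex.I / 2 * cotPi (f (n + 1) - f n - ν) with hc
  have hz : ∀ n < L, e (f n) = (e (f n) - e (f (n + 1))) * c n := by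
    intro n hn
    have := one_sub_e_mul (x := f (n + 1) - f n - ν) (by linarith [h1 n hn]) (by linarith [h2 n hn])
    rw [e_sub_int] at this
    have h3 : e (f (n + 1)) = e (f n) * e (f (n + 1) - f n) := by rw [← e_add]; congr 1; ring
    rw [h3]
    linear_combination - e (f n) * this
  have hcb : ∀ n < L, ‖c n‖ ≤ 1 / 2 + 1 / (4 * θ) := by
    intro n hn
    have := abs_cotPi_le (x := f (n + 1) - f n - ν) hθ (by linarith [h1 n hn])
        (by linarith [h2 n hn])
    refine (norm_add_le _ _).trans ?_
    rw [norm_mul, Complex.norm_real, Real.norm_eq_abs]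
    simp only [norm_div, Complex.norm_I, norm_one, Complex.norm_ofNat]
    have : 1 / 2 * |cotPi (f (n + 1) - f n - ν)| ≤ 1 / 2 * (1 / (2 * θ)) := by gcongr
    refine (add_le_add_right this _).trans (le_of_eq ?_)
    field_simp
    ring
  -- summation by parts
  have key : ∀ m < L, ‖∑ n ∈ Finset.range (m + 1), (e (f n) - e (f (n + 1))) * c n +
      e (f (m + 1)) * c m‖ ≤ ‖c 0‖ +
        1 / 2 * (cotPi (f 1 - f 0 - ν) - cotPi (f (m + 1) - f m - ν)) := by
    intro m hmL
    induction m with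
    | zero => simp [sub_mul]
    | succ m ih =>
      have ih := ih (by omega)
      rw [Finset.sum_range_succ]
      have e1 : ∑ n ∈ Finset.range (m + 1), (e (f n) - e (f (n + 1))) * c n +
          (e (f (m + 1)) - e (f (m + 1 + 1))) * c (m + 1) + e (f (m + 1 + 1)) * c (m + 1) =
          (∑ n ∈ Finset.range (m + 1), (e (f n) - e (f (n + 1))) * c n + e (f (m + 1)) * c m) +
          e (f (m + 1)) * (c (m + 1) - c m) := by ring
      rw [e1]
      refine (norm_add_le _ _).trans ?_
      have h3 : cotPi (f (m + 1 + 1) - f (m + 1) - ν) ≤ cotPi (f (m + 1) - f m - ν) :=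
        cotPi_antitone (by linarith [h1 m (by omega)]) (by linarith [hm m hmL])
          (by linarith [h2 (m + 1) hmL])
      have h4 : ‖e (f (m + 1)) * (c (m + 1) - c m)‖ = 1 / 2 * (cotPi (f (m + 1) - f m - ν) -
          cotPi (f (m + 1 + 1) - f (m + 1) - ν)) := by
        have : c (m + 1) - c m = Complex.I / 2 * ((cotPi (f (m + 1 + 1) - f (m + 1) - ν) -
          cotPi (f (m + 1) - f m - ν) : ℝ) : ℂ) := by
          simp only [hc]; push_cast; ring
        rw [this, norm_mul, norm_e, norm_mul, Complex.norm_real, Real.norm_eq_abs,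
          abs_of_nonpos (by linarith)]
        simp
      rw [h4]
      linarith
  rcases L.eq_zero_or_pos with rfl | hL
  · simp; positivity
  obtain ⟨m, rfl⟩ : ∃ m, L = m + 1 := ⟨L - 1, by omega⟩
  have hθ2 : 2 * θ ≤ 1 := by linarith [h1 0 hL, h2 0 hL]
  have k := key m (by omega)
  rw [← Finset.sum_congr rfl fun n hn => hz n (Finset.mem_range.1 hn)] at k
  have a1 := abs_le.1 (abs_cotPi_le (x := f (0 + 1) - f 0 - ν) hθ (by linarith [h1 0 hL])
    (by linarith [h2 0 hL]))
  have a2 := abs_le.1 (abs_cotPi_le (x := f (m + 1) - f m - ν) hθ (by linarith [h1 m (by omega)])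
    (by linarith [h2 m (by omega)]))
  have b1 := hcb 0 hL
  have b2 := hcb m (by omega)
  have h5 := norm_sub_le (∑ n ∈ Finset.range (m + 1), e (f n) + e (f (m + 1)) * c m)
    (e (f (m + 1)) * c m)
  rw [add_sub_cancel_right, norm_mul (e _), norm_e, one_mul] at h5
  simp only [zero_add] at a1
  have t1 : 1 / (4 * θ) = 1 / 4 * (1 / θ) := by field_simp
  have t2 : 1 / (2 * θ) = 1 / 2 * (1 / θ) := by field_simp
  have t3 : 2 / θ = 2 * (1 / θ) := by field_simp
  have t4 : 2 ≤ 1 / θ := by rw [le_div_iff₀ hθ]; linarith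
  rw [t1] at b1 b2
  rw [t2] at a1 a2
  rw [t3]
  linarith [a1.2, a2.1]

/-- The number of indices at which a sequence with increments at least `lam` stays below a
threshold. -/
lemma exists_threshold {g : ℕ → ℝ} {L : ℕ} (hg : ∀ n, n + 1 < L → g n ≤ g (n + 1)) (α : ℝ) :
    ∃ m ≤ L, (∀ n < m, g n < α) ∧ ∀ n, m ≤ n → n < L → α ≤ g n := by
  classical
  have hex : ∃ n, L ≤ n ∨ α ≤ g n := ⟨L, Or.inl le_rfl⟩
  refine ⟨Nat.find hex, Nat.find_min' hex (Or.inl le_rfl), fun n hn => ?_, fun n hn hnL => ?_⟩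
  · have := Nat.find_min hex hn
    push Not at this
    exact this.2
  · induction n, hn using Nat.le_induction with
    | base => exact (Nat.find_spec hex).resolve_left (by omega)
    | succ n hn ih => exact (ih (by omega)).trans (hg n hnL)

lemma mul_lt_of_increments {g : ℕ → ℝ} {L : ℕ} {lam α β : ℝ} (hl : 0 < lam)
    (hg : ∀ n, n + 1 < L → g n + lam ≤ g (n + 1)) (h1 : ∀ n < L, α ≤ g n)
    (h2 : ∀ n < L, g n < β) (hαβ : α ≤ β) : (L : ℝ) ≤ (β - α) / lam + 1 := by
  have key : ∀ n < L, g 0 + n * lam ≤ g n := by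
    intro n
    induction n with
    | zero => simp
    | succ n ih => intro hn; push_cast; linarith [ih (by omega), hg n hn]
  rcases L.eq_zero_or_pos with rfl | hL
  · have : 0 ≤ β - α := by linarith
    simp; positivity
  obtain ⟨m, rfl⟩ : ∃ m, L = m + 1 := ⟨L - 1, by omega⟩
  have := key m (by omega)
  push_cast
  have h3 : (m : ℝ) ≤ (β - α) / lam := by
    rw [le_div_iff₀ hl]
    linarith [h1 0 hL, h2 m (by omega)]
  linarith

lemma sum_range_split (F : ℕ → ℂ) {m L : ℕ} (h : m ≤ L) :
    ∑ n ∈ Finset.range L, F n =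
      ∑ n ∈ Finset.range m, F n + ∑ n ∈ Finset.range (L - m), F (m + n) := by
  obtain ⟨k, rfl⟩ := Nat.exists_eq_add_of_le h
  rw [Finset.sum_range_add, Nat.add_sub_cancel_left]

/-- Exponential sums whose increments stay in one unit interval. -/
lemma norm_sum_e_le_unit {f : ℕ → ℝ} {L : ℕ} {θ lam : ℝ} (ν : ℤ) (hθ : 0 < θ)
    (hl : 0 < lam)
    (hg : ∀ n, n + 1 < L → f (n + 1) - f n + lam ≤ f (n + 2) - f (n + 1))
    (h1 : ∀ n < L, ν ≤ f (n + 1) - f n) (h2 : ∀ n < L, f (n + 1) - f n < ν + 1) :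
    ‖∑ n ∈ Finset.range L, e (f n)‖ ≤ 2 * (θ / lam + 1) + 2 / θ := by
  obtain ⟨m, hmL, hm1, hm2⟩ := exists_threshold (g := fun n => f (n + 1) - f n) (L := L)
    (fun n hn => by have := hg n hn; linarith) (ν + θ)
  rw [sum_range_split _ hmL]
  have A : (m : ℝ) ≤ θ / lam + 1 := by
    have := mul_lt_of_increments (g := fun n => f (n + 1) - f n) (L := m) (α := ν) (β := ν + θ) hl
      (fun n hn => hg n (by omega)) (fun n hn => h1 n (by omega)) hm1 (by linarith)
    simpa using this
  obtain ⟨k, hkL, hk1, hk2⟩ := exists_threshold (g := fun n => f (m + n + 1) - f (m + n))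
    (L := L - m) (fun n hn => by
      have := hg (m + n) (by omega)
      rw [show m + (n + 1) + 1 = m + n + 2 by ring, show m + (n + 1) = m + n + 1 by ring]
      linarith) (ν + 1 - θ)
  rw [sum_range_split _ hkL]
  have B : ((L - m - k : ℕ) : ℝ) ≤ θ / lam + 1 := by
    have := mul_lt_of_increments (g := fun n => f (m + (k + n) + 1) - f (m + (k + n)))
      (L := L - m - k) (α := ν + 1 - θ) (β := ν + 1) hl
      (fun n hn => hg (m + (k + n)) (by omega)) (fun n hn => hk2 (k + n) (by omega) (by omega))
      (fun n hn => h2 _ (by omega)) (by linarith)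
    simpa using this
  have C : ‖∑ n ∈ Finset.range k, e (f (m + n))‖ ≤ 2 / θ := by
    refine norm_sum_e_le_of_monotone (f := fun n => f (m + n)) ν hθ (fun n hn => ?_)
      (fun n hn => ?_) fun n hn => ?_
    · exact hm2 (m + n) (by omega) (by omega)
    · exact (hk1 n hn).le
    · have := hg (m + n) (by omega)
      simp only [← add_assoc]
      linarith
  have A' := norm_sum_e_le f (Finset.range m)
  have B' := norm_sum_e_le (fun n => f (m + (k + n))) (Finset.range (L - m - k))
  rw [Finset.card_range] at A' B'
  refine (norm_add_le _ _).trans ?_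
  have := norm_add_le (∑ n ∈ Finset.range k, e (f (m + n)))
    (∑ n ∈ Finset.range (L - m - k), e (f (m + (k + n))))
  linarith

lemma norm_sum_e_le_units {θ lam : ℝ} (hθ : 0 < θ) (hl : 0 < lam) (K : ℕ) :
    ∀ {f : ℕ → ℝ} {L : ℕ} (ν : ℤ),
    (∀ n, n + 1 < L → f (n + 1) - f n + lam ≤ f (n + 2) - f (n + 1)) →
    (∀ n < L, ν ≤ f (n + 1) - f n) → (∀ n < L, f (n + 1) - f n < ν + K) →
    ‖∑ n ∈ Finset.range L, e (f n)‖ ≤ K * (2 * (θ / lam + 1) + 2 / θ) := by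
  induction K with
  | zero =>
    intro f L ν _ h1 h2
    rcases L.eq_zero_or_pos with rfl | hL
    · simp
    · have := h1 0 hL
      have := h2 0 hL
      simp at *
      linarith
  | succ K ih =>
    intro f L ν hg h1 h2
    obtain ⟨m, hmL, hm1, hm2⟩ := exists_threshold (g := fun n => f (n + 1) - f n) (L := L)
      (fun n hn => by have := hg n hn; linarith) (ν + 1)
    rw [sum_range_split _ hmL]
    refine (norm_add_le _ _).trans ?_
    have A := norm_sum_e_le_unit (f := f) (L := m) ν hθ hl (fun n hn => hg n (by omega))
      (fun n hn => h1 n (by omega)) hm1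
    have B := ih (f := fun n => f (m + n)) (L := L - m) (ν + 1) (fun n hn => ?_) (fun n hn => ?_)
      fun n hn => ?_
    · push_cast
      linarith
    · exact hg (m + n) (by omega)
    · push_cast
      exact hm2 (m + n) (by omega) (by omega)
    · have := h2 (m + n) (by omega)
      push_cast at this ⊢
      rw [← add_assoc]
      linarith

/-- The second derivative test, in terms of second differences. -/
lemma norm_sum_e_le_second {f : ℕ → ℝ} {L : ℕ} {lam c : ℝ} (hl : 0 < lam) (hc : 1 ≤ c)
    (hg : ∀ n < L, f (n + 1) - f n + lam ≤ f (n + 2) - f (n + 1))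
    (hg' : ∀ n < L, f (n + 2) - f (n + 1) ≤ f (n + 1) - f n + c * lam) :
    ‖∑ n ∈ Finset.range L, e (f n)‖ ≤ 6 * (c * lam * L + 2) * lam ^ (-(1 / 2) : ℝ) := by
  set r : ℝ := lam ^ (1 / 2 : ℝ) with hr
  have hr0 : 0 < r := rpow_pos_of_pos hl _
  have hrr : r * r = lam := by rw [hr, ← rpow_add hl]; norm_num
  have hri : lam ^ (-(1 / 2) : ℝ) = 1 / r := by rw [rpow_neg hl.le, ← hr, one_div]
  rw [hri]
  rcases lt_or_ge (1 / 2) r with hr2 | hr2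
  · refine (norm_sum_e_le f _).trans ?_
    rw [Finset.card_range, ← hrr, mul_one_div, le_div_iff₀ hr0]
    have h0 : (0 : ℝ) ≤ L := by positivity
    have : r * L ≤ 6 * (1 * (r * r) * L) := by nlinarith [mul_nonneg hr0.le h0]
    have : 6 * (1 * (r * r) * L) ≤ 6 * (c * (r * r) * L) := by gcongr
    linarith
  rcases L.eq_zero_or_pos with rfl | hL
  · simp; positivity
  set D := f (0 + 1) - f 0
  have hup : ∀ n, n ≤ L → f (n + 1) - f n ≤ D + n * (c * lam) := by
    intro n
    induction n with
    | zero => simp [D]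
    | succ n ih =>
      intro hn
      have := ih (by omega)
      have := hg' n (by omega)
      push_cast
      linarith
  have hlo : ∀ n, n ≤ L → D ≤ f (n + 1) - f n := by
    intro n
    induction n with
    | zero => simp [D]
    | succ n ih =>
      intro hn
      have := ih (by omega)
      have := hg n (by omega)
      linarith
  have hcl : 0 ≤ c * lam := by positivity
  set K : ℕ := ⌈c * lam * L + 1⌉₊ with hK
  have hK1 : c * lam * L + 1 ≤ K := Nat.le_ceil _
  have hK2 : (K : ℝ) < c * lam * L + 1 + 1 := Nat.ceil_lt_add_one (by positivity)
  have := norm_sum_e_le_units hr0 hl K (f := f) (L := L) ⌊D⌋ (fun n hn => hg n (by omega))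
    (fun n hn => (Int.floor_le D).trans (hlo n hn.le)) (fun n hn => by
      have h1 := hup n hn.le
      have h2 := Int.lt_floor_add_one D
      have h3 : n * (c * lam) ≤ L * (c * lam) := by gcongr
      linarith)
  refine this.trans ?_
  have h4 : r / lam = 1 / r := by rw [← hrr]; field_simp
  have h5 : 2 ≤ 1 / r := by rw [le_div_iff₀ hr0]; linarith
  rw [h4, show 2 / r = 2 * (1 / r) by ring]
  have h6 : 2 * (1 / r + 1) + 2 * (1 / r) ≤ 6 * (1 / r) := by linarith
  calc (K : ℝ) * (2 * (1 / r + 1) + 2 * (1 / r)) ≤ (c * lam * L + 2) * (6 * (1 / r)) := by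
        gcongr; linarith
    _ = _ := by ring

open ComplexConjugate in
/-- The Weyl–van der Corput differencing inequality. -/
lemma norm_sum_sq_le_of_correlations {z : ℕ → ℂ} (hz : ∀ n, ‖z n‖ ≤ 1) {L H : ℕ} (hH : 1 ≤ H)
    {M : ℕ → ℝ} (hM0 : ∀ r, 0 ≤ M r) (hM00 : (L : ℝ) ≤ M 0)
    (hM : ∀ r, 1 ≤ r → r < H → ‖∑ n ∈ Finset.range (L - r), z (n + r) * conj (z n)‖ ≤ M r) :
    ‖∑ n ∈ Finset.range L, z n‖ ^ 2 ≤ 2 * (L + H) / H * ∑ r ∈ Finset.range H, M r := by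
  classical
  set w : ℕ → ℕ → ℂ := fun h m => if h ≤ m ∧ m < h + L then z (m - h) else 0 with hw
  set S := ∑ n ∈ Finset.range L, z n with hS
  have hsum : ∀ h < H, ∑ m ∈ Finset.range (L + H), w h m = S := by
    intro h hh
    rw [← Finset.sum_subset (s₁ := Finset.Ico h (h + L))]
    · rw [Finset.sum_Ico_eq_sum_range, Nat.add_sub_cancel_left, hS]
      refine Finset.sum_congr rfl fun n hn => ?_
      have := Finset.mem_range.1 hn
      simp [hw, this]
    · intro m hm
      simp only [Finset.mem_Ico, Finset.mem_range] at *
      omega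
    · intro m _ hm
      simp only [Finset.mem_Ico] at hm
      simp [hw, hm]
  have hcor : ∀ h < H, ∀ h' ≤ h,
      ‖∑ m ∈ Finset.range (L + H), w h m * conj (w h' m)‖ ≤ M (h - h') := by
    intro h hh h' hh'
    have e1 : ∑ m ∈ Finset.range (L + H), w h m * conj (w h' m) =
        conj (∑ n ∈ Finset.range (L - (h - h')), z (n + (h - h')) * conj (z n)) := by
      rw [← Finset.sum_subset (s₁ := Finset.Ico h (h' + L)), Finset.sum_Ico_eq_sum_range, map_sum,
        show h' + L - h = L - (h - h') by omega]
      · refine Finset.sum_congr rfl fun n hn => ?_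
        have := Finset.mem_range.1 hn
        have h1 : h ≤ h + n ∧ h + n < h + L := by omega
        have h2 : h' ≤ h + n ∧ h + n < h' + L := by omega
        simp only [hw, h1, h2, and_self, if_true, map_mul, Complex.conj_conj]
        rw [show h + n - h = n by omega, show h + n - h' = n + (h - h') by omega, mul_comm]
      · intro m hm
        simp only [Finset.mem_Ico, Finset.mem_range] at *
        omega
      · intro m _ hm
        simp only [Finset.mem_Ico] at hm
        by_cases h1 : h ≤ m ∧ m < h + L
        · have h2 : ¬ (h' ≤ m ∧ m < h' + L) := by omega
          simp [hw, h2]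
        · simp [hw, h1]
    rw [e1, RCLike.norm_conj]
    rcases Nat.eq_zero_or_pos (h - h') with h0 | h0
    · rw [h0]
      refine (norm_sum_le _ _).trans (le_trans ?_ hM00)
      refine (Finset.sum_le_card_nsmul _ _ 1 fun n _ => ?_).trans (by simp)
      rw [norm_mul, RCLike.norm_conj]
      exact mul_le_one₀ (hz _) (norm_nonneg _) (hz _)
    · exact hM _ h0 (by omega)
  have hcor' : ∀ h < H, ∀ h' < H, ‖∑ m ∈ Finset.range (L + H), w h m * conj (w h' m)‖ ≤
      M ((h - h') + (h' - h)) := by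
    intro h hh h' hh'
    rcases le_total h' h with hle | hle
    · simpa [Nat.sub_eq_zero_of_le hle] using hcor h hh h' hle
    · have : ∑ m ∈ Finset.range (L + H), w h m * conj (w h' m) =
          conj (∑ m ∈ Finset.range (L + H), w h' m * conj (w h m)) := by
        rw [map_sum]
        refine Finset.sum_congr rfl fun m _ => ?_
        rw [map_mul, Complex.conj_conj, mul_comm]
      rw [this, RCLike.norm_conj]
      simpa [Nat.sub_eq_zero_of_le hle] using hcor h' hh' h hle
  have hrow : ∀ h < H, ∑ h' ∈ Finset.range H, M ((h - h') + (h' - h)) ≤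
      2 * ∑ r ∈ Finset.range H, M r := by
    intro h hh
    rw [← Finset.sum_range_add_sum_Ico _ hh.le, two_mul]
    refine add_le_add ?_ ?_
    · have e1 : ∑ h' ∈ Finset.range h, M ((h - h') + (h' - h)) =
          ∑ h' ∈ Finset.range h, M (h - 1 - h' + 1) := by
        refine Finset.sum_congr rfl fun n hn => ?_
        have := Finset.mem_range.1 hn
        congr 1
        omega
      rw [e1, Finset.sum_range_reflect (fun r => M (r + 1)) h]
      have := Finset.sum_range_succ' M h
      have h3 : ∑ r ∈ Finset.range (h + 1), M r ≤ ∑ r ∈ Finset.range H, M r :=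
        Finset.sum_le_sum_of_subset_of_nonneg (Finset.range_mono hh) fun r _ _ => hM0 r
      linarith [hM0 0]
    · rw [Finset.sum_Ico_eq_sum_range]
      have e1 : ∑ k ∈ Finset.range (H - h), M ((h - (h + k)) + (h + k - h)) =
          ∑ k ∈ Finset.range (H - h), M k := by
        refine Finset.sum_congr rfl fun n hn => ?_
        congr 1
        omega
      rw [e1]
      exact Finset.sum_le_sum_of_subset_of_nonneg (Finset.range_mono (by omega)) fun r _ _ => hM0 r
  have hHS : (H : ℂ) * S = ∑ m ∈ Finset.range (L + H), ∑ h ∈ Finset.range H, w h m := by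
    rw [Finset.sum_comm, Finset.sum_congr rfl fun h hh => hsum h (Finset.mem_range.1 hh)]
    simp
  have hsq : ∑ m ∈ Finset.range (L + H), ‖∑ h ∈ Finset.range H, w h m‖ ^ 2 ≤
      H * (2 * ∑ r ∈ Finset.range H, M r) := by
    have e1 : ((∑ m ∈ Finset.range (L + H), ‖∑ h ∈ Finset.range H, w h m‖ ^ 2 : ℝ) : ℂ) =
        ∑ h ∈ Finset.range H, ∑ h' ∈ Finset.range H,
          ∑ m ∈ Finset.range (L + H), w h m * conj (w h' m) := by
      push_cast
      rw [Finset.sum_congr rfl fun m _ => by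
        rw [← Complex.mul_conj', map_sum, Finset.sum_mul_sum], Finset.sum_comm]
      refine Finset.sum_congr rfl fun h _ => ?_
      rw [Finset.sum_comm]
    have e2 : ∑ m ∈ Finset.range (L + H), ‖∑ h ∈ Finset.range H, w h m‖ ^ 2 =
        ‖((∑ m ∈ Finset.range (L + H), ‖∑ h ∈ Finset.range H, w h m‖ ^ 2 : ℝ) : ℂ)‖ := by
      rw [Complex.norm_real, Real.norm_eq_abs, abs_of_nonneg (by positivity)]
    rw [e2, e1]
    refine (norm_sum_le _ _).trans ?_
    refine (Finset.sum_le_card_nsmul _ _ (2 * ∑ r ∈ Finset.range H, M r) fun h hh => ?_).trans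
      (by simp)
    refine (norm_sum_le _ _).trans (le_trans (Finset.sum_le_sum fun h' hh' =>
      hcor' h (Finset.mem_range.1 hh) h' (Finset.mem_range.1 hh')) (hrow h (Finset.mem_range.1 hh)))
  have h1 : ‖(H : ℂ) * S‖ ^ 2 ≤ (L + H) * (H * (2 * ∑ r ∈ Finset.range H, M r)) := by
    rw [hHS]
    calc _ ≤ (∑ m ∈ Finset.range (L + H), ‖∑ h ∈ Finset.range H, w h m‖) ^ 2 := by
          gcongr; exact norm_sum_le _ _
      _ ≤ _ := sq_sum_le_card_mul_sum_sq
      _ ≤ _ := by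
          rw [Finset.card_range]; push_cast
          gcongr
  have hH0 : (0 : ℝ) < H := by exact_mod_cast hH
  rw [norm_mul, Complex.norm_natCast] at h1
  have h2 : ‖S‖ ^ 2 * H ≤ 2 * (L + H) * ∑ r ∈ Finset.range H, M r := by
    refine le_of_mul_le_mul_left ?_ hH0
    nlinarith
  rw [div_mul_eq_mul_div, le_div_iff₀ hH0]
  exact h2

lemma sum_one_div_sqrt_le (n : ℕ) : ∑ r ∈ Finset.range n, 1 / √((r : ℝ) + 1) ≤ 2 * √n := by
  induction n with
  | zero => simp
  | succ n ih =>
    rw [Finset.sum_range_succ]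
    push_cast
    have h0 : 0 < √((n : ℝ) + 1) := sqrt_pos.2 (by positivity)
    have h1 : √(n : ℝ) ≤ √((n : ℝ) + 1) := sqrt_le_sqrt (by linarith)
    have h2 : √((n : ℝ) + 1) * √((n : ℝ) + 1) = n + 1 := mul_self_sqrt (by positivity)
    have h3 : √(n : ℝ) * √(n : ℝ) = n := mul_self_sqrt (by positivity)
    have : 1 / √((n : ℝ) + 1) ≤ 2 * √((n : ℝ) + 1) - 2 * √n := by
      rw [div_le_iff₀ h0]
      nlinarith [sq_nonneg (√((n : ℝ) + 1) - √n)]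
    linarith

/-- The third derivative test, in terms of third differences. -/
lemma norm_sum_e_sq_le_third {f : ℕ → ℝ} {L : ℕ} {lam c : ℝ} (hl : 0 < lam) (hc : 1 ≤ c)
    (hg : ∀ n < L, lam ≤ f (n + 3) - 3 * f (n + 2) + 3 * f (n + 1) - f n)
    (hg' : ∀ n < L, f (n + 3) - 3 * f (n + 2) + 3 * f (n + 1) - f n ≤ c * lam) :
    ‖∑ n ∈ Finset.range L, e (f n)‖ ^ 2 ≤
      200 * c * (L ^ 2 * lam ^ (1 / 3 : ℝ) + L / lam ^ (1 / 3 : ℝ)) := by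
  set u : ℝ := lam ^ (1 / 3 : ℝ) with hu
  have hu0 : 0 < u := rpow_pos_of_pos hl _
  have hu3 : u ^ 3 = lam := by
    rw [hu, ← rpow_natCast, ← rpow_mul hl.le]; norm_num
  have hL0 : (0 : ℝ) ≤ L := by positivity
  have triv : ‖∑ n ∈ Finset.range L, e (f n)‖ ^ 2 ≤ (L : ℝ) ^ 2 := by
    have := norm_sum_e_le f (Finset.range L)
    rw [Finset.card_range] at this
    gcongr
  have h200 : (1 : ℝ) ≤ 200 * c := by linarith
  rcases lt_or_ge 1 u with hu1 | hu1
  · refine triv.trans ?_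
    have h1 : (L : ℝ) ^ 2 * 1 ≤ L ^ 2 * u := by gcongr
    have h2 : 0 ≤ L / u := by positivity
    calc (L : ℝ) ^ 2 ≤ 1 * (L ^ 2 * u + L / u) := by linarith
      _ ≤ _ := by gcongr
  set H : ℕ := ⌈1 / u⌉₊ with hH
  have hHl : 1 / u ≤ H := Nat.le_ceil _
  have hone : 1 ≤ 1 / u := by rw [le_div_iff₀ hu0]; linarith
  have hHu : (H : ℝ) ≤ 2 / u := by
    have := Nat.ceil_lt_add_one (show (0 : ℝ) ≤ 1 / u by positivity)
    rw [show 2 / u = 2 * (1 / u) by ring]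
    linarith
  have hH1 : 1 ≤ H := by exact_mod_cast hone.trans hHl
  rcases lt_or_ge L H with hLH | hLH
  · refine triv.trans ?_
    have h1 : (L : ℝ) ≤ 2 / u := le_trans (by exact_mod_cast hLH.le) hHu
    have h2 : 0 ≤ (L : ℝ) ^ 2 * u := by positivity
    have h3 : 0 ≤ L / u := by positivity
    calc (L : ℝ) ^ 2 ≤ L * (2 / u) := by rw [sq]; gcongr
      _ = 2 * (L / u) := by ring
      _ ≤ 200 * c * (L / u) := by gcongr; linarith
      _ ≤ _ := by gcongr; linarith
  have hsl : 0 < √lam := sqrt_pos.2 hl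
  have hslu : √lam * √lam = u ^ 3 := by rw [mul_self_sqrt hl.le, hu3]
  set M : ℕ → ℝ := fun r => if r = 0 then (L : ℝ) else
    12 * c * L * u + 12 * (1 / √lam) * (1 / √(r : ℝ)) with hMdef
  have hM := norm_sum_sq_le_of_correlations (z := fun n => e (f n)) (fun n => (norm_e _).le)
    (L := L) hH1 (M := M) (fun r => by simp only [hMdef]; split_ifs <;> positivity)
        (by simp [hMdef])
    (fun r hr1 hrH => by
      have hr0 : (0 : ℝ) < r := by exact_mod_cast hr1
      have hrl : 0 < r * lam := by positivity
      have eq : ∀ n, e (f (n + r)) * (starRingEnd ℂ) (e (f n)) = e (f (n + r) - f n) := by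
        intro n; rw [← e_neg, ← e_add, sub_eq_add_neg]
      simp only [eq]
      have hdiff : ∀ k n, n + k ≤ L → k * lam ≤ (f (n + k + 2) - 2 * f (n + k + 1) + f (n + k)) -
          (f (n + 2) - 2 * f (n + 1) + f n) ∧ (f (n + k + 2) - 2 * f (n + k + 1) + f (n + k)) -
          (f (n + 2) - 2 * f (n + 1) + f n) ≤ k * (c * lam) := by
        intro k n
        induction k with
        | zero => intro _; simp
        | succ k ih =>
          intro hk
          have i1 := ih (by omega)
          have i2 := hg (n + k) (by omega)
          have i3 := hg' (n + k) (by omega)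
          push_cast
          simp only [← add_assoc]
          constructor <;> linarith [i1.1, i1.2]
      have main := norm_sum_e_le_second (f := fun n => f (n + r) - f n) (L := L - r) hrl hc
        (fun n hn => by
          have := (hdiff r n (by omega)).1
          rw [show n + 1 + r = n + r + 1 by ring, show n + 2 + r = n + r + 2 by ring]
          linarith)
        (fun n hn => by
          have := (hdiff r n (by omega)).2
          rw [show n + 1 + r = n + r + 1 by ring, show n + 2 + r = n + r + 2 by ring]
          linarith)
      refine main.trans ?_
      have hr00 : r ≠ 0 := by omega
      simp only [hMdef, hr00, if_false]
      have e1 : ((r : ℝ) * lam) ^ (-(1 / 2) : ℝ) = 1 / (√r * √lam) := by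
        rw [rpow_neg hrl.le, ← sqrt_eq_rpow, sqrt_mul hr0.le, one_div]
      rw [e1]
      have hsr : 0 < √(r : ℝ) := sqrt_pos.2 hr0
      have hsrr : √(r : ℝ) * √(r : ℝ) = r := mul_self_sqrt hr0.le
      have hLr : ((L - r : ℕ) : ℝ) ≤ L := by exact_mod_cast Nat.sub_le _ _
      have hb : √(r : ℝ) * √lam ≤ 2 * u := by
        rw [← sqrt_mul hr0.le, sqrt_le_left (by positivity)]
        have : (r : ℝ) ≤ 2 / u := le_trans (by exact_mod_cast hrH.le) hHu
        calc (r : ℝ) * lam ≤ 2 / u * u ^ 3 := by rw [hu3]; gcongr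
          _ = 2 * u ^ 2 := by field_simp
          _ ≤ _ := by nlinarith
      calc 6 * (c * (r * lam) * ((L - r : ℕ) : ℝ) + 2) * (1 / (√r * √lam))
          ≤ 6 * (c * (r * lam) * L + 2) * (1 / (√r * √lam)) := by gcongr
        _ = 6 * (c * ((√(r : ℝ) * √(r : ℝ)) * (√lam * √lam)) * L + 2) * (1 / (√r * √lam)) := by
            rw [hsrr, mul_self_sqrt hl.le]
        _ = 6 * c * L * (√r * √lam) + 12 * (1 / √lam) * (1 / √(r : ℝ)) := by field_simp; ring
        _ ≤ 6 * c * L * (2 * u) + 12 * (1 / √lam) * (1 / √(r : ℝ)) := by gcongr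
        _ = _ := by ring)
  refine hM.trans ?_
  have hH0 : (0 : ℝ) < H := by exact_mod_cast hH1
  have hsumM : ∑ r ∈ Finset.range H, M r ≤ L + 24 * c * L + 48 / u ^ 2 := by
    obtain ⟨K, hK⟩ : ∃ K, H = K + 1 := ⟨H - 1, by omega⟩
    have hKr : (K : ℝ) ≤ 2 / u := le_trans (by exact_mod_cast (by omega : K ≤ H)) hHu
    rw [hK, Finset.sum_range_succ']
    have e0 : M 0 = L := by simp [hMdef]
    have e1 : ∀ r, M (r + 1) = 12 * c * L * u + 12 * (1 / √lam) * (1 / √((r : ℝ) + 1)) := by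
      intro r; simp [hMdef]
    simp only [e1, e0]
    rw [Finset.sum_add_distrib, Finset.sum_const, Finset.card_range, nsmul_eq_mul, ← Finset.mul_sum]
    have h1 : (K : ℝ) * (12 * c * L * u) ≤ 2 / u * (12 * c * L * u) := by gcongr
    have h2 : 2 / u * (12 * c * L * u) = 24 * c * L := by field_simp; ring
    have h3 : 12 * (1 / √lam) * ∑ r ∈ Finset.range K, 1 / √((r : ℝ) + 1) ≤
        12 * (1 / √lam) * (2 * √K) := by gcongr; exact sum_one_div_sqrt_le K
    have h4 : √(K : ℝ) ≤ 2 * √lam / u ^ 2 := by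
      rw [sqrt_le_left (by positivity), div_pow, mul_pow, sq (√lam), hslu]
      refine hKr.trans (le_of_eq_of_le (b := 2 * u ^ 3 / (u ^ 2) ^ 2) (by field_simp) ?_)
      gcongr
      norm_num
    have h5 : 12 * (1 / √lam) * (2 * √K) ≤ 12 * (1 / √lam) * (2 * (2 * √lam / u ^ 2)) := by gcongr
    have h6 : 12 * (1 / √lam) * (2 * (2 * √lam / u ^ 2)) = 48 / u ^ 2 := by field_simp; ring
    linarith
  have hpre : 2 * ((L : ℝ) + H) / H ≤ 4 * L * u := by
    have : (H : ℝ) ≤ L := by exact_mod_cast hLH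
    rw [div_le_iff₀ hH0]
    have h1 : 1 ≤ u * H := by
      rw [div_le_iff₀ hu0] at hHl; linarith
    nlinarith
  calc _ ≤ 4 * L * u * (L + 24 * c * L + 48 / u ^ 2) := by
        refine mul_le_mul hpre hsumM ?_ (by positivity)
        exact Finset.sum_nonneg fun r _ => by simp only [hMdef]; split_ifs <;> positivity
    _ = (4 + 96 * c) * (L ^ 2 * u) + 192 * (L / u) := by field_simp; ring
    _ ≤ (200 * c) * (L ^ 2 * u) + 200 * c * (L / u) := by
        gcongr <;> linarith
    _ = _ := by ring

lemma half_le_log_one_add {u : ℝ} (h0 : 0 ≤ u) (h1 : u ≤ 1) : u / 2 ≤ log (1 + u) := by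
  have h := one_sub_inv_le_log_of_pos (x := 1 + u) (by linarith)
  refine le_trans ?_ h
  have e : 1 - (1 + u)⁻¹ = u / (1 + u) := by field_simp; ring
  rw [e, div_le_div_iff₀ (by norm_num) (by linarith)]
  nlinarith

lemma log_one_add_le {u : ℝ} (h0 : 0 ≤ u) : log (1 + u) ≤ u := by
  linarith [log_le_sub_one_of_pos (x := 1 + u) (by linarith)]

lemma log_second_difference {x : ℝ} (hx : 0 < x) :
    2 * log (x + 1) - log (x + 2) - log x = log (1 + 1 / (x * (x + 2))) := by
  have : 1 + 1 / (x * (x + 2)) = (x + 1) ^ 2 / (x * (x + 2)) := by field_simp; ring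
  rw [this, log_div (by positivity) (by positivity), log_pow, log_mul hx.ne' (by positivity)]
  push_cast; ring

lemma log_third_difference {x : ℝ} (hx : 0 < x) :
    log (x + 3) - 3 * log (x + 2) + 3 * log (x + 1) - log x =
      log (1 + (2 * x + 3) / (x * (x + 2) ^ 3)) := by
  have : 1 + (2 * x + 3) / (x * (x + 2) ^ 3) = (x + 3) * (x + 1) ^ 3 / (x * (x + 2) ^ 3) := by
    field_simp; ring
  rw [this, log_div (by positivity) (by positivity), log_mul (by positivity) (by positivity),
    log_mul hx.ne' (by positivity), log_pow, log_pow]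
  push_cast; ring

section blocks

variable {τ : ℝ} {N L : ℕ}

lemma norm_zeta_block_kusmin (hτ : 0 < τ) (hN : 1 ≤ N) (hτN : τ ≤ N / 2) (hL : L ≤ N) :
    ‖∑ n ∈ Finset.range L, e (-(τ * log ((N : ℝ) + n)))‖ ≤ 8 * N / τ := by
  have hN0 : (0 : ℝ) < N := by exact_mod_cast hN
  have hd : ∀ n : ℕ, log ((N : ℝ) + (n + 1 : ℕ)) - log ((N : ℝ) + n) =
      log (1 + 1 / ((N : ℝ) + n)) := by
    intro n
    rw [← log_div (by positivity) (by positivity)]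
    congr 1
    push_cast
    field_simp
    ring
  have hNn : ∀ n < L, (N : ℝ) + n ≤ 2 * N := by
    intro n hn
    have : (n : ℝ) ≤ N := by exact_mod_cast (by omega)
    linarith
  refine (norm_sum_e_le_of_monotone (θ := τ / (4 * N)) (-1) (by positivity)
    (fun n hn => ?_) (fun n hn => ?_) fun n hn => ?_).trans (le_of_eq ?_)
  · have h1 : log (1 + 1 / ((N : ℝ) + n)) ≤ 1 / N :=
      (log_one_add_le (by positivity)).trans (by gcongr; linarith [n.cast_nonneg (α := ℝ)])
    have h2 : τ * log (1 + 1 / ((N : ℝ) + n)) ≤ τ * (1 / N) := by gcongr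
    have h3 : τ * (1 / N) ≤ 1 / 2 := by
      rw [mul_one_div, div_le_div_iff₀ hN0 (by norm_num)]; linarith
    have h4 : τ / (4 * N) = τ * (1 / N) / 4 := by field_simp
    rw [← hd] at h2
    push_cast at h2 ⊢
    linarith
  · have h1 : 1 / (4 * N) ≤ log (1 + 1 / ((N : ℝ) + n)) := by
      refine le_trans ?_ (half_le_log_one_add (by positivity) ?_)
      · rw [div_div]
        apply one_div_le_one_div_of_le (by positivity)
        linarith [hNn n hn]
      · rw [div_le_one (by positivity)]
        have : (1 : ℝ) ≤ N := by exact_mod_cast hN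
        linarith [n.cast_nonneg (α := ℝ)]
    have h2 : τ * (1 / (4 * N)) ≤ τ * log (1 + 1 / ((N : ℝ) + n)) := by gcongr
    rw [← hd] at h2
    have h4 : τ / (4 * N) = τ * (1 / (4 * N)) := by field_simp
    push_cast at h2 ⊢
    linarith
  · have h1 := hd n
    have h2 := hd (n + 1)
    have h3 : log (1 + 1 / ((N : ℝ) + (n + 1 : ℕ))) ≤ log (1 + 1 / ((N : ℝ) + n)) := by
      apply log_le_log (by positivity)
      gcongr
      linarith
    have h4 := mul_le_mul_of_nonneg_left h3 hτ.le
    rw [← h1, ← h2] at h4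
    linarith
  · field_simp; ring

lemma norm_zeta_block_second (hτ : 0 < τ) (hN : 1 ≤ N) (hL : L ≤ N) :
    ‖∑ n ∈ Finset.range L, e (-(τ * log ((N : ℝ) + n)))‖ ≤ 24 * (√τ + 2 * N / √τ) := by
  have hN1 : (1 : ℝ) ≤ N := by exact_mod_cast hN
  have hN0 : (0 : ℝ) < N := by linarith
  have hd : ∀ n < L, 1 / (16 * (N : ℝ) ^ 2) ≤ 2 * log ((N : ℝ) + (n + 1 : ℕ)) -
      log ((N : ℝ) + (n + 2 : ℕ)) - log ((N : ℝ) + n) ∧ 2 * log ((N : ℝ) + (n + 1 : ℕ)) -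
      log ((N : ℝ) + (n + 2 : ℕ)) - log ((N : ℝ) + n) ≤ 1 / (N : ℝ) ^ 2 := by
    intro n hn
    have hn' : (n : ℝ) + 1 ≤ N := by exact_mod_cast (by omega)
    have h0 : (0 : ℝ) ≤ n := by positivity
    have := log_second_difference (x := (N : ℝ) + n) (by positivity)
    push_cast
    simp only [← add_assoc]
    rw [this]
    have hu : 1 / (((N : ℝ) + n) * (N + n + 2)) ≤ 1 / (N : ℝ) ^ 2 := by
      apply one_div_le_one_div_of_le (by positivity); nlinarith
    constructor
    · refine le_trans ?_ (half_le_log_one_add (by positivity) (hu.trans ?_))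
      · rw [div_div]
        apply one_div_le_one_div_of_le (by positivity)
        have : ((N : ℝ) + n) * (N + n + 2) ≤ (2 * N) * (4 * N) := by gcongr <;> linarith
        nlinarith
      · rw [div_le_one (by positivity)]; nlinarith
    · exact (log_one_add_le (by positivity)).trans hu
  refine (norm_sum_e_le_second (lam := τ / (16 * N ^ 2)) (c := 16) (by positivity) (by norm_num)
    (fun n hn => ?_) fun n hn => ?_).trans ?_
  · have := mul_le_mul_of_nonneg_left (hd n hn).1 hτ.le
    rw [mul_one_div] at this
    linarith
  · have := mul_le_mul_of_nonneg_left (hd n hn).2 hτ.le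
    have e1 : 16 * (τ / (16 * (N : ℝ) ^ 2)) = τ * (1 / (N : ℝ) ^ 2) := by field_simp
    rw [e1]
    linarith
  · have hs : 0 < √τ := sqrt_pos.2 hτ
    have e1 : (τ / (16 * (N : ℝ) ^ 2)) ^ (-(1 / 2) : ℝ) = 4 * N / √τ := by
      rw [rpow_neg (by positivity), ← sqrt_eq_rpow, sqrt_div hτ.le,
        show 16 * (N : ℝ) ^ 2 = (4 * N) ^ 2 by ring, sqrt_sq (by positivity), inv_div]
    rw [e1]
    have hLN : (L : ℝ) ≤ N := by exact_mod_cast hL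
    calc 6 * (16 * (τ / (16 * (N : ℝ) ^ 2)) * L + 2) * (4 * N / √τ)
        ≤ 6 * (16 * (τ / (16 * (N : ℝ) ^ 2)) * N + 2) * (4 * N / √τ) := by gcongr
      _ = 24 * (τ / √τ + 2 * N / √τ) := by field_simp; norm_num
      _ = _ := by rw [div_sqrt]

lemma norm_zeta_block_third (hτ : 0 < τ) (hN : 1 ≤ N) (hL : L ≤ N) :
    ‖∑ n ∈ Finset.range L, e (-(τ * log ((N : ℝ) + n)))‖ ^ 2 ≤
      25600 * (N * τ ^ (1 / 3 : ℝ) / 4 + 4 * N ^ 2 / τ ^ (1 / 3 : ℝ)) := by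
  have hN1 : (1 : ℝ) ≤ N := by exact_mod_cast hN
  have hN0 : (0 : ℝ) < N := by linarith
  have hd : ∀ n < L, 1 / (64 * (N : ℝ) ^ 3) ≤ log ((N : ℝ) + (n + 3 : ℕ)) -
      3 * log ((N : ℝ) + (n + 2 : ℕ)) + 3 * log ((N : ℝ) + (n + 1 : ℕ)) - log ((N : ℝ) + n) ∧
      log ((N : ℝ) + (n + 3 : ℕ)) - 3 * log ((N : ℝ) + (n + 2 : ℕ)) +
        3 * log ((N : ℝ) + (n + 1 : ℕ)) - log ((N : ℝ) + n) ≤ 2 / (N : ℝ) ^ 3 := by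
    intro n hn
    have hn' : (n : ℝ) + 1 ≤ N := by exact_mod_cast (by omega)
    have h0 : (0 : ℝ) ≤ n := by positivity
    have := log_third_difference (x := (N : ℝ) + n) (by positivity)
    push_cast
    simp only [← add_assoc]
    rw [this]
    set x : ℝ := (N : ℝ) + n with hx
    have hx0 : 0 < x := by positivity
    have hx1 : N ≤ x := by linarith
    have hx2 : x + 1 ≤ 2 * N := by linarith
    have hu : (2 * x + 3) / (x * (x + 2) ^ 3) ≤ 2 / (x * (x + 2) ^ 2) := by
      rw [div_le_div_iff₀ (by positivity) (by positivity)]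
      have : 0 ≤ x * (x + 2) ^ 2 := by positivity
      nlinarith
    have hu1 : 2 / (x * (x + 2) ^ 2) ≤ 2 / (N : ℝ) ^ 3 := by
      apply div_le_div_of_nonneg_left (by norm_num) (by positivity)
      calc (N : ℝ) ^ 3 = N * N ^ 2 := by ring
        _ ≤ x * (x + 2) ^ 2 := by gcongr; linarith
    have hu2 : 1 / (x * (x + 2) ^ 2) ≤ (2 * x + 3) / (x * (x + 2) ^ 3) := by
      rw [div_le_div_iff₀ (by positivity) (by positivity)]
      have : 0 ≤ x * (x + 2) ^ 2 := by positivity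
      nlinarith
    constructor
    · refine le_trans ?_ (half_le_log_one_add (by positivity) (hu.trans ?_))
      · refine le_trans ?_ (div_le_div_of_nonneg_right hu2 (by norm_num))
        rw [div_div]
        apply one_div_le_one_div_of_le (by positivity)
        have h4 : x + 2 ≤ 4 * N := by linarith
        rcases Nat.lt_or_ge N 2 with hN2 | hN2
        · have : N = 1 := by omega
          subst this
          have hx' : x ≤ 1 := by push_cast at hx2; linarith
          have : x * (x + 2) ^ 2 ≤ 1 * (1 + 2) ^ 2 := by gcongr
          push_cast; linarith
        · have hN2' : (2 : ℝ) ≤ N := by exact_mod_cast hN2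
          have h5 : x * (x + 2) ≤ 4 * N ^ 2 := by nlinarith
          have h6 : x + 2 ≤ 3 * N := by linarith
          calc x * (x + 2) ^ 2 * 2 = 2 * (x * (x + 2)) * (x + 2) := by ring
            _ ≤ 2 * (4 * N ^ 2) * (3 * N) := by gcongr
            _ ≤ 64 * (N : ℝ) ^ 3 := by nlinarith [pow_pos hN0 3]
      · rw [div_le_one (by positivity)]
        have hx3 : 1 ≤ x := by linarith
        nlinarith [sq_nonneg x]
    · exact (log_one_add_le (by positivity)).trans (hu.trans hu1)
  have e0 : ‖∑ n ∈ Finset.range L, e (-(τ * log ((N : ℝ) + n)))‖ =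
      ‖∑ n ∈ Finset.range L, e (τ * log ((N : ℝ) + n))‖ := by
    rw [Finset.sum_congr rfl fun n _ => e_neg _, ← map_sum, RCLike.norm_conj]
  rw [e0]
  refine (norm_sum_e_sq_le_third (lam := τ / (64 * N ^ 3)) (c := 128) (by positivity) (by norm_num)
    (fun n hn => ?_) fun n hn => ?_).trans ?_
  · have := mul_le_mul_of_nonneg_left (hd n hn).1 hτ.le
    rw [mul_one_div] at this
    linarith
  · have := mul_le_mul_of_nonneg_left (hd n hn).2 hτ.le
    have e1 : 128 * (τ / (64 * (N : ℝ) ^ 3)) = τ * (2 / (N : ℝ) ^ 3) := by field_simp; norm_num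
    rw [e1]
    linarith
  · have e1 : (τ / (64 * (N : ℝ) ^ 3)) ^ (1 / 3 : ℝ) = τ ^ (1 / 3 : ℝ) / (4 * N) := by
      rw [show 64 * (N : ℝ) ^ 3 = (4 * N) ^ 3 by ring, div_rpow hτ.le (by positivity),
        ← rpow_natCast (4 * (N : ℝ)) 3, ← rpow_mul (by positivity)]
      norm_num
    rw [e1]
    have hu : 0 < τ ^ (1 / 3 : ℝ) := by positivity
    have hLN : (L : ℝ) ≤ N := by exact_mod_cast hL
    calc 200 * 128 * ((L : ℝ) ^ 2 * (τ ^ (1 / 3 : ℝ) / (4 * N)) + L / (τ ^ (1 / 3 : ℝ) / (4 * N)))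
        ≤ 200 * 128 * ((N : ℝ) ^ 2 * (τ ^ (1 / 3 : ℝ) / (4 * N)) +
          N / (τ ^ (1 / 3 : ℝ) / (4 * N))) := by gcongr
      _ = _ := by field_simp; ring

end blocks

lemma norm_zeta_block_sq_le {t : ℝ} (ht : 1 ≤ t) {N L : ℕ} (hN : 1 ≤ N) (hNt : N ≤ t ^ 2)
    (hL : L ≤ N) :
    ‖∑ n ∈ Finset.range L, e (-(t / (2 * π) * log ((N : ℝ) + n)))‖ ^ 2 ≤
      500 ^ 2 * (N * t ^ (1 / 3 : ℝ)) := by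
  have hN1 : (1 : ℝ) ≤ N := by exact_mod_cast hN
  have hN0 : (0 : ℝ) < N := by linarith
  set v : ℝ := t ^ (1 / 3 : ℝ) with hv
  have ht0 : 0 < t := by linarith
  have hv0 : 0 < v := by positivity
  have hv1 : 1 ≤ v := one_le_rpow ht (by norm_num)
  have hv3 : v ^ 3 = t := by rw [hv, ← rpow_natCast, ← rpow_mul ht0.le]; norm_num
  set τ := t / (2 * π) with hτ
  have hpi := pi_gt_three
  have hpi' := pi_lt_d2
  have hτ0 : 0 < τ := by positivity
  have hτt : τ ≤ t / 2 := by rw [hτ]; gcongr; linarith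
  have hτt' : t / 8 ≤ τ := by rw [hτ]; gcongr; linarith
  rcases le_or_gt (N : ℝ) v with h1 | h1
  · have := norm_sum_e_le (fun n => -(τ * log ((N : ℝ) + n))) (Finset.range L)
    rw [Finset.card_range] at this
    have hLN : (L : ℝ) ≤ N := by exact_mod_cast hL
    calc _ ≤ (N : ℝ) ^ 2 := by gcongr; linarith
      _ = 1 * (N * N) := by ring
      _ ≤ 500 ^ 2 * (N * v) := by gcongr; norm_num
  rcases le_or_gt (N : ℝ) (v ^ 2) with h2 | h2
  · refine (norm_zeta_block_third hτ0 hN hL).trans ?_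
    have hu1 : τ ^ (1 / 3 : ℝ) ≤ v := rpow_le_rpow hτ0.le (by linarith) (by norm_num)
    have hu2 : v / 2 ≤ τ ^ (1 / 3 : ℝ) := by
      have : (t / 8) ^ (1 / 3 : ℝ) = v / 2 := by
        rw [← hv3, show v ^ 3 / 8 = (v / 2) ^ 3 by ring, ← rpow_natCast (v / 2) 3,
          ← rpow_mul (by positivity)]
        norm_num
      rw [← this]
      exact rpow_le_rpow (by positivity) hτt' (by norm_num)
    have h3 : 4 * (N : ℝ) ^ 2 / τ ^ (1 / 3 : ℝ) ≤ 8 * (N * v) := by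
      calc 4 * (N : ℝ) ^ 2 / τ ^ (1 / 3 : ℝ) ≤ 4 * (N * v ^ 2) / (v / 2) := by
            rw [sq]; gcongr
        _ = _ := by field_simp; norm_num
    have h4 : N * τ ^ (1 / 3 : ℝ) ≤ N * v := by gcongr
    have h5 : 0 ≤ N * v := by positivity
    linarith
  rcases le_or_gt (N : ℝ) t with h3 | h3
  · have h4 := norm_zeta_block_second hτ0 hN hL
    have hs : 0 < √τ := sqrt_pos.2 hτ0
    have hss : √τ ^ 2 = τ := sq_sqrt hτ0.le
    have h5 : t ≤ N * v := by rw [← hv3]; nlinarith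
    calc _ ≤ (24 * (√τ + 2 * N / √τ)) ^ 2 := by gcongr
      _ ≤ 576 * (2 * (√τ ^ 2 + (2 * N / √τ) ^ 2)) := by
          nlinarith [sq_nonneg (√τ - 2 * N / √τ)]
      _ = 1152 * (τ + 4 * (N * (N / τ))) := by rw [div_pow, hss]; field_simp; ring
      _ ≤ 1152 * (N * v + 4 * (N * (8 * v))) := by
          gcongr
          · linarith
          · rw [div_le_iff₀ hτ0]; nlinarith
      _ ≤ _ := by nlinarith [mul_pos hN0 hv0]
  · have h4 := norm_zeta_block_kusmin hτ0 hN (by linarith) hL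
    calc _ ≤ (8 * N / τ) ^ 2 := by gcongr
      _ ≤ (8 * N / (t / 8)) ^ 2 := by gcongr
      _ = 4096 * (N * (N / t ^ 2)) := by field_simp; ring
      _ ≤ 500 ^ 2 * (N * v) := by
          have : (N : ℝ) / t ^ 2 ≤ v := ((div_le_one (by positivity)).2 hNt).trans hv1
          gcongr
          norm_num

/-- Abel summation against nonnegative decreasing weights. -/
lemma norm_sum_mul_le_of_antitone {a : ℕ → ℝ} (ha : Antitone a) (ha0 : ∀ n, 0 ≤ a n)
    {z : ℕ → ℂ} {L : ℕ} {B : ℝ} (hB : ∀ k ≤ L, ‖∑ n ∈ Finset.range k, z n‖ ≤ B) :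
    ‖∑ n ∈ Finset.range L, (a n : ℂ) * z n‖ ≤ a 0 * B := by
  have key : ∀ k ≤ L, ‖∑ n ∈ Finset.range k, (a n : ℂ) * z n -
      a k * ∑ n ∈ Finset.range k, z n‖ ≤ (a 0 - a k) * B := by
    intro k
    induction k with
    | zero => simp
    | succ k ih =>
      intro hk
      have h1 := ih (by omega)
      have e1 : ∑ n ∈ Finset.range (k + 1), (a n : ℂ) * z n -
          a (k + 1) * ∑ n ∈ Finset.range (k + 1), z n =
          (∑ n ∈ Finset.range k, (a n : ℂ) * z n - a k * ∑ n ∈ Finset.range k, z n) +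
          ((a k - a (k + 1) : ℝ) : ℂ) * ∑ n ∈ Finset.range (k + 1), z n := by
        rw [Finset.sum_range_succ, Finset.sum_range_succ z]; push_cast; ring
      rw [e1]
      refine (norm_add_le _ _).trans ?_
      have h2 : 0 ≤ a k - a (k + 1) := sub_nonneg.2 (ha (Nat.le_succ k))
      rw [norm_mul, Complex.norm_real, Real.norm_eq_abs, abs_of_nonneg h2]
      have := mul_le_mul_of_nonneg_left (hB (k + 1) hk) h2
      linarith
  have h1 := key L le_rfl
  have h2 := norm_add_le (∑ n ∈ Finset.range L, (a n : ℂ) * z n -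
      a L * ∑ n ∈ Finset.range L, z n) (a L * ∑ n ∈ Finset.range L, z n)
  rw [sub_add_cancel, norm_mul, Complex.norm_real, Real.norm_eq_abs, abs_of_nonneg (ha0 L)] at h2
  have := mul_le_mul_of_nonneg_left (hB L le_rfl) (ha0 L)
  linarith

lemma natCast_cpow_eq_mul_e {σ t : ℝ} {n : ℝ} (hn : 0 < n) :
    (n : ℂ) ^ (-(σ + t * Complex.I : ℂ)) = (n ^ (-σ) : ℝ) * e (-(t / (2 * π) * log n)) := by
  have h0 : (n : ℂ) ≠ 0 := by exact_mod_cast hn.ne'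
  rw [neg_add, Complex.cpow_add _ _ h0, Complex.ofReal_cpow hn.le]
  congr 1
  · push_cast; rfl
  · rw [Complex.cpow_def_of_ne_zero h0, e, ← Complex.ofReal_log hn.le]
    congr 1
    push_cast
    have : (π : ℂ) ≠ 0 := by exact_mod_cast pi_ne_zero
    field_simp

lemma norm_zeta_dyadic_le {σ t : ℝ} (hσ : 1 / 2 ≤ σ) (ht : 1 ≤ t) {N : ℕ} (hN : 1 ≤ N)
    (hNt : N ≤ t ^ 2) :
    ‖∑ n ∈ Finset.Ico N (2 * N), (n : ℂ) ^ (-(σ + t * Complex.I : ℂ))‖ ≤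
      500 * t ^ (1 / 6 : ℝ) := by
  have hN1 : (1 : ℝ) ≤ N := by exact_mod_cast hN
  have hN0 : (0 : ℝ) < N := by linarith
  have ht0 : 0 < t := by linarith
  have e1 : ∑ n ∈ Finset.Ico N (2 * N), (n : ℂ) ^ (-(σ + t * Complex.I : ℂ)) =
      ∑ n ∈ Finset.range N, (((N + n : ℝ) ^ (-σ) : ℝ) : ℂ) *
        e (-(t / (2 * π) * log ((N : ℝ) + n))) := by
    rw [Finset.sum_Ico_eq_sum_range, two_mul, Nat.add_sub_cancel]
    refine Finset.sum_congr rfl fun n _ => ?_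
    rw [← natCast_cpow_eq_mul_e (by positivity)]
    push_cast; rfl
  rw [e1]
  have h6 : 0 < t ^ (1 / 6 : ℝ) := by positivity
  have hsq : (√N * t ^ (1 / 6 : ℝ)) ^ 2 = N * t ^ (1 / 3 : ℝ) := by
    rw [mul_pow, sq_sqrt hN0.le, ← rpow_natCast, ← rpow_mul ht0.le]; norm_num
  refine (norm_sum_mul_le_of_antitone (a := fun n : ℕ => ((N : ℝ) + n) ^ (-σ))
    (B := 500 * (√N * t ^ (1 / 6 : ℝ))) ?_ (fun n => by positivity) fun k hk => ?_).trans ?_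
  · intro m n hmn
    apply rpow_le_rpow_of_nonpos (by positivity) _ (by linarith)
    have : (m : ℝ) ≤ n := by exact_mod_cast hmn
    linarith
  · refine le_of_sq_le_sq ?_ (by positivity)
    rw [mul_pow, hsq]
    exact norm_zeta_block_sq_le ht hN hNt hk
  · have h7 : (N : ℝ) ^ (-σ) ≤ (N : ℝ) ^ (-(1 / 2) : ℝ) :=
      rpow_le_rpow_of_exponent_le hN1 (by linarith)
    have h8 : (N : ℝ) ^ (-(1 / 2) : ℝ) * √N = 1 := by
      rw [sqrt_eq_rpow, ← rpow_add hN0]; norm_num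
    calc ((N : ℝ) + (0 : ℕ)) ^ (-σ) * (500 * (√N * t ^ (1 / 6 : ℝ)))
        ≤ (N : ℝ) ^ (-(1 / 2) : ℝ) * (500 * (√N * t ^ (1 / 6 : ℝ))) := by
          rw [Nat.cast_zero, add_zero]; gcongr
      _ = 500 * t ^ (1 / 6 : ℝ) * ((N : ℝ) ^ (-(1 / 2) : ℝ) * √N) := by ring
      _ = _ := by rw [h8, mul_one]

lemma norm_riemannZeta_le_log {σ t : ℝ} (hσ : 1 / 2 ≤ σ) (hσ3 : σ ≤ 3) (ht : 1 ≤ t) :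
    ‖riemannZeta (σ + t * Complex.I)‖ ≤ 500 * t ^ (1 / 6 : ℝ) * (1 + 3 * log t) + 14 := by
  obtain ⟨k, hk1, hk2⟩ := exists_nat_pow_near (one_le_pow₀ ht : 1 ≤ t ^ 2)
      (one_lt_two : (1 : ℝ) < 2)
  set s : ℂ := σ + t * Complex.I with hs
  have hre : s.re = σ := by simp [hs]
  have him : s.im = t := by simp [hs]
  have ht0 : 0 < t := by linarith
  set N : ℕ := 2 ^ (k + 1) - 1 with hN
  have hp1 : 1 ≤ 2 ^ k := Nat.one_le_two_pow
  have hp2 : 2 ^ (k + 1) = 2 * 2 ^ k := by ring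
  have hNk : 2 ^ k ≤ N := by omega
  have hN1 : 1 ≤ N := by omega
  have hsum : ∀ j ≤ k + 1, ‖∑ n ∈ Finset.Icc (1 : ℕ) (2 ^ j - 1), (n : ℂ) ^ (-s)‖ ≤
      j * (500 * t ^ (1 / 6 : ℝ)) := by
    intro j
    induction j with
    | zero => simp
    | succ j ih =>
      intro hj
      have e1 : ∀ j : ℕ, Finset.Icc 1 (2 ^ j - 1) = Finset.Ico 1 (2 ^ j) := by
        intro j; ext n; have := Nat.one_le_two_pow (n := j); simp; omega
      have ih := ih (by omega)
      have hp : (2 : ℕ) ^ (j + 1) = 2 * 2 ^ j := by ring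
      rw [e1] at ih ⊢
      rw [← Finset.sum_Ico_consecutive _ (Nat.one_le_two_pow (n := j))
        (Nat.pow_le_pow_right (by norm_num) (Nat.le_succ j)), hp]
      refine (norm_add_le _ _).trans ?_
      have := norm_zeta_dyadic_le hσ ht (N := 2 ^ j) Nat.one_le_two_pow (by
        refine le_trans ?_ hk1
        push_cast
        exact pow_le_pow_right₀ (by norm_num) (by omega))
      push_cast
      linarith
  have hEM := norm_riemannZeta_sub_sum_le (s := s) (by rw [hre]; linarith) (by
    intro h; rw [h] at him; simp at him; linarith) hN1
  have hNr : (2 : ℝ) ^ k ≤ N := by exact_mod_cast hNk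
  have hNt : t ^ 2 / 2 ≤ N := by
    have : (2 : ℝ) ^ (k + 1) = 2 * 2 ^ k := by ring
    linarith
  have hNt2 : (N : ℝ) ≤ 2 * t ^ 2 := by
    have : (N : ℝ) ≤ 2 ^ (k + 1) := by exact_mod_cast (Nat.sub_le _ _)
    have e : (2 : ℝ) ^ (k + 1) = 2 * 2 ^ k := by ring
    linarith
  have hN0 : (0 : ℝ) < N := by exact_mod_cast hN1
  have hN1' : (1 : ℝ) ≤ N := by exact_mod_cast hN1
  have hsn : 1 ≤ ‖s - 1‖ / t := by
    rw [le_div_iff₀ ht0, one_mul]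
    have := Complex.abs_im_le_norm (s - 1)
    simp only [Complex.sub_im, him, Complex.one_im, sub_zero] at this
    exact (le_abs_self t).trans this
  have hs1 : t ≤ ‖s - 1‖ := by rwa [le_div_iff₀ ht0, one_mul] at hsn
  have b1 : ‖(N : ℂ) ^ (1 - s) / (s - 1)‖ ≤ 2 := by
    rw [norm_div, ← Complex.ofReal_natCast, Complex.norm_cpow_eq_rpow_re_of_pos hN0,
      div_le_iff₀ (by linarith)]
    simp only [Complex.sub_re, Complex.one_re, hre]
    calc (N : ℝ) ^ (1 - σ) ≤ (N : ℝ) ^ (1 / 2 : ℝ) :=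
          rpow_le_rpow_of_exponent_le hN1' (by linarith)
      _ = √N := (sqrt_eq_rpow _).symm
      _ ≤ 2 * t := by rw [sqrt_le_left (by positivity)]; nlinarith
      _ ≤ 2 * ‖s - 1‖ := by gcongr
  have b2 : ‖s‖ / s.re * (N : ℝ) ^ (-s.re) ≤ 12 := by
    have h1 : ‖s‖ ≤ 3 + t := by
      refine (norm_add_le _ _).trans ?_
      simp only [norm_mul, Complex.norm_real, Complex.norm_I, mul_one, Real.norm_eq_abs]
      rw [abs_of_pos ht0, abs_of_pos (by linarith : 0 < σ)]
      linarith
    have h2 : (N : ℝ) ^ (-s.re) ≤ 3 / 2 / t := by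
      rw [hre]
      calc (N : ℝ) ^ (-σ) ≤ (N : ℝ) ^ (-(1 / 2) : ℝ) :=
            rpow_le_rpow_of_exponent_le hN1' (by linarith)
        _ = 1 / √N := by rw [rpow_neg hN0.le, ← sqrt_eq_rpow, one_div]
        _ ≤ 3 / 2 / t := by
            rw [div_div, div_le_div_iff₀ (sqrt_pos.2 hN0) (by positivity), one_mul]
            have : 2 * t / 3 ≤ √N := le_sqrt_of_sq_le (by nlinarith)
            linarith
    rw [hre] at h2 ⊢
    calc ‖s‖ / σ * (N : ℝ) ^ (-σ) ≤ (3 + t) / (1 / 2) * (3 / 2 / t) := by gcongr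
      _ ≤ (4 * t) / (1 / 2) * (3 / 2 / t) := by gcongr; linarith
      _ = 12 := by field_simp; norm_num
  have hk3 : ((k + 1 : ℕ) : ℝ) ≤ 1 + 3 * log t := by
    have h1 : log ((2 : ℝ) ^ k) ≤ log (t ^ 2) := log_le_log (by positivity) hk1
    rw [log_pow, log_pow] at h1
    have h2 := log_two_gt_d9
    have h3 : (0 : ℝ) ≤ k := by positivity
    push_cast at h1 ⊢
    nlinarith
  have h3 := hsum (k + 1) le_rfl
  have h4 : ((k + 1 : ℕ) : ℝ) * (500 * t ^ (1 / 6 : ℝ)) ≤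
      500 * t ^ (1 / 6 : ℝ) * (1 + 3 * log t) := by
    rw [mul_comm]; gcongr
  have e2 : riemannZeta s = (riemannZeta s - ∑ n ∈ Finset.Icc 1 N, (n : ℂ) ^ (-s) -
      (N : ℂ) ^ (1 - s) / (s - 1)) + ∑ n ∈ Finset.Icc 1 N, (n : ℂ) ^ (-s) +
      (N : ℂ) ^ (1 - s) / (s - 1) := by ring
  rw [e2]
  refine (norm_add_le _ _).trans ?_
  have := norm_add_le (riemannZeta s - ∑ n ∈ Finset.Icc 1 N, (n : ℂ) ^ (-s) -
      (N : ℂ) ^ (1 - s) / (s - 1)) (∑ n ∈ Finset.Icc 1 N, (n : ℂ) ^ (-s))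
  linarith

/-- Weyl's bound for `ζ` on and to the right of the critical line. -/
lemma exists_norm_riemannZeta_le : ∃ C : ℝ, 1 ≤ C ∧ ∀ σ t : ℝ, 1 / 2 ≤ σ → σ ≤ 3 → 1 ≤ |t| →
    ‖riemannZeta (σ + t * Complex.I)‖ ≤ C * |t| ^ (0.17 : ℝ) := by
  have hpos : ∀ σ t : ℝ, 1 / 2 ≤ σ → σ ≤ 3 → 1 ≤ t →
      ‖riemannZeta (σ + t * Complex.I)‖ ≤ 500514 * t ^ (0.17 : ℝ) := by
    intro σ t h1 h2 h3
    refine (norm_riemannZeta_le_log h1 h2 h3).trans ?_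
    have ht0 : 0 < t := by linarith
    have hl : log t ≤ t ^ (0.003 : ℝ) / 0.003 := log_le_rpow_div ht0.le (by norm_num)
    have hone : 1 ≤ t ^ (0.003 : ℝ) := one_le_rpow h3 (by norm_num)
    have hone' : 1 ≤ t ^ (0.17 : ℝ) := one_le_rpow h3 (by norm_num)
    have h6 : t ^ (1 / 6 : ℝ) * t ^ (0.003 : ℝ) ≤ t ^ (0.17 : ℝ) := by
      rw [← rpow_add ht0]; exact rpow_le_rpow_of_exponent_le h3 (by norm_num)
    calc 500 * t ^ (1 / 6 : ℝ) * (1 + 3 * log t) + 14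
        ≤ 500 * t ^ (1 / 6 : ℝ) * (t ^ (0.003 : ℝ) + 3 * (t ^ (0.003 : ℝ) / 0.003)) + 14 := by
          gcongr
      _ = 500500 * (t ^ (1 / 6 : ℝ) * t ^ (0.003 : ℝ)) + 14 * 1 := by ring
      _ ≤ 500500 * t ^ (0.17 : ℝ) + 14 * t ^ (0.17 : ℝ) := by gcongr
      _ = _ := by ring
  refine ⟨500514, by norm_num, fun σ t h1 h2 h3 => ?_⟩
  rcases le_or_gt 0 t with h | h
  · rw [abs_of_nonneg h] at h3 ⊢
    exact hpos σ t h1 h2 h3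
  · rw [abs_of_neg h] at h3 ⊢
    have := hpos σ (-t) h1 h2 h3
    rw [← RCLike.norm_conj, ← riemannZeta_conj] at this
    have e1 : (starRingEnd ℂ) ((σ : ℂ) + ((-t : ℝ) : ℂ) * Complex.I) = σ + t * Complex.I := by
      rw [map_add, map_mul, Complex.conj_ofReal, Complex.conj_ofReal, Complex.conj_I]
      push_cast; ring
    rwa [e1] at this

/-- The off-diagonal kernel of the mean value theorem. -/
noncomputable def offKernel (n m : ℕ) : ℝ :=
  if n = m ∨ 2 * min n m < max n m then 0 else 1 / |(n : ℝ) - m|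

lemma offKernel_nonneg (n m : ℕ) : 0 ≤ offKernel n m := by
  unfold offKernel; split_ifs <;> positivity

lemma offKernel_comm (n m : ℕ) : offKernel n m = offKernel m n := by
  unfold offKernel
  simp only [min_comm n m, max_comm n m, abs_sub_comm (n : ℝ) m, eq_comm (a := n) (b := m)]

lemma sum_one_div_succ_le (n : ℕ) :
    ∑ k ∈ Finset.range n, 1 / ((k : ℝ) + 1) ≤ 1 + log n := by
  have := harmonic_le_one_add_log n
  simpa [harmonic] using this

lemma sum_offKernel_le {n : ℕ} (hn : 1 ≤ n) (S : Finset ℕ) :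
    ∑ m ∈ S, offKernel n m ≤ 2 * (1 + log n) := by
  have h1 : ∑ m ∈ S, offKernel n m ≤ ∑ m ∈ Finset.range (2 * n + 1), offKernel n m := by
    rw [← Finset.sum_filter_add_sum_filter_not S (fun m => m ≤ 2 * n)]
    have : ∑ m ∈ S with ¬ m ≤ 2 * n, offKernel n m = 0 := by
      refine Finset.sum_eq_zero fun m hm => ?_
      have := (Finset.mem_filter.1 hm).2
      rw [offKernel, if_pos]
      omega
    rw [this, add_zero]
    refine Finset.sum_le_sum_of_subset_of_nonneg (fun m hm => ?_) fun _ _ _ => offKernel_nonneg _ _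
    have := (Finset.mem_filter.1 hm).2
    simp; omega
  refine h1.trans ?_
  rw [← Finset.sum_range_add_sum_Ico _ (show n + 1 ≤ 2 * n + 1 by omega), Finset.sum_range_succ,
    show offKernel n n = 0 by simp [offKernel], add_zero, two_mul (1 + log (n : ℝ))]
  refine add_le_add ?_ ?_
  · rw [← Finset.sum_range_reflect (fun m => offKernel n m) n]
    refine le_trans (Finset.sum_le_sum (g := fun k : ℕ => 1 / ((k : ℝ) + 1)) fun k hk => ?_)
        (sum_one_div_succ_le n)
    have hk := Finset.mem_range.1 hk
    unfold offKernel
    split_ifs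
    · positivity
    · rw [show n - 1 - k = n - (k + 1) by omega, Nat.cast_sub (by omega)]
      push_cast
      rw [sub_sub_cancel, abs_of_pos (by positivity)]
  · rw [Finset.sum_Ico_eq_sum_range, show 2 * n + 1 - (n + 1) = n by omega]
    refine le_trans (Finset.sum_le_sum (g := fun k : ℕ => 1 / ((k : ℝ) + 1)) fun k hk => ?_)
        (sum_one_div_succ_le n)
    unfold offKernel
    split_ifs
    · positivity
    · push_cast
      rw [show (n : ℝ) - (n + 1 + k) = -(k + 1) by ring, abs_neg, abs_of_pos (by positivity)]

lemma one_div_abs_log_sub_le {n m : ℕ} (hn : 1 ≤ n) (hm : 1 ≤ m) (hnm : n ≠ m) :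
    1 / |log n - log m| ≤ 2 + √n * √m * offKernel n m := by
  wlog h : m < n generalizing n m
  · have := this hm hn hnm.symm (by omega)
    rwa [abs_sub_comm, offKernel_comm, mul_comm (√(n : ℝ))]
  have hn0 : (0 : ℝ) < n := by exact_mod_cast hn
  have hm0 : (0 : ℝ) < m := by exact_mod_cast hm
  have hmn : (m : ℝ) < n := by exact_mod_cast h
  have hd : 0 < (n : ℝ) - m := by linarith
  have h1 : ((n : ℝ) - m) / n ≤ log n - log m := by
    rw [← log_div hn0.ne' hm0.ne']
    have := one_sub_inv_le_log_of_pos (x := (n : ℝ) / m) (by positivity)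
    rw [inv_div] at this
    rwa [sub_div, div_self hn0.ne']
  have h2 : 0 < ((n : ℝ) - m) / n := by positivity
  rw [abs_of_pos (by linarith)]
  have h3 : 1 / (log n - log m) ≤ 1 + m / (n - m) := by
    calc 1 / (log n - log m) ≤ 1 / (((n : ℝ) - m) / n) := one_div_le_one_div_of_le h2 h1
      _ = _ := by field_simp; ring
  refine h3.trans ?_
  unfold offKernel
  rw [min_eq_right h.le, max_eq_left h.le]
  split_ifs with hc
  · have : 2 * (m : ℝ) < n := by exact_mod_cast hc.resolve_left (by omega)
    have : (m : ℝ) / (n - m) ≤ 1 := by rw [div_le_one hd]; linarith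
    linarith
  · rw [abs_of_pos hd]
    have : (m : ℝ) ≤ √n * √m := by
      calc (m : ℝ) = √m * √m := (mul_self_sqrt hm0.le).symm
        _ ≤ √n * √m := by gcongr
    have : (m : ℝ) / (n - m) ≤ √n * √m / (n - m) := by gcongr
    rw [mul_one_div]
    linarith

lemma natCast_cpow_neg_mul_I {n : ℕ} (hn : 1 ≤ n) (t : ℝ) :
    (n : ℂ) ^ (-(t * Complex.I) : ℂ) = Complex.exp ((-(log n * t) : ℝ) * Complex.I) := by
  have h0 : (n : ℂ) ≠ 0 := by exact_mod_cast (by omega : n ≠ 0)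
  rw [Complex.cpow_def_of_ne_zero h0, ← Complex.ofReal_natCast,
    ← Complex.ofReal_log (by positivity)]
  congr 1
  push_cast
  ring

lemma norm_integral_exp_le {t₀ T x : ℝ} (hx : x ≠ 0) :
    ‖∫ t in t₀..(t₀ + T), Complex.exp ((-(x * t) : ℝ) * Complex.I)‖ ≤ 2 / |x| := by
  have hc : (-(x : ℂ) * Complex.I) ≠ 0 := by
    simp [hx]
  have e1 : (fun t : ℝ => Complex.exp ((-(x * t) : ℝ) * Complex.I)) =
      fun t : ℝ => Complex.exp ((-(x : ℂ) * Complex.I) * t) := by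
    ext t; congr 1; push_cast; ring
  rw [e1, integral_exp_mul_complex hc, norm_div]
  have h1 : ‖(-(x : ℂ) * Complex.I)‖ = |x| := by simp
  have hn : ∀ t : ℝ, ‖Complex.exp ((-(x : ℂ) * Complex.I) * t)‖ = 1 := by
    intro t
    rw [show (-(x : ℂ) * Complex.I) * t = ((-(x * t) : ℝ) : ℂ) * Complex.I by push_cast; ring]
    exact Complex.norm_exp_ofReal_mul_I _
  rw [h1]
  gcongr
  refine (norm_sub_le _ _).trans ?_
  rw [hn, hn]; norm_num

open ComplexConjugate in
/-- The mean value theorem for finite Dirichlet polynomials. -/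
lemma integral_norm_sq_dirichlet_le (S : Finset ℕ) (hS : ∀ n ∈ S, 1 ≤ n) (a : ℕ → ℂ)
    (t₀ : ℝ) {T : ℝ} (hT : 0 ≤ T) :
    ∫ t in t₀..(t₀ + T), ‖∑ n ∈ S, a n * (n : ℂ) ^ (-(t * Complex.I) : ℂ)‖ ^ 2 ≤
      T * ∑ n ∈ S, ‖a n‖ ^ 2 + 4 * (∑ n ∈ S, ‖a n‖) ^ 2 +
        4 * ∑ n ∈ S, ‖a n‖ ^ 2 * (n * (1 + log n)) := by
  have e1 : ∀ t : ℝ, ((‖∑ n ∈ S, a n * (n : ℂ) ^ (-(t * Complex.I) : ℂ)‖ ^ 2 : ℝ) : ℂ) =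
      ∑ n ∈ S, ∑ m ∈ S, a n * conj (a m) *
        Complex.exp ((-((log n - log m) * t) : ℝ) * Complex.I) := by
    intro t
    push_cast
    rw [← Complex.mul_conj', map_sum, Finset.sum_mul_sum]
    refine Finset.sum_congr rfl fun n hn => Finset.sum_congr rfl fun m hm => ?_
    rw [natCast_cpow_neg_mul_I (hS n hn), natCast_cpow_neg_mul_I (hS m hm), map_mul,
      ← Complex.exp_conj, map_mul, Complex.conj_ofReal, Complex.conj_I]
    rw [show ∀ x y z w : ℂ, x * y * (z * w) = x * z * (y * w) by intros; ring, ← Complex.exp_add]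
    congr 2
    push_cast; ring
  have hcont : ∀ n m : ℕ, Continuous fun t : ℝ => a n * conj (a m) *
        Complex.exp ((-((log n - log m) * t) : ℝ) * Complex.I) := by
    intro n m; fun_prop
  have e2 : ((∫ t in t₀..(t₀ + T), ‖∑ n ∈ S, a n * (n : ℂ) ^ (-(t * Complex.I) : ℂ)‖ ^ 2 : ℝ) : ℂ)
      = ∑ n ∈ S, ∑ m ∈ S, a n * conj (a m) *
        ∫ t in t₀..(t₀ + T), Complex.exp ((-((log n - log m) * t) : ℝ) * Complex.I) := by
    rw [← intervalIntegral.integral_ofReal]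
    simp only [e1]
    rw [intervalIntegral.integral_finsetSum fun n _ =>
      (continuous_finsetSum _ fun m _ => hcont n m).intervalIntegrable _ _]
    refine Finset.sum_congr rfl fun n _ => ?_
    rw [intervalIntegral.integral_finsetSum fun m _ => (hcont n m).intervalIntegrable _ _]
    refine Finset.sum_congr rfl fun m _ => ?_
    rw [intervalIntegral.integral_const_mul]
  have hK : ∀ n ∈ S, ∀ m ∈ S,
      ‖∫ t in t₀..(t₀ + T), Complex.exp ((-((log n - log m) * t) : ℝ) * Complex.I)‖ ≤
        (if n = m then T else 0) + 4 + 2 * (√n * √m * offKernel n m) := by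
    intro n hn m hm
    have hk : 0 ≤ √(n : ℝ) * √(m : ℝ) * offKernel n m :=
      mul_nonneg (by positivity) (offKernel_nonneg _ _)
    rcases eq_or_ne n m with rfl | hnm
    · simp only [sub_self, zero_mul, neg_zero, Complex.ofReal_zero, Complex.exp_zero, if_true]
      rw [intervalIntegral.integral_const]
      simp only [add_sub_cancel_left, Complex.real_smul, mul_one, Complex.norm_real,
        Real.norm_eq_abs, abs_of_nonneg hT]
      linarith
    · have hne : log (n : ℝ) - log m ≠ 0 := by
        rw [sub_ne_zero]
        intro h
        have h1 : (0 : ℝ) < n := by exact_mod_cast hS n hn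
        have h2 : (0 : ℝ) < m := by exact_mod_cast hS m hm
        exact hnm (by exact_mod_cast log_injOn_pos h1 h2 h)
      have h1 := norm_integral_exp_le (t₀ := t₀) (T := T) hne
      have h2 := one_div_abs_log_sub_le (hS n hn) (hS m hm) hnm
      rw [if_neg hnm]
      rw [show 2 / |log (n : ℝ) - log m| = 2 * (1 / |log (n : ℝ) - log m|) by ring] at h1
      linarith
  have e3 : ∫ t in t₀..(t₀ + T), ‖∑ n ∈ S, a n * (n : ℂ) ^ (-(t * Complex.I) : ℂ)‖ ^ 2 ≤
      ∑ n ∈ S, ∑ m ∈ S, ‖a n‖ * ‖a m‖ *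
        ((if n = m then T else 0) + 4 + 2 * (√n * √m * offKernel n m)) := by
    refine (le_abs_self _).trans ?_
    rw [← Real.norm_eq_abs, ← Complex.norm_real, e2]
    refine (norm_sum_le _ _).trans (Finset.sum_le_sum fun n hn => ?_)
    refine (norm_sum_le _ _).trans (Finset.sum_le_sum fun m hm => ?_)
    rw [norm_mul, norm_mul, RCLike.norm_conj]
    exact mul_le_mul_of_nonneg_left (hK n hn m hm) (by positivity)
  have p1 : ∑ n ∈ S, ∑ m ∈ S, ‖a n‖ * ‖a m‖ * (if n = m then T else 0) =
      T * ∑ n ∈ S, ‖a n‖ ^ 2 := by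
    rw [Finset.mul_sum]
    refine Finset.sum_congr rfl fun n hn => ?_
    simp only [mul_ite, mul_zero]
    rw [Finset.sum_ite_eq, if_pos hn]
    ring
  have p2 : ∑ n ∈ S, ∑ m ∈ S, ‖a n‖ * ‖a m‖ * 4 = 4 * (∑ n ∈ S, ‖a n‖) ^ 2 := by
    rw [sq, Finset.sum_mul_sum, Finset.mul_sum]
    refine Finset.sum_congr rfl fun n _ => ?_
    rw [Finset.mul_sum]
    exact Finset.sum_congr rfl fun m _ => by ring
  have p3 : ∑ n ∈ S, ∑ m ∈ S, ‖a n‖ * ‖a m‖ * (2 * (√n * √m * offKernel n m)) ≤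
      4 * ∑ n ∈ S, ‖a n‖ ^ 2 * (n * (1 + log n)) := by
    have q1 : ∀ n m : ℕ, ‖a n‖ * ‖a m‖ * (2 * (√n * √m * offKernel n m)) ≤
        ‖a n‖ ^ 2 * n * offKernel n m + ‖a m‖ ^ 2 * m * offKernel m n := by
      intro n m
      rw [offKernel_comm m n]
      have hn : √(n : ℝ) ^ 2 = n := sq_sqrt (by positivity)
      have hm : √(m : ℝ) ^ 2 = m := sq_sqrt (by positivity)
      have := mul_nonneg (sq_nonneg (‖a n‖ * √n - ‖a m‖ * √m)) (offKernel_nonneg n m)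
      calc _ ≤ ‖a n‖ ^ 2 * √(n : ℝ) ^ 2 * offKernel n m +
            ‖a m‖ ^ 2 * √(m : ℝ) ^ 2 * offKernel n m := by linarith
        _ = _ := by rw [hn, hm]
    have q2 : ∑ n ∈ S, ∑ m ∈ S, ‖a n‖ ^ 2 * n * offKernel n m ≤
        2 * ∑ n ∈ S, ‖a n‖ ^ 2 * (n * (1 + log n)) := by
      rw [Finset.mul_sum]
      refine Finset.sum_le_sum fun n hn => ?_
      rw [← Finset.mul_sum]
      have := mul_le_mul_of_nonneg_left (sum_offKernel_le (hS n hn) S)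
        (show 0 ≤ ‖a n‖ ^ 2 * n by positivity)
      linarith
    calc _ ≤ ∑ n ∈ S, ∑ m ∈ S, (‖a n‖ ^ 2 * n * offKernel n m + ‖a m‖ ^ 2 * m * offKernel m n) :=
          Finset.sum_le_sum fun n _ => Finset.sum_le_sum fun m _ => q1 n m
      _ = ∑ n ∈ S, ∑ m ∈ S, ‖a n‖ ^ 2 * n * offKernel n m +
          ∑ n ∈ S, ∑ m ∈ S, ‖a n‖ ^ 2 * n * offKernel n m := by
          simp only [Finset.sum_add_distrib]
          congr 1
          rw [Finset.sum_comm]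
      _ ≤ _ := by linarith
  refine e3.trans ?_
  simp only [mul_add (_ * _), Finset.sum_add_distrib]
  rw [p1, p2]
  linarith

open Filter Topology in
/-- The mean value theorem for absolutely convergent Dirichlet series. -/
lemma integral_norm_sq_dirichlet_tsum_le {a : ℕ → ℂ} (ha0 : a 0 = 0)
    (ha : Summable fun n => ‖a n‖) (hal : Summable fun n : ℕ => ‖a n‖ ^ 2 * (n * (1 + log n)))
    (t₀ : ℝ) {T : ℝ} (hT : 0 ≤ T) :
    ∫ t in t₀..(t₀ + T), ‖∑' n, a n * (n : ℂ) ^ (-(t * Complex.I) : ℂ)‖ ^ 2 ≤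
      T * ∑' n, ‖a n‖ ^ 2 + 4 * (∑' n, ‖a n‖) ^ 2 + 4 * ∑' n : ℕ,
          ‖a n‖ ^ 2 * (n * (1 + log n)) := by
  have hnorm : ∀ n (t : ℝ), ‖a n * (n : ℂ) ^ (-(t * Complex.I) : ℂ)‖ ≤ ‖a n‖ := by
    intro n t
    rcases Nat.eq_zero_or_pos n with rfl | hn
    · simp [ha0]
    · rw [norm_mul, natCast_cpow_neg_mul_I hn, Complex.norm_exp_ofReal_mul_I, mul_one]
  have ha2 : Summable fun n => ‖a n‖ ^ 2 := by
    refine Summable.of_nonneg_of_le (fun n => by positivity) (fun n => ?_)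
      (ha.mul_left (∑' n, ‖a n‖))
    rw [sq]
    exact mul_le_mul_of_nonneg_right (ha.le_tsum n fun _ _ => norm_nonneg _) (norm_nonneg _)
  have hpos : ∀ n : ℕ, 0 ≤ ‖a n‖ ^ 2 * (n * (1 + log n)) := by
    intro n
    rcases Nat.eq_zero_or_pos n with rfl | hn
    · simp
    · have : 0 ≤ log (n : ℝ) := log_nonneg (by exact_mod_cast hn)
      positivity
  have hfin : ∀ N : ℕ, ∫ t in t₀..(t₀ + T),
      ‖∑ n ∈ Finset.range N, a n * (n : ℂ) ^ (-(t * Complex.I) : ℂ)‖ ^ 2 ≤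
      T * ∑' n, ‖a n‖ ^ 2 + 4 * (∑' n, ‖a n‖) ^ 2 + 4 * ∑' n : ℕ,
          ‖a n‖ ^ 2 * (n * (1 + log n)) := by
    intro N
    have e1 : ∀ t : ℝ, ∑ n ∈ Finset.range N, a n * (n : ℂ) ^ (-(t * Complex.I) : ℂ) =
        ∑ n ∈ Finset.range N with 1 ≤ n, a n * (n : ℂ) ^ (-(t * Complex.I) : ℂ) := by
      intro t
      rw [Finset.sum_filter]
      refine Finset.sum_congr rfl fun n _ => ?_
      split_ifs with h
      · rfl
      · rw [show n = 0 by omega, ha0, zero_mul]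
    simp only [e1]
    refine (integral_norm_sq_dirichlet_le _
      (fun n hn => (Finset.mem_filter.1 hn).2) a t₀ hT).trans ?_
    gcongr
    · exact ha2.sum_le_tsum _ fun n _ => by positivity
    · exact ha.sum_le_tsum _ fun n _ => by positivity
    · exact hal.sum_le_tsum _ fun n _ => hpos n
  refine le_of_tendsto (x := atTop) ?_ (Eventually.of_forall hfin)
  refine intervalIntegral.tendsto_integral_filter_of_dominated_convergence
    (fun _ => (∑' n, ‖a n‖) ^ 2) (Eventually.of_forall fun N => ?_)
    (Eventually.of_forall fun N => Eventually.of_forall fun t _ => ?_) (by simp)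
    (Eventually.of_forall fun t _ => ?_)
  · refine Continuous.aestronglyMeasurable ?_
    refine (continuous_norm.comp (continuous_finsetSum _ fun n _ => ?_)).pow 2
    rcases Nat.eq_zero_or_pos n with rfl | hn
    · simpa [ha0] using continuous_const
    · simp only [natCast_cpow_neg_mul_I hn]
      fun_prop
  · rw [Real.norm_eq_abs, abs_of_nonneg (by positivity)]
    gcongr
    refine (norm_sum_le _ _).trans ((Finset.sum_le_sum fun n _ => hnorm n t).trans ?_)
    exact ha.sum_le_tsum _ fun n _ => by positivity
  · have : Summable fun n => a n * (n : ℂ) ^ (-(t * Complex.I) : ℂ) :=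
      Summable.of_norm_bounded ha fun n => hnorm n t
    exact (this.hasSum.tendsto_sum_nat.norm).pow 2

/-- The number of `k`-tuples in the dyadic block `(N, 2 * N]` with product `m`. -/
def blockCount (k N m : ℕ) : ℕ :=
  (Finset.filter (fun p => ∏ i, p i = m)
    (Fintype.piFinset fun _ : Fin k => Finset.Ioc N (2 * N))).card

lemma blockCount_le (k N m : ℕ) (hm : 1 ≤ m) : blockCount k N m ≤ m.divisors.card ^ k := by
  unfold blockCount
  calc _ ≤ (Fintype.piFinset fun _ : Fin k => m.divisors).card := by
        refine Finset.card_le_card fun p hp => ?_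
        rw [Finset.mem_filter] at hp
        rw [Fintype.mem_piFinset]
        intro i
        rw [Nat.mem_divisors]
        exact ⟨hp.2 ▸ Finset.dvd_prod_of_mem p (Finset.mem_univ i), by omega⟩
    _ = m.divisors.card ^ k := by simp

lemma natCast_prod_cpow {ι : Type*} (S : Finset ι) (f : ι → ℕ) (s : ℂ) :
    (∏ i ∈ S, (f i : ℂ)) ^ s = ∏ i ∈ S, (f i : ℂ) ^ s := by
  classical
  induction S using Finset.induction_on with
  | empty => simp
  | insert i S hi ih =>
    rw [Finset.prod_insert hi, Finset.prod_insert hi, ← ih, ← Nat.cast_prod,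
      Complex.natCast_mul_natCast_cpow]

lemma block_pow_eq (k N : ℕ) (s : ℂ) :
    (∑ n ∈ Finset.Ioc N (2 * N), (n : ℂ) ^ (-s)) ^ k =
      ∑ m ∈ Finset.Icc (N ^ k) ((2 * N) ^ k), (blockCount k N m : ℂ) * (m : ℂ) ^ (-s) := by
  rw [Finset.sum_pow']
  rw [← Finset.sum_fiberwise_of_maps_to (s := Fintype.piFinset fun _ : Fin k =>
      Finset.Ioc N (2 * N))
    (t := Finset.Icc (N ^ k) ((2 * N) ^ k)) (g := fun p => ∏ i, p i)]
  · refine Finset.sum_congr rfl fun m _ => ?_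
    rw [blockCount, ← nsmul_eq_mul, ← Finset.sum_const]
    refine Finset.sum_congr rfl fun p hp => ?_
    rw [← (Finset.mem_filter.1 hp).2, Nat.cast_prod]
    exact (natCast_prod_cpow _ _ _).symm
  · intro p hp
    rw [Fintype.mem_piFinset] at hp
    have h := fun i => Finset.mem_Ioc.1 (hp i)
    rw [Finset.mem_Icc]
    constructor
    · calc N ^ k = ∏ _i : Fin k, N := by simp
        _ ≤ _ := Finset.prod_le_prod' fun i _ => (h i).1.le
    · calc _ ≤ ∏ _i : Fin k, (2 * N) := Finset.prod_le_prod' fun i _ => (h i).2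
        _ = (2 * N) ^ k := by simp

lemma exists_one_add_log_le {η : ℝ} (hη : 0 < η) :
    ∃ C : ℝ, 1 ≤ C ∧ ∀ x : ℝ, 1 ≤ x → 1 + log x ≤ C * x ^ η := by
  refine ⟨1 + 1 / η, by have : 0 < 1 / η := by positivity
                        linarith, fun x hx => ?_⟩
  have h1 := log_le_rpow_div (by linarith : 0 ≤ x) hη
  have h2 : 1 ≤ x ^ η := one_le_rpow hx hη.le
  calc 1 + log x ≤ x ^ η + x ^ η / η := by linarith
    _ = _ := by ring

lemma exists_moment_block_le (k : ℕ) {η : ℝ} (hη : 0 < η) :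
    ∃ C : ℝ, 0 ≤ C ∧ ∀ N : ℕ, 1 ≤ N → ∀ σ : ℝ, 0 ≤ σ → ∀ t₀ T : ℝ, 0 ≤ T → T ≤ (N : ℝ) ^ k →
      ∫ t in t₀..(t₀ + T),
        ‖∑ n ∈ Finset.Ioc N (2 * N), (n : ℂ) ^ (-(σ + t * Complex.I) : ℂ)‖ ^ (2 * k) ≤
      C * ((N : ℝ) ^ k) ^ (2 - 2 * σ + 3 * η) := by
  obtain ⟨C₁, hC₁, hd⟩ := exists_card_divisors_pow_le k hη
  obtain ⟨C₂, hC₂, hl⟩ := exists_one_add_log_le hη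
  set D : ℝ := 2 ^ k with hD
  have hD1 : 1 ≤ D := one_le_pow₀ (by norm_num)
  refine ⟨C₁ ^ 2 * (D ^ η) ^ 2 * D + 4 * (C₁ * D ^ η * D) ^ 2 +
    4 * (C₁ ^ 2 * (D ^ η) ^ 3 * C₂ * D ^ 2), by positivity, ?_⟩
  intro N hN σ hσ t₀ T hT hTN
  set M : ℝ := (N : ℝ) ^ k with hM
  have hN1 : (1 : ℝ) ≤ N := by exact_mod_cast hN
  have hM1 : 1 ≤ M := one_le_pow₀ hN1
  have hM0 : 0 < M := by linarith
  set S := Finset.Icc (N ^ k) ((2 * N) ^ k) with hS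
  have hS1 : ∀ m ∈ S, 1 ≤ m := fun m hm => (Nat.one_le_pow _ _ hN).trans (Finset.mem_Icc.1 hm).1
  have hSl : ∀ m ∈ S, M ≤ m := fun m hm => by
    have := (Finset.mem_Icc.1 hm).1
    rw [hM]; exact_mod_cast this
  have hSu : ∀ m ∈ S, (m : ℝ) ≤ D * M := fun m hm => by
    have := (Finset.mem_Icc.1 hm).2
    rw [hM, hD, ← mul_pow]; exact_mod_cast this
  have hcard : (S.card : ℝ) ≤ D * M := by
    have h1 : S.card ≤ (2 * N) ^ k := by
      have : 1 ≤ N ^ k := Nat.one_le_pow _ _ hN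
      rw [hS, Nat.card_Icc]; omega
    rw [hM, hD, ← mul_pow]; exact_mod_cast h1
  set a : ℕ → ℂ := fun m => (blockCount k N m : ℂ) * (m : ℂ) ^ (-(σ : ℂ)) with ha
  have hA : ∀ m ∈ S, ‖a m‖ ≤ C₁ * D ^ η * M ^ (η - σ) := by
    intro m hm
    have hm1 := hS1 m hm
    have hmr : (0 : ℝ) < m := by exact_mod_cast hm1
    rw [ha]
    simp only
    rw [norm_mul, Complex.norm_natCast, Complex.norm_natCast_cpow_of_pos hm1]
    have e1 : ((blockCount k N m : ℕ) : ℝ) ≤ C₁ * (D * M) ^ η := by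
      calc ((blockCount k N m : ℕ) : ℝ) ≤ ((m.divisors.card ^ k : ℕ) : ℝ) := by
            exact_mod_cast blockCount_le k N m hm1
        _ ≤ C₁ * (m : ℝ) ^ η := by push_cast; exact hd m hm1
        _ ≤ _ := by gcongr; exact hSu m hm
    have e2 : (m : ℝ) ^ (-(σ : ℂ)).re ≤ M ^ (-σ) := by
      simp only [Complex.neg_re, Complex.ofReal_re]
      exact rpow_le_rpow_of_nonpos hM0 (hSl m hm) (by linarith)
    calc _ ≤ C₁ * (D * M) ^ η * M ^ (-σ) := by gcongr
      _ = _ := by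
        rw [mul_rpow (by positivity) hM0.le, sub_eq_add_neg, rpow_add hM0]; ring
  have hB : (0 : ℝ) ≤ C₁ * D ^ η * M ^ (η - σ) := by positivity
  have e0 : ∀ t : ℝ, ‖∑ n ∈ Finset.Ioc N (2 * N), (n : ℂ) ^ (-(σ + t * Complex.I) : ℂ)‖ ^ (2 * k) =
      ‖∑ m ∈ S, a m * (m : ℂ) ^ (-(t * Complex.I) : ℂ)‖ ^ 2 := by
    intro t
    rw [mul_comm 2 k, pow_mul, ← norm_pow, block_pow_eq]
    congr 2
    refine Finset.sum_congr rfl fun m hm => ?_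
    have : (m : ℂ) ≠ 0 := by have := hS1 m hm; exact_mod_cast (by omega : m ≠ 0)
    rw [ha, neg_add, Complex.cpow_add _ _ this, mul_assoc]
  simp only [e0]
  refine (integral_norm_sq_dirichlet_le S hS1 a t₀ hT).trans ?_
  set B := C₁ * D ^ η * M ^ (η - σ) with hBdef
  have s1 : ∑ m ∈ S, ‖a m‖ ^ 2 ≤ D * M * B ^ 2 := by
    calc _ ≤ ∑ m ∈ S, B ^ 2 := Finset.sum_le_sum fun m hm => by gcongr; exact hA m hm
      _ = S.card * B ^ 2 := by simp
      _ ≤ _ := by gcongr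
  have s2 : ∑ m ∈ S, ‖a m‖ ≤ D * M * B := by
    calc _ ≤ ∑ m ∈ S, B := Finset.sum_le_sum fun m hm => hA m hm
      _ = S.card * B := by simp
      _ ≤ _ := by gcongr
  have s3 : ∑ m ∈ S, ‖a m‖ ^ 2 * (m * (1 + log m)) ≤
      D * M * (B ^ 2 * (D * M * (C₂ * (D * M) ^ η))) := by
    calc _ ≤ ∑ m ∈ S, B ^ 2 * (D * M * (C₂ * (D * M) ^ η)) := by
          refine Finset.sum_le_sum fun m hm => ?_
          have hm1 : (1 : ℝ) ≤ m := by exact_mod_cast hS1 m hm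
          have l0 := log_nonneg hm1
          have l1 : 1 + log (m : ℝ) ≤ C₂ * (D * M) ^ η :=
              (hl m hm1).trans (by gcongr; exact hSu m hm)
          have := hA m hm
          have := hSu m hm
          gcongr
      _ = S.card * (B ^ 2 * (D * M * (C₂ * (D * M) ^ η))) := by simp
      _ ≤ _ := by gcongr
  have q1 : M ^ 2 * (M ^ (η - σ)) ^ 2 ≤ M ^ (2 - 2 * σ + 3 * η) := by
    rw [← rpow_natCast M 2, ← rpow_natCast _ 2, ← rpow_mul hM0.le, ← rpow_add hM0]
    refine rpow_le_rpow_of_exponent_le hM1 ?_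
    push_cast; linarith
  have q2 : M ^ 2 * (M ^ (η - σ)) ^ 2 * M ^ η ≤ M ^ (2 - 2 * σ + 3 * η) := by
    rw [← rpow_natCast M 2, ← rpow_natCast _ 2, ← rpow_mul hM0.le, ← rpow_add hM0, ← rpow_add hM0]
    refine rpow_le_rpow_of_exponent_le hM1 ?_
    push_cast; linarith
  calc _ ≤ M * (D * M * B ^ 2) + 4 * (D * M * B) ^ 2 +
        4 * (D * M * (B ^ 2 * (D * M * (C₂ * (D * M) ^ η)))) := by gcongr
    _ = (C₁ ^ 2 * (D ^ η) ^ 2 * D) * (M ^ 2 * (M ^ (η - σ)) ^ 2) +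
        4 * (C₁ * D ^ η * D) ^ 2 * (M ^ 2 * (M ^ (η - σ)) ^ 2) +
        4 * (C₁ ^ 2 * (D ^ η) ^ 3 * C₂ * D ^ 2) * (M ^ 2 * (M ^ (η - σ)) ^ 2 * M ^ η) := by
        rw [hBdef, mul_rpow (x := D) (by positivity) hM0.le]; ring
    _ ≤ (C₁ ^ 2 * (D ^ η) ^ 2 * D) * M ^ (2 - 2 * σ + 3 * η) +
        4 * (C₁ * D ^ η * D) ^ 2 * M ^ (2 - 2 * σ + 3 * η) +
        4 * (C₁ ^ 2 * (D ^ η) ^ 3 * C₂ * D ^ 2) * M ^ (2 - 2 * σ + 3 * η) := by gcongr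
    _ = _ := by ring

end WeightedDivisor

namespace WeightedDivisor

open MeasureTheory Filter Topology

lemma integrable_one_add_abs_rpow {r : ℝ} (hr : 1 < r) :
    Integrable fun τ : ℝ => (1 + |τ|) ^ (-r) := by
  have := integrable_one_add_norm (E := ℝ) (μ := volume) (r := r) (by simpa using hr)
  simpa using this

lemma integrable_of_norm_le_rpow {f : ℝ → ℂ} (hf : Continuous f) {C r : ℝ} (hr : 1 < r)
    (h : ∀ τ : ℝ, 1 ≤ |τ| → ‖f τ‖ ≤ C * (1 + |τ|) ^ (-r)) : Integrable f := by
  obtain ⟨K, hK⟩ := (isCompact_Icc (a := (-1 : ℝ)) (b := 1)).exists_bound_of_continuousOn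
    hf.continuousOn
  have hK0 : 0 ≤ K := (norm_nonneg _).trans (hK 0 (by simp))
  refine ((integrable_one_add_abs_rpow hr).const_mul (|C| + K * 2 ^ r)).mono'
    hf.aestronglyMeasurable (Eventually.of_forall fun τ => ?_)
  have hp : 0 < (1 + |τ|) ^ (-r) := by positivity
  rcases le_or_gt 1 |τ| with h1 | h1
  · calc ‖f τ‖ ≤ C * (1 + |τ|) ^ (-r) := h τ h1
      _ ≤ (|C| + K * 2 ^ r) * (1 + |τ|) ^ (-r) := by
        gcongr
        have := le_abs_self C
        have : 0 ≤ K * (2 : ℝ) ^ r := by positivity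
        linarith
  · have h2 : (2 : ℝ) ^ (-r) ≤ (1 + |τ|) ^ (-r) :=
      rpow_le_rpow_of_nonpos (by positivity) (by linarith) (by linarith)
    calc ‖f τ‖ ≤ K := hK τ (by rw [Set.mem_Icc]; exact abs_le.1 h1.le)
      _ = K * 2 ^ r * 2 ^ (-r) := by
        rw [mul_assoc, ← rpow_add (by norm_num)]; simp
      _ ≤ K * 2 ^ r * (1 + |τ|) ^ (-r) := by gcongr
      _ ≤ _ := by
        gcongr
        linarith [abs_nonneg C]

/-- Equality of the integrals over the two sides of a vertical strip. -/
lemma integral_vertical_eq {g : ℂ → ℂ} {a b : ℝ} (hab : a ≤ b)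
    (hg : DifferentiableOn ℂ g {z | a ≤ z.re ∧ z.re ≤ b}) {C r : ℝ} (hr : 1 < r)
    (hB : ∀ x τ : ℝ, a ≤ x → x ≤ b → 1 ≤ |τ| →
      ‖g (x + τ * Complex.I)‖ ≤ C * (1 + |τ|) ^ (-r)) :
    ∫ τ : ℝ, g (a + τ * Complex.I) = ∫ τ : ℝ, g (b + τ * Complex.I) := by
  have hcont : ∀ x : ℝ, a ≤ x → x ≤ b → Continuous fun τ : ℝ => g (x + τ * Complex.I) := by
    intro x hx hx'
    refine hg.continuousOn.comp_continuous (by fun_prop) fun τ => ?_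
    simp [hx, hx']
  have hint : ∀ x : ℝ, a ≤ x → x ≤ b → Integrable fun τ : ℝ => g (x + τ * Complex.I) :=
    fun x hx hx' => integrable_of_norm_le_rpow (hcont x hx hx') hr fun τ => hB x τ hx hx'
  have hlim : ∀ x : ℝ, a ≤ x → x ≤ b → Tendsto
      (fun R : ℝ => ∫ τ in (-R)..R, g (x + τ * Complex.I)) atTop
      (𝓝 (∫ τ : ℝ, g (x + τ * Complex.I))) := fun x hx hx' =>
    intervalIntegral_tendsto_integral (hint x hx hx') tendsto_neg_atTop_atBot tendsto_id
  have hdiff : Tendsto (fun R : ℝ => (∫ τ in (-R)..R, g (b + τ * Complex.I)) -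
      ∫ τ in (-R)..R, g (a + τ * Complex.I)) atTop (𝓝 0) := by
    have hz : Tendsto (fun R : ℝ => 2 * ((|C| * (1 + R) ^ (-r)) * |b - a|)) atTop (𝓝 0) := by
      have h1 : Tendsto (fun R : ℝ => (1 + R) ^ (-r)) atTop (𝓝 0) :=
        (tendsto_rpow_neg_atTop (by linarith : 0 < r)).comp
            (tendsto_atTop_add_const_left _ 1 tendsto_id)
      simpa using ((h1.const_mul |C|).mul_const |b - a|).const_mul 2
    refine squeeze_zero_norm' ?_ hz
    filter_upwards [eventually_ge_atTop 1] with R hR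
    have hrect := Complex.integral_boundary_rect_eq_zero_of_differentiableOn g
      ⟨a, -R⟩ ⟨b, R⟩ (hg.mono fun z hz => by
        rw [Complex.mem_reProdIm, Set.uIcc_of_le hab] at hz
        exact hz.1)
    simp only at hrect
    have hh : ∀ τ : ℝ, |τ| = R → ‖∫ x : ℝ in a..b, g (x + τ * Complex.I)‖ ≤
        (|C| * (1 + R) ^ (-r)) * |b - a| := by
      intro τ hτ
      refine intervalIntegral.norm_integral_le_of_norm_le_const fun x hx => ?_
      rw [Set.uIoc_of_le hab] at hx
      refine (hB x τ hx.1.le hx.2 (by rw [hτ]; exact hR)).trans ?_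
      rw [hτ]
      gcongr
      exact le_abs_self C
    have e1 := hh (-R) (by rw [abs_neg, abs_of_pos (by linarith)])
    have e2 := hh R (abs_of_pos (by linarith))
    have e3 : (∫ τ in (-R)..R, g (b + τ * Complex.I)) - ∫ τ in (-R)..R, g (a + τ * Complex.I) =
        Complex.I * ((∫ x : ℝ in a..b, g (x + (-R : ℝ) * Complex.I)) -
          ∫ x : ℝ in a..b, g (x + R * Complex.I)) := by
      simp only [smul_eq_mul] at hrect
      linear_combination (-Complex.I) * hrect + ((∫ τ in (-R)..R, g (b + τ * Complex.I)) -
        ∫ τ in (-R)..R, g (a + τ * Complex.I)) * Complex.I_sq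
    rw [e3, norm_mul, Complex.norm_I, one_mul]
    refine (norm_sub_le _ _).trans ?_
    linarith
  have := ((hlim b hab le_rfl).sub (hlim a le_rfl hab))
  exact (sub_eq_zero.1 (tendsto_nhds_unique this hdiff)).symm

lemma integrable_exp_neg_sq : Integrable fun v : ℝ => rexp (-v ^ 2) := by
  simpa using integrable_exp_neg_mul_sq (b := 1) one_pos

lemma norm_cexp_sq (x v : ℝ) :
    ‖Complex.exp ((x + v * Complex.I) ^ 2)‖ = rexp (x ^ 2) * rexp (-v ^ 2) := by
  rw [Complex.norm_exp, ← Real.exp_add]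
  congr 1
  rw [sq, Complex.mul_re]
  simp; ring

/-- The Gaussian residue integral. -/
lemma integral_cexp_sq_div {c : ℝ} (hc : 0 < c) :
    ∫ v : ℝ, Complex.exp ((c + v * Complex.I) ^ 2) / (c + v * Complex.I) = π := by
  have e1 : ∀ v : ℝ, Complex.exp ((c + v * Complex.I) ^ 2) / (c + v * Complex.I) =
      ∫ u : ℝ in Set.Ioi 0, Complex.exp ((c + v * Complex.I) ^ 2) *
        Complex.exp (-(c + v * Complex.I) * u) := by
    intro v
    have hre : (-(c + v * Complex.I)).re < 0 := by simpa using hc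
    rw [integral_const_mul, integral_exp_mul_complex_Ioi hre]
    simp only [Complex.ofReal_zero, mul_zero, Complex.exp_zero, neg_div_neg_eq, mul_one_div]
  simp_rw [e1]
  rw [integral_integral_swap]
  · have e2 : ∀ u : ℝ, ∫ v : ℝ, Complex.exp ((c + v * Complex.I) ^ 2) *
        Complex.exp (-(c + v * Complex.I) * u) = ((√π * rexp (-(1 / 4) * u ^ 2) : ℝ) : ℂ) := by
      intro u
      have := integral_cexp_quadratic (b := -1) (by simp) ((2 * c - u) * Complex.I) (c ^ 2 - c * u)
      rw [neg_neg, div_one] at this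
      have e : ∀ v : ℝ, Complex.exp ((c + v * Complex.I) ^ 2) *
          Complex.exp (-(c + v * Complex.I) * u) =
          Complex.exp (-1 * (v : ℂ) ^ 2 + (2 * c - u) * Complex.I * v + (c ^ 2 - c * u)) := by
        intro v
        rw [← Complex.exp_add]
        congr 1
        linear_combination (v : ℂ) ^ 2 * Complex.I_sq
      simp_rw [e]
      rw [this]
      push_cast
      rw [Real.sqrt_eq_rpow, Complex.ofReal_cpow pi_pos.le]
      push_cast
      congr 2
      rw [mul_pow, Complex.I_sq]
      ring
    simp_rw [e2]
    rw [integral_complex_ofReal, integral_const_mul, integral_gaussian_Ioi]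
    congr 1
    rw [show π / (1 / 4) = π * 2 ^ 2 by ring, Real.sqrt_mul pi_pos.le, Real.sqrt_sq (by norm_num)]
    have := Real.mul_self_sqrt pi_pos.le
    linarith
  · have h1 : Integrable (fun v : ℝ => rexp (c ^ 2) * rexp (-v ^ 2)) :=
      integrable_exp_neg_sq.const_mul _
    have h2 : Integrable (fun u : ℝ => rexp (-c * u)) (volume.restrict (Set.Ioi 0)) :=
      exp_neg_integrableOn_Ioi 0 hc
    refine (h1.mul_prod h2).mono' ?_ (Eventually.of_forall fun p => ?_)
    · exact Continuous.aestronglyMeasurable (by fun_prop)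
    · simp only [Function.uncurry]
      rw [norm_mul, norm_cexp_sq]
      gcongr
      rw [Complex.norm_exp]
      gcongr
      simp

lemma integral_cexp_sq_div_neg {c : ℝ} (hc : c < 0) :
    ∫ v : ℝ, Complex.exp ((c + v * Complex.I) ^ 2) / (c + v * Complex.I) = -π := by
  rw [← integral_cexp_sq_div (neg_pos.2 hc), ← integral_neg, ← integral_neg_eq_self]
  refine integral_congr_ae (Eventually.of_forall fun v => ?_)
  simp only
  rw [← div_neg]
  congr 1
  · congr 1; push_cast; ring
  · push_cast; ring

lemma exists_exp_mul_exp_neg_sq_le (A : ℝ) :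
    ∃ K : ℝ, 0 ≤ K ∧ ∀ v : ℝ, rexp (A * |v|) * rexp (-v ^ 2) ≤ K * (1 + |v|) ^ (-2 : ℝ) := by
  refine ⟨rexp ((A + 2) ^ 2), (Real.exp_pos _).le, fun v => ?_⟩
  have h1 : (1 + |v|) ^ (2 : ℝ) ≤ rexp (2 * |v|) := by
    rw [mul_comm, Real.exp_mul]
    gcongr
    linarith [Real.add_one_le_exp |v|]
  rw [rpow_neg (by positivity), ← div_eq_mul_inv, le_div_iff₀ (by positivity)]
  calc _ ≤ rexp (A * |v|) * rexp (-v ^ 2) * rexp (2 * |v|) := by gcongr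
    _ = rexp (A * |v| + -v ^ 2 + 2 * |v|) := by rw [Real.exp_add, Real.exp_add]
    _ ≤ _ := by
      gcongr
      rw [← sq_abs v]
      nlinarith [sq_nonneg (|v| - (A + 2) / 2), sq_nonneg (A + 2)]

lemma integral_vertical_gauss_eq {g : ℂ → ℂ} {a b : ℝ} (hab : a ≤ b)
    (hg : DifferentiableOn ℂ g {z | a ≤ z.re ∧ z.re ≤ b}) {C A : ℝ} (hC : 0 ≤ C)
    (hB : ∀ x v : ℝ, a ≤ x → x ≤ b → 1 ≤ |v| →
      ‖g (x + v * Complex.I)‖ ≤ C * (rexp (A * |v|) * rexp (-v ^ 2))) :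
    ∫ τ : ℝ, g (a + τ * Complex.I) = ∫ τ : ℝ, g (b + τ * Complex.I) := by
  obtain ⟨K, hK0, hK⟩ := exists_exp_mul_exp_neg_sq_le A
  refine integral_vertical_eq (C := C * K) (r := 2) hab hg (by norm_num) fun x v hx hx' hv => ?_
  refine (hB x v hx hx' hv).trans ?_
  rw [mul_assoc]
  exact mul_le_mul_of_nonneg_left (hK v) hC

lemma integrable_vertical_gauss {g : ℝ → ℂ} (hg : Continuous g) {C A : ℝ} (hC : 0 ≤ C)
    (hB : ∀ v : ℝ, 1 ≤ |v| → ‖g v‖ ≤ C * (rexp (A * |v|) * rexp (-v ^ 2))) : Integrable g := by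
  obtain ⟨K, hK0, hK⟩ := exists_exp_mul_exp_neg_sq_le A
  refine integrable_of_norm_le_rpow (C := C * K) (r := 2) hg (by norm_num) fun v hv => ?_
  refine (hB v hv).trans ?_
  rw [mul_assoc]
  exact mul_le_mul_of_nonneg_left (hK v) hC

/-- The residue formula with a Gaussian kernel. -/
lemma integral_vertical_gauss_div {g : ℂ → ℂ} {a b : ℝ} (ha : a < 0) (hb : 0 < b)
    (hg : DifferentiableOn ℂ g {z | a ≤ z.re ∧ z.re ≤ b}) {C A : ℝ} (hC : 0 ≤ C) (hA : 0 ≤ A)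
    (hB : ∀ x v : ℝ, a ≤ x → x ≤ b → ‖g (x + v * Complex.I)‖ ≤ C * rexp (A * |v|)) :
    (∫ v : ℝ, g (b + v * Complex.I) * Complex.exp ((b + v * Complex.I) ^ 2) / (b + v * Complex.I)) -
      ∫ v : ℝ, g (a + v * Complex.I) * Complex.exp ((a + v * Complex.I) ^ 2) / (a + v * Complex.I) =
      2 * π * g 0 := by
  set S := {z : ℂ | a ≤ z.re ∧ z.re ≤ b} with hS
  set f : ℂ → ℂ := fun w => (g w - g 0) * Complex.exp (w ^ 2) with hf
  have hSn : S ∈ 𝓝 (0 : ℂ) := by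
    have : {z : ℂ | a < z.re ∧ z.re < b} ∈ 𝓝 (0 : ℂ) :=
      ((isOpen_lt continuous_const Complex.continuous_re).inter
        (isOpen_lt Complex.continuous_re continuous_const)).mem_nhds ⟨by simpa, by simpa⟩
    exact mem_of_superset this fun z hz => ⟨hz.1.le, hz.2.le⟩
  have hfd : DifferentiableOn ℂ f S := by
    refine (hg.sub_const _).mul ?_
    exact Differentiable.differentiableOn (by fun_prop)
  have hdd : DifferentiableOn ℂ (dslope f 0) S := (Complex.differentiableOn_dslope hSn).2 hfd
  have hf0 : f 0 = 0 := by simp [hf]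
  have hds : ∀ w : ℂ, w ≠ 0 → dslope f 0 w = g w * Complex.exp (w ^ 2) / w -
      g 0 * (Complex.exp (w ^ 2) / w) := by
    intro w hw
    rw [dslope_of_ne _ hw, slope_def_field, hf0, sub_zero, sub_zero, hf]
    field_simp
  have hg0 : ‖g 0‖ ≤ C := by simpa using hB 0 0 ha.le hb.le
  set D := rexp (a ^ 2 + b ^ 2) with hD
  have hne : ∀ (x v : ℝ), x ≠ 0 ∨ 1 ≤ |v| → (x + v * Complex.I : ℂ) ≠ 0 := by
    rintro x v h h0
    have h1 := congrArg Complex.re h0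
    have h2 := congrArg Complex.im h0
    simp at h1 h2
    rcases h with h | h
    · exact h h1
    · rw [h2] at h; simp at h; linarith
  have hexp : ∀ x v : ℝ, a ≤ x → x ≤ b →
      ‖Complex.exp ((x + v * Complex.I) ^ 2)‖ ≤ D * rexp (-v ^ 2) := by
    intro x v hx hx'
    rw [norm_cexp_sq]
    refine mul_le_mul_of_nonneg_right (Real.exp_le_exp.2 ?_) (Real.exp_pos _).le
    rcases le_total 0 x with h | h <;> nlinarith [sq_nonneg a, sq_nonneg b]
  have hnorm : ∀ x v : ℝ, 1 ≤ |v| → 1 ≤ ‖(x + v * Complex.I : ℂ)‖ := by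
    intro x v hv
    refine hv.trans ?_
    have := Complex.abs_im_le_norm (x + v * Complex.I : ℂ)
    simpa using this
  have b1 : ∀ x v : ℝ, a ≤ x → x ≤ b → 1 ≤ |v| →
      ‖g (x + v * Complex.I) * Complex.exp ((x + v * Complex.I) ^ 2) / (x + v * Complex.I)‖ ≤
      C * D * (rexp (A * |v|) * rexp (-v ^ 2)) := by
    intro x v hx hx' hv
    rw [norm_div, norm_mul]
    refine (div_le_self (by positivity) (hnorm x v hv)).trans ?_
    calc _ ≤ C * rexp (A * |v|) * (D * rexp (-v ^ 2)) := by
          gcongr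
          · exact hB x v hx hx'
          · exact hexp x v hx hx'
      _ = _ := by ring
  have b2 : ∀ x v : ℝ, a ≤ x → x ≤ b → 1 ≤ |v| →
      ‖g 0 * (Complex.exp ((x + v * Complex.I) ^ 2) / (x + v * Complex.I))‖ ≤
      C * D * (rexp (A * |v|) * rexp (-v ^ 2)) := by
    intro x v hx hx' hv
    rw [norm_mul, norm_div]
    have h1 : (1 : ℝ) ≤ rexp (A * |v|) := Real.one_le_exp (by positivity)
    calc _ ≤ C * (1 * (D * rexp (-v ^ 2))) := by
          gcongr
          rw [one_mul]
          exact (div_le_self (by positivity) (hnorm x v hv)).trans (hexp x v hx hx')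
      _ ≤ C * (rexp (A * |v|) * (D * rexp (-v ^ 2))) := by gcongr
      _ = _ := by ring
  have hCD : 0 ≤ C * D := by positivity
  have hmain := integral_vertical_gauss_eq (g := dslope f 0) (C := C * D + C * D) (A := A)
    (ha.le.trans hb.le) hdd (by positivity) fun x v hx hx' hv => by
      rw [hds _ (hne x v (Or.inr hv)), add_mul]
      exact (norm_sub_le _ _).trans (add_le_add (b1 x v hx hx' hv) (b2 x v hx hx' hv))
  have split : ∀ x : ℝ, a ≤ x → x ≤ b → x ≠ 0 → ∫ v : ℝ, dslope f 0 (x + v * Complex.I) =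
      (∫ v : ℝ, g (x + v * Complex.I) * Complex.exp
          ((x + v * Complex.I) ^ 2) / (x + v * Complex.I)) -
      g 0 * ∫ v : ℝ, Complex.exp ((x + v * Complex.I) ^ 2) / (x + v * Complex.I) := by
    intro x hx hx' hx0
    have e : (fun v : ℝ => dslope f 0 (x + v * Complex.I)) = fun v : ℝ =>
        g (x + v * Complex.I) * Complex.exp ((x + v * Complex.I) ^ 2) / (x + v * Complex.I) -
        g 0 * (Complex.exp ((x + v * Complex.I) ^ 2) / (x + v * Complex.I)) :=
      funext fun v => hds _ (hne x v (Or.inl hx0))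
    rw [e]
    have hc1 : Continuous fun v : ℝ => g (x + v * Complex.I) :=
      hg.continuousOn.comp_continuous (by fun_prop) fun v => ⟨by simpa using hx, by simpa using hx'⟩
    have hnz : ∀ v : ℝ, (x + v * Complex.I : ℂ) ≠ 0 := fun v => hne x v (Or.inl hx0)
    rw [integral_sub, integral_const_mul]
    · exact integrable_vertical_gauss ((hc1.mul (by fun_prop)).div (by fun_prop) hnz) hCD
        fun v => b1 x v hx hx'
    · exact integrable_vertical_gauss (continuous_const.mul
        (Continuous.div (by fun_prop) (by fun_prop) hnz)) hCD fun v => b2 x v hx hx'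
  rw [split a le_rfl (ha.le.trans hb.le) ha.ne, split b (ha.le.trans hb.le) le_rfl hb.ne',
    integral_cexp_sq_div hb, integral_cexp_sq_div_neg ha] at hmain
  linear_combination -hmain

/-- The factor of the functional equation `ζ(1 - s) = χ(s) ζ(s)`. -/
noncomputable def chi (s : ℂ) : ℂ :=
  2 * (2 * π) ^ (-s) * Complex.Gamma s * Complex.cos (π * s / 2)

lemma zeta_one_sub_eq_chi {s : ℂ} (hs : 0 < s.re) (hs1 : s ≠ 1) :
    riemannZeta (1 - s) = chi s * riemannZeta s := by
  refine riemannZeta_one_sub (fun n h => ?_) hs1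
  rw [h] at hs
  simp at hs
  linarith [(Nat.cast_nonneg n : (0 : ℝ) ≤ n)]

lemma differentiableAt_chi {s : ℂ} (hs : 0 < s.re) : DifferentiableAt ℂ chi s := by
  have h2 : (2 * π : ℂ) ≠ 0 := by exact_mod_cast (by positivity : (2 * π : ℝ) ≠ 0)
  have hG : DifferentiableAt ℂ Complex.Gamma s := by
    refine Complex.differentiableAt_Gamma s fun m h => ?_
    rw [h] at hs
    simp at hs
    linarith [(Nat.cast_nonneg m : (0 : ℝ) ≤ m)]
  unfold chi
  refine ((DifferentiableAt.mul ?_ ?_).mul hG).mul (by fun_prop)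
  · fun_prop
  · exact (differentiableAt_id.neg).const_cpow (Or.inl h2)

open ComplexConjugate in
lemma chi_conj (s : ℂ) : chi (conj s) = conj (chi s) := by
  unfold chi
  have h : (2 * π : ℂ) ^ (-(conj s)) = conj ((2 * π : ℂ) ^ (-s)) := by
    have h2 : (2 * π : ℂ) = ((2 * π : ℝ) : ℂ) := by push_cast; rfl
    rw [h2, ← map_neg, Complex.cpow_conj _ _ (by
      rw [Complex.arg_ofReal_of_nonneg (by positivity)]; exact pi_pos.ne), Complex.conj_ofReal]
  rw [map_mul, map_mul, map_mul, h, Complex.Gamma_conj, ← Complex.cos_conj, map_div₀, map_mul,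
    Complex.conj_ofReal, map_ofNat]

lemma chi_mul_chi_one_sub {s : ℂ} (hs : s.re = 1 / 2) : chi s * chi (1 - s) = 1 := by
  have h2 : (2 * π : ℂ) ≠ 0 := by exact_mod_cast (by positivity : (2 * π : ℝ) ≠ 0)
  have hsin : Complex.sin (π * s) ≠ 0 := by
    intro h
    rw [Complex.sin_eq_zero_iff] at h
    obtain ⟨k, hk⟩ := h
    have hpi : (π : ℂ) ≠ 0 := by exact_mod_cast pi_ne_zero
    have h1 : s = k := mul_left_cancel₀ hpi (by rw [hk]; ring)
    rw [h1] at hs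
    simp at hs
    have h3 : (2 * k : ℤ) = 1 := by
      have : (2 * k : ℝ) = 1 := by rw [hs]; norm_num
      exact_mod_cast this
    omega
  have e1 := Complex.Gamma_mul_Gamma_one_sub s
  have e2 : Complex.cos (π * (1 - s) / 2) = Complex.sin (π * s / 2) := by
    rw [show (π * (1 - s) / 2 : ℂ) = π / 2 - π * s / 2 by ring, Complex.cos_pi_div_two_sub]
  have e3 : Complex.sin (π * s) = 2 * Complex.sin (π * s / 2) * Complex.cos (π * s / 2) := by
    rw [← Complex.sin_two_mul]; congr 1; ring
  have e4 : (2 * π : ℂ) ^ (-s) * (2 * π) ^ (-(1 - s)) = (2 * (π : ℂ))⁻¹ := by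
    rw [← Complex.cpow_add _ _ h2, show -s + -(1 - s) = (-1 : ℂ) by ring, Complex.cpow_neg_one]
  unfold chi
  calc _ = 2 * ((2 * π : ℂ) ^ (-s) * (2 * π) ^ (-(1 - s))) *
        (Complex.Gamma s * Complex.Gamma (1 - s)) *
        (2 * Complex.sin (π * s / 2) * Complex.cos (π * s / 2)) := by rw [e2]; ring
    _ = 1 := by
      rw [e4, e1, ← e3]
      field_simp

open ComplexConjugate in
lemma norm_chi_half (τ : ℝ) : ‖chi (1 / 2 + τ * Complex.I)‖ = 1 := by
  set s : ℂ := 1 / 2 + τ * Complex.I with hs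
  have h1 := chi_mul_chi_one_sub (s := s) (by simp [hs])
  have h2 : 1 - s = conj s := by
    apply Complex.ext <;> simp [hs]
    norm_num
  rw [h2, chi_conj, Complex.mul_conj'] at h1
  have h3 : ‖chi s‖ ^ 2 = 1 := by exact_mod_cast h1
  nlinarith [norm_nonneg (chi s)]

open ComplexConjugate in
lemma norm_chi_three_half_le (τ : ℝ) : ‖chi (3 / 2 + τ * Complex.I)‖ ≤ 1 + |τ| := by
  set s : ℂ := 1 / 2 + τ * Complex.I with hs
  have h2 : (2 * π : ℂ) ≠ 0 := by exact_mod_cast (by positivity : (2 * π : ℝ) ≠ 0)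
  have hs0 : s ≠ 0 := by
    intro h
    have := congrArg Complex.re h
    simp [hs] at this
  have hsc : ‖Complex.sin (π * s / 2)‖ = ‖Complex.cos (π * s / 2)‖ := by
    have e : conj (π * s / 2) = π / 2 - π * s / 2 := by
      have hc : conj s = 1 - s := by
        apply Complex.ext <;> simp [hs]
        norm_num
      rw [map_div₀, map_mul, Complex.conj_ofReal, map_ofNat, hc]
      ring
    rw [← Complex.cos_pi_div_two_sub, ← e, Complex.cos_conj, RCLike.norm_conj]
  have e1 : chi (3 / 2 + τ * Complex.I) =
      2 * (2 * π) ^ (-s) * (2 * (π : ℂ))⁻¹ * (s * Complex.Gamma s) *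
          (-Complex.sin (π * s / 2)) := by
    rw [show (3 / 2 + τ * Complex.I : ℂ) = s + 1 by rw [hs]; ring, chi, Complex.Gamma_add_one s hs0,
      show -(s + 1) = -s + -1 by ring, Complex.cpow_add _ _ h2, Complex.cpow_neg_one,
      show (π * (s + 1) / 2 : ℂ) = π * s / 2 + π / 2 by ring, Complex.cos_add_pi_div_two]
    ring
  have e2 : ‖chi (3 / 2 + τ * Complex.I)‖ = ‖chi s‖ * (‖s‖ / (2 * π)) := by
    rw [e1, chi]
    simp only [norm_mul, norm_neg, hsc, norm_inv]
    rw [show ‖(2 : ℂ)‖ = 2 by simp, show ‖(π : ℂ)‖ = π by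
      rw [Complex.norm_real, Real.norm_of_nonneg pi_pos.le]]
    ring
  rw [e2, hs, norm_chi_half, one_mul]
  have h3 : ‖(1 / 2 + τ * Complex.I : ℂ)‖ ≤ 1 / 2 + |τ| := by
    refine (norm_add_le _ _).trans ?_
    simp
  have : 1 ≤ 2 * π := by linarith [pi_gt_three]
  refine (div_le_self (norm_nonneg _) this).trans ?_
  linarith

lemma norm_Gamma_le {s : ℂ} (hs : 0 < s.re) : ‖Complex.Gamma s‖ ≤ Real.Gamma s.re := by
  rw [Complex.Gamma_eq_integral hs, Real.Gamma_eq_integral hs, Complex.GammaIntegral]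
  refine (norm_integral_le_integral_norm _).trans (le_of_eq ?_)
  refine setIntegral_congr_fun measurableSet_Ioi fun x hx => ?_
  have hx : 0 < x := hx
  change ‖_‖ = _
  rw [norm_mul, Complex.norm_cpow_eq_rpow_re_of_pos hx, Complex.norm_real,
    Real.norm_of_nonneg (Real.exp_pos _).le]
  simp

lemma norm_cos_le (x y : ℝ) : ‖Complex.cos (x + y * Complex.I)‖ ≤ rexp |y| := by
  rw [Complex.cos, norm_div]
  have h1 : ‖Complex.exp ((x + y * Complex.I) * Complex.I)‖ ≤ rexp |y| := by
    rw [Complex.norm_exp]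
    gcongr
    simp
    exact neg_le_abs y
  have h2 : ‖Complex.exp (-(x + y * Complex.I) * Complex.I)‖ ≤ rexp |y| := by
    rw [Complex.norm_exp]
    gcongr
    simp
    exact le_abs_self y
  rw [show ‖(2 : ℂ)‖ = 2 by simp, div_le_iff₀ (by norm_num)]
  refine (norm_add_le _ _).trans ?_
  linarith

lemma exists_norm_chi_le : ∃ C : ℝ, 0 ≤ C ∧ ∀ x τ : ℝ, 1 / 2 ≤ x → x ≤ 3 / 2 →
    ‖chi (x + τ * Complex.I)‖ ≤ C * rexp (2 * |τ|) := by
  have hc : ContinuousOn Real.Gamma (Set.Icc (1 / 2) (3 / 2)) := by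
    intro x hx
    refine (Real.differentiableAt_Gamma fun m => ?_).continuousAt.continuousWithinAt
    have := hx.1
    have h2 := (Nat.cast_nonneg m : (0 : ℝ) ≤ m)
    intro h; linarith
  obtain ⟨K, hK⟩ := isCompact_Icc.exists_bound_of_continuousOn hc
  have hK0 : 0 ≤ K := (norm_nonneg _).trans (hK 1 (by norm_num))
  refine ⟨2 * K, by positivity, fun x τ hx hx' => ?_⟩
  have h2 : (2 * π : ℂ) = ((2 * π : ℝ) : ℂ) := by push_cast; rfl
  unfold chi
  rw [norm_mul, norm_mul, norm_mul, h2, Complex.norm_cpow_eq_rpow_re_of_pos (by positivity)]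
  have e1 : (2 * π) ^ (-(x + τ * Complex.I : ℂ)).re ≤ 1 := by
    refine rpow_le_one_of_one_le_of_nonpos (by linarith [pi_gt_three]) ?_
    simp; linarith
  have e2 : ‖Complex.Gamma (x + τ * Complex.I)‖ ≤ K := by
    refine (norm_Gamma_le (by simp; linarith)).trans ?_
    simp only [Complex.add_re, Complex.ofReal_re, Complex.mul_re, Complex.I_re, mul_zero,
      Complex.ofReal_im, Complex.I_im, mul_one, sub_self, add_zero]
    exact (le_abs_self _).trans (hK x ⟨hx, hx'⟩)
  have e3 : ‖Complex.cos (π * (x + τ * Complex.I) / 2)‖ ≤ rexp (2 * |τ|) := by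
    rw [show (π * (x + τ * Complex.I) / 2 : ℂ) =
      ((π * x / 2 : ℝ) : ℂ) + ((π * τ / 2 : ℝ) : ℂ) * Complex.I by push_cast; ring]
    refine (norm_cos_le _ _).trans ?_
    gcongr
    rw [abs_div, abs_mul, abs_of_pos pi_pos, abs_of_pos (by norm_num : (0 : ℝ) < 2)]
    nlinarith [pi_lt_four, abs_nonneg τ]
  calc _ ≤ ‖(2 : ℂ)‖ * 1 * K * rexp (2 * |τ|) := by gcongr
    _ = _ := by simp

end WeightedDivisor

namespace WeightedDivisor

lemma dk_zero_right (k : ℕ) : dk k 0 = 0 := by simp [dk]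

lemma dk_zero_left (n : ℕ) : dk 0 n = if n = 1 then 1 else 0 := by
  simp [dk, ArithmeticFunction.one_apply]

lemma dk_succ (k n : ℕ) : dk (k + 1) n = ∑ p ∈ n.divisorsAntidiagonal, dk k p.1 := by
  rw [dk, pow_succ, ArithmeticFunction.mul_apply]
  refine Finset.sum_congr rfl fun p hp => ?_
  have h2 : p.2 ≠ 0 := (Nat.mem_divisorsAntidiagonal.1 hp |> fun h => by
    intro h0; rw [h0, mul_zero] at h; exact h.2 h.1.symm)
  rw [ArithmeticFunction.zeta_apply_ne h2, mul_one, dk]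

lemma LSeriesHasSum_dk (k : ℕ) {s : ℂ} (hs : 1 < s.re) :
    LSeriesHasSum (fun n => (dk k n : ℂ)) s (riemannZeta s ^ k) := by
  induction k with
  | zero =>
    rw [pow_zero, LSeriesHasSum]
    convert hasSum_ite_eq (α := ℂ) (1 : ℕ) 1 using 1
    ext n
    rcases eq_or_ne n 0 with rfl | hn
    · simp
    · rw [LSeries.term_of_ne_zero hn, dk_zero_left]
      split_ifs with h <;> simp [h]
  | succ k ih =>
    rw [pow_succ]
    refine (LSeriesHasSum_congr s _ fun {n} hn => ?_).1 (ih.convolution (LSeriesHasSum_one hs))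
    rw [LSeries.convolution_def, dk_succ]
    simp

lemma LSeriesHasSum_dWeighted (ℓ : ℕ) {a : ℝ} (ha : 0 ≤ a) {s : ℂ} (hs : 1 < s.re) :
    LSeriesHasSum (fun n => (dWeighted ℓ a n : ℂ)) s
      (riemannZeta s ^ 4 * riemannZeta (s + a) ^ ℓ) := by
  have h2 : LSeriesHasSum (fun n => ((dk ℓ n : ℝ) * (n : ℝ) ^ (-a) : ℝ)) s
      (riemannZeta (s + a) ^ ℓ) := by
    have h := LSeriesHasSum_dk ℓ (s := s + a) (by simp; linarith)
    rw [LSeriesHasSum] at h ⊢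
    convert h using 1
    ext n
    rcases eq_or_ne n 0 with rfl | hn
    · simp
    · have hn0 : (n : ℂ) ≠ 0 := by exact_mod_cast hn
      rw [LSeries.term_of_ne_zero hn, LSeries.term_of_ne_zero hn]
      push_cast
      rw [Complex.ofReal_cpow (by positivity), Complex.cpow_add _ _ hn0]
      push_cast
      rw [Complex.cpow_neg]
      have e1 : (n : ℂ) ^ s ≠ 0 := by simp [Complex.cpow_eq_zero_iff, hn0]
      have e2 : (n : ℂ) ^ (a : ℂ) ≠ 0 := by simp [Complex.cpow_eq_zero_iff, hn0]
      field_simp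
  refine (LSeriesHasSum_congr s _ fun {n} hn => ?_).1 ((LSeriesHasSum_dk 4 hs).convolution h2)
  rw [LSeries.convolution_def, dWeighted]
  push_cast
  exact Finset.sum_congr rfl fun _ _ => by ring

lemma LSeriesHasSum.hasSum_mul_cpow {f : ℕ → ℂ} {s b : ℂ} (hf : f 0 = 0)
    (h : LSeriesHasSum f s b) : HasSum (fun n => f n * (n : ℂ) ^ (-s)) b := by
  rw [LSeriesHasSum] at h
  convert h using 1
  ext n
  rw [LSeries.term_def₀ hf]

/-- The partial sum of the Dirichlet series of `ζ²`. -/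
noncomputable def zetaSqHead (N : ℕ) (z : ℂ) : ℂ :=
  ∑ n ∈ Finset.Icc 1 N, (dk 2 n : ℂ) * (n : ℂ) ^ (-z)

/-- The remainder of the Dirichlet series of `ζ²`. -/
noncomputable def zetaSqTail (N : ℕ) (z : ℂ) : ℂ := riemannZeta z ^ 2 - zetaSqHead N z

lemma differentiable_zetaSqHead (N : ℕ) : Differentiable ℂ (zetaSqHead N) := by
  intro z
  unfold zetaSqHead
  refine DifferentiableAt.fun_sum fun n hn => ?_
  have hn0 : (n : ℂ) ≠ 0 := by
    have := (Finset.mem_Icc.1 hn).1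
    exact_mod_cast (by omega : n ≠ 0)
  exact (differentiableAt_id.neg.const_cpow (Or.inl hn0)).const_mul _

lemma norm_natCast_cpow_neg {n : ℕ} (hn : 1 ≤ n) (z : ℂ) :
    ‖(n : ℂ) ^ (-z)‖ = (n : ℝ) ^ (-z.re) := by
  rw [Complex.norm_natCast_cpow_of_pos (by omega), Complex.neg_re]

lemma norm_zetaSqHead_le (N : ℕ) {z : ℂ} {x : ℝ} (hx : x ≤ z.re) :
    ‖zetaSqHead N z‖ ≤ ∑ n ∈ Finset.Icc 1 N, (dk 2 n : ℝ) * (n : ℝ) ^ (-x) := by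
  refine (norm_sum_le _ _).trans (Finset.sum_le_sum fun n hn => ?_)
  have hn1 := (Finset.mem_Icc.1 hn).1
  rw [norm_mul, norm_natCast_cpow_neg hn1, Complex.norm_natCast]
  gcongr
  exact_mod_cast hn1

lemma natCast_cpow_neg_add {n : ℕ} (hn : 1 ≤ n) (α τ : ℝ) :
    (n : ℂ) ^ (-((α : ℂ) + τ * Complex.I)) =
      ((n : ℝ) ^ (-α) : ℝ) * (n : ℂ) ^ (-(τ * Complex.I) : ℂ) := by
  have hn0 : (n : ℂ) ≠ 0 := by exact_mod_cast (by omega : n ≠ 0)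
  rw [neg_add, Complex.cpow_add _ _ hn0, Complex.ofReal_cpow (by positivity)]
  push_cast
  rfl

lemma hasSum_zetaSqTail (N : ℕ) {z : ℂ} (hz : 1 < z.re) :
    HasSum (fun n : ℕ => (if n ≤ N then 0 else (dk 2 n : ℂ)) * (n : ℂ) ^ (-z))
        (zetaSqTail N z) := by
  have h1 := LSeriesHasSum.hasSum_mul_cpow (by simp [dk_zero_right]) (LSeriesHasSum_dk 2 hz)
  have h2 : HasSum (fun n : ℕ => (if n ≤ N then (dk 2 n : ℂ) else 0) * (n : ℂ) ^ (-z))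
      (∑ n ∈ Finset.Icc 1 N, (if n ≤ N then (dk 2 n : ℂ) else 0) * (n : ℂ) ^ (-z)) := by
    refine hasSum_sum_of_ne_finset_zero fun n hn => ?_
    rcases Nat.eq_zero_or_pos n with rfl | h
    · simp [dk_zero_right]
    · rw [if_neg fun h' => hn (Finset.mem_Icc.2 ⟨h, h'⟩), zero_mul]
  have h3 := h1.sub h2
  rw [Finset.sum_congr rfl fun n hn => by rw [if_pos (Finset.mem_Icc.1 hn).2]] at h3
  refine h3.congr_fun ?_
  intro n
  split_ifs <;> simp

lemma exists_integral_norm_sq_zetaSqHead_le {η : ℝ} (hη : 0 < η) :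
    ∃ C : ℝ, 0 ≤ C ∧ ∀ N : ℕ, 1 ≤ N → ∀ α : ℝ, 1 / 2 ≤ α → ∀ t₀ : ℝ,
      ∫ t in t₀..(t₀ + N), ‖zetaSqHead N (α + t * Complex.I)‖ ^ 2 ≤ C * (N : ℝ) ^ (1 + 4 * η) := by
  obtain ⟨C₁, hC₁, hd⟩ := exists_dk_le 2 hη
  obtain ⟨C₂, hC₂, hl⟩ := exists_one_add_log_le hη
  refine ⟨C₁ ^ 2 * C₂ * (5 + 4 * C₂), by positivity, fun N hN α hα t₀ => ?_⟩
  have hN1 : (1 : ℝ) ≤ N := by exact_mod_cast hN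
  have hN0 : (0 : ℝ) < N := by linarith
  set a : ℕ → ℂ := fun n => (dk 2 n : ℂ) * ((n : ℝ) ^ (-α) : ℝ) with ha
  have hS : ∀ n ∈ Finset.Icc 1 N, 1 ≤ n := fun n hn => (Finset.mem_Icc.1 hn).1
  have e : ∀ t : ℝ, zetaSqHead N (α + t * Complex.I) =
      ∑ n ∈ Finset.Icc 1 N, a n * (n : ℂ) ^ (-(t * Complex.I) : ℂ) := by
    intro t
    refine Finset.sum_congr rfl fun n hn => ?_
    rw [natCast_cpow_neg_add (hS n hn), ha, mul_assoc]
  simp_rw [e]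
  refine (integral_norm_sq_dirichlet_le _ hS a t₀ hN0.le).trans ?_
  have han : ∀ n ∈ Finset.Icc 1 N, ‖a n‖ ^ 2 ≤ C₁ ^ 2 * (N : ℝ) ^ (2 * η) * (1 / n) := by
    intro n hn
    have hn1 : (1 : ℝ) ≤ n := by exact_mod_cast hS n hn
    have hnN : (n : ℝ) ≤ N := by exact_mod_cast (Finset.mem_Icc.1 hn).2
    have h1 : ‖a n‖ ≤ C₁ * (N : ℝ) ^ η * (n : ℝ) ^ (-(1 / 2) : ℝ) := by
      simp only [ha]
      rw [norm_mul, Complex.norm_natCast, Complex.norm_real, norm_of_nonneg (by positivity)]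
      gcongr
      exact (hd n (hS n hn)).trans (by gcongr)
    calc ‖a n‖ ^ 2 ≤ (C₁ * (N : ℝ) ^ η * (n : ℝ) ^ (-(1 / 2) : ℝ)) ^ 2 := by gcongr
      _ = C₁ ^ 2 * ((N : ℝ) ^ η) ^ 2 * ((n : ℝ) ^ (-(1 / 2) : ℝ)) ^ 2 := by ring
      _ = _ := by
        rw [← Real.rpow_natCast ((N : ℝ) ^ η), ← Real.rpow_mul hN0.le,
          ← Real.rpow_natCast ((n : ℝ) ^ _), ← Real.rpow_mul (by positivity)]
        norm_num [mul_comm η 2, Real.rpow_neg_one]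
  have hsum : ∑ n ∈ Finset.Icc 1 N, ‖a n‖ ^ 2 ≤ C₁ ^ 2 * C₂ * (N : ℝ) ^ (3 * η) := by
    have h2 : ∑ n ∈ Finset.Icc 1 N, 1 / (n : ℝ) ≤ C₂ * (N : ℝ) ^ η := by
      refine le_trans (le_of_eq ?_) ((sum_one_div_succ_le N).trans (hl N hN1))
      rw [← Finset.Ico_add_one_right_eq_Icc, Finset.sum_Ico_eq_sum_range]
      exact Finset.sum_congr rfl fun n _ => by push_cast; rw [add_comm]
    calc _ ≤ ∑ n ∈ Finset.Icc 1 N, C₁ ^ 2 * (N : ℝ) ^ (2 * η) * (1 / n) := Finset.sum_le_sum han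
      _ = C₁ ^ 2 * (N : ℝ) ^ (2 * η) * ∑ n ∈ Finset.Icc 1 N, 1 / (n : ℝ) := by rw [Finset.mul_sum]
      _ ≤ C₁ ^ 2 * (N : ℝ) ^ (2 * η) * (C₂ * (N : ℝ) ^ η) := by gcongr
      _ = _ := by
        rw [show 3 * η = 2 * η + η by ring, Real.rpow_add hN0]; ring
  have hcs : (∑ n ∈ Finset.Icc 1 N, ‖a n‖) ^ 2 ≤ N * ∑ n ∈ Finset.Icc 1 N, ‖a n‖ ^ 2 := by
    have := sq_sum_le_card_mul_sum_sq (s := Finset.Icc 1 N) (f := fun n => ‖a n‖)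
    simpa using this
  have hlast : ∑ n ∈ Finset.Icc 1 N, ‖a n‖ ^ 2 * (n * (1 + log n)) ≤
      (∑ n ∈ Finset.Icc 1 N, ‖a n‖ ^ 2) * (C₂ * (N * (N : ℝ) ^ η)) := by
    rw [Finset.sum_mul]
    refine Finset.sum_le_sum fun n hn => ?_
    have hn1 : (1 : ℝ) ≤ n := by exact_mod_cast hS n hn
    have hnN : (n : ℝ) ≤ N := by exact_mod_cast (Finset.mem_Icc.1 hn).2
    have := log_nonneg hn1
    have h3 : 1 + log n ≤ C₂ * (N : ℝ) ^ η := (hl n hn1).trans (by gcongr)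
    refine mul_le_mul_of_nonneg_left ?_ (by positivity)
    calc n * (1 + log n) ≤ N * (C₂ * (N : ℝ) ^ η) := by gcongr
      _ = _ := by ring
  have hNη : 1 ≤ (N : ℝ) ^ η := Real.one_le_rpow hN1 hη.le
  set Q := ∑ n ∈ Finset.Icc 1 N, ‖a n‖ ^ 2
  have hQ : 0 ≤ Q := Finset.sum_nonneg fun _ _ => by positivity
  calc _ ≤ N * Q + 4 * (N * Q) + 4 * (Q * (C₂ * (N * (N : ℝ) ^ η))) := by gcongr
    _ = N * Q * (5 * 1 + 4 * C₂ * (N : ℝ) ^ η) := by ring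
    _ ≤ N * (C₁ ^ 2 * C₂ * (N : ℝ) ^ (3 * η)) * (5 * (N : ℝ) ^ η + 4 * C₂ * (N : ℝ) ^ η) := by
      gcongr
    _ = _ := by
      rw [show 1 + 4 * η = 1 + 3 * η + η by ring, Real.rpow_add hN0, Real.rpow_add hN0,
        Real.rpow_one]
      ring

lemma exists_integral_norm_sq_zetaSqTail_le {η : ℝ} (hη : 0 < η) (hη' : η ≤ 1 / 8) :
    ∃ C : ℝ, 0 ≤ C ∧ ∀ N : ℕ, 1 ≤ N → ∀ t₀ : ℝ,
      ∫ t in t₀..(t₀ + N), ‖zetaSqTail N ((3 / 2 : ℝ) + t * Complex.I)‖ ^ 2 ≤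
        C * (N : ℝ) ^ (4 * η - 1) := by
  obtain ⟨C₁, hC₁, hd⟩ := exists_dk_le 2 hη
  obtain ⟨C₂, hC₂, hl⟩ := exists_one_add_log_le hη
  have hZs : Summable fun n : ℕ => (n : ℝ) ^ (-1 - η) :=
    Real.summable_nat_rpow.2 (by linarith)
  set Z := ∑' n : ℕ, (n : ℝ) ^ (-1 - η)
  have hZ : 0 ≤ Z := tsum_nonneg fun n => by positivity
  refine ⟨C₁ ^ 2 * C₂ * Z + 4 * (C₁ * Z) ^ 2 + 4 * (C₁ ^ 2 * C₂ * Z), by positivity,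
    fun N hN t₀ => ?_⟩
  have hN1 : (1 : ℝ) ≤ N := by exact_mod_cast hN
  have hN0 : (0 : ℝ) < N := by linarith
  set a : ℕ → ℂ := fun n => (if n ≤ N then 0 else (dk 2 n : ℂ)) * ((n : ℝ) ^ (-(3 / 2) : ℝ) : ℝ)
    with ha
  have ha0 : a 0 = 0 := by simp [ha]
  have e : ∀ t : ℝ, zetaSqTail N ((3 / 2 : ℝ) + t * Complex.I) =
      ∑' n, a n * (n : ℂ) ^ (-(t * Complex.I) : ℂ) := by
    intro t
    rw [← (hasSum_zetaSqTail N (by simp; norm_num)).tsum_eq]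
    refine tsum_congr fun n => ?_
    rcases Nat.eq_zero_or_pos n with rfl | h
    · simp [ha0]
    · rw [natCast_cpow_neg_add h, ha, mul_assoc]
  simp_rw [e]
  have hb : ∀ n, ‖a n‖ ≤ C₁ * (N : ℝ) ^ (2 * η - 1 / 2) * (n : ℝ) ^ (-1 - η) ∧
      ‖a n‖ ^ 2 * (n * (1 + log n)) ≤ C₁ ^ 2 * C₂ * (N : ℝ) ^ (4 * η - 1) * (n : ℝ) ^ (-1 - η) ∧
      N * ‖a n‖ ^ 2 ≤ ‖a n‖ ^ 2 * (n * (1 + log n)) := by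
    intro n
    by_cases hnN : n ≤ N
    · have : a n = 0 := by simp [ha, hnN]
      rw [this]
      simp
      exact ⟨by positivity, by positivity⟩
    have hNn : (N : ℝ) ≤ n := by exact_mod_cast (by omega : N ≤ n)
    have hn1 : (1 : ℝ) ≤ n := hN1.trans hNn
    have hn0 : (0 : ℝ) < n := by linarith
    have hlog := log_nonneg hn1
    have h1 : ‖a n‖ ≤ C₁ * (n : ℝ) ^ (η - 3 / 2) := by
      simp only [ha, if_neg hnN]
      rw [norm_mul, Complex.norm_natCast, Complex.norm_real, norm_of_nonneg (by positivity),
        sub_eq_add_neg, Real.rpow_add hn0, ← mul_assoc]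
      gcongr
      exact hd n (by exact_mod_cast hn1)
    refine ⟨h1.trans ?_, ?_, ?_⟩
    · rw [show η - 3 / 2 = (2 * η - 1 / 2) + (-1 - η) by ring, Real.rpow_add hn0, ← mul_assoc]
      gcongr C₁ * ?_ * _
      exact Real.rpow_le_rpow_of_nonpos hN0 hNn (by linarith)
    · calc ‖a n‖ ^ 2 * (n * (1 + log n)) ≤
          (C₁ * (n : ℝ) ^ (η - 3 / 2)) ^ 2 * (n * (C₂ * (n : ℝ) ^ η)) := by
            gcongr; exact hl n hn1
        _ = C₁ ^ 2 * C₂ * ((n : ℝ) ^ (4 * η - 1) * (n : ℝ) ^ (-1 - η)) := by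
          rw [mul_pow, ← Real.rpow_natCast ((n : ℝ) ^ _), ← Real.rpow_mul hn0.le,
            ← Real.rpow_add hn0,
            show (4 * η - 1) + (-1 - η) = (η - 3 / 2) * ((2 : ℕ) : ℝ) + 1 + η by push_cast; ring,
            Real.rpow_add hn0, Real.rpow_add hn0, Real.rpow_one]
          ring
        _ ≤ C₁ ^ 2 * C₂ * ((N : ℝ) ^ (4 * η - 1) * (n : ℝ) ^ (-1 - η)) := by
          gcongr C₁ ^ 2 * C₂ * (?_ * _)
          exact Real.rpow_le_rpow_of_nonpos hN0 hNn (by linarith)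
        _ = _ := by ring
    · rw [mul_comm]
      gcongr
      nlinarith
  have hs1 : Summable fun n => ‖a n‖ :=
    Summable.of_nonneg_of_le (fun n => norm_nonneg _) (fun n => (hb n).1) (hZs.mul_left _)
  have hpos : ∀ n : ℕ, 0 ≤ ‖a n‖ ^ 2 * (n * (1 + log n)) := fun n =>
    le_trans (by positivity) (hb n).2.2
  have hs2 : Summable fun n : ℕ => ‖a n‖ ^ 2 * (n * (1 + log n)) :=
    Summable.of_nonneg_of_le hpos (fun n => (hb n).2.1) (hZs.mul_left _)
  have hs3 : Summable fun n : ℕ => N * ‖a n‖ ^ 2 :=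
    Summable.of_nonneg_of_le (fun n => by positivity) (fun n => (hb n).2.2) hs2
  refine (integral_norm_sq_dirichlet_tsum_le ha0 hs1 hs2 t₀ hN0.le).trans ?_
  have t1 : ∑' n, ‖a n‖ ≤ C₁ * (N : ℝ) ^ (2 * η - 1 / 2) * Z := by
    rw [← tsum_mul_left]
    exact hs1.tsum_le_tsum (fun n => (hb n).1) (hZs.mul_left _)
  have t2 : ∑' n : ℕ, ‖a n‖ ^ 2 * (n * (1 + log n)) ≤ C₁ ^ 2 * C₂ * (N : ℝ) ^ (4 * η - 1) * Z := by
    rw [← tsum_mul_left]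
    exact hs2.tsum_le_tsum (fun n => (hb n).2.1) (hZs.mul_left _)
  have t3 : N * ∑' n, ‖a n‖ ^ 2 ≤ C₁ ^ 2 * C₂ * (N : ℝ) ^ (4 * η - 1) * Z := by
    rw [← tsum_mul_left]
    exact (hs3.tsum_le_tsum (fun n => (hb n).2.2) hs2).trans t2
  have t0 : 0 ≤ ∑' n, ‖a n‖ := tsum_nonneg fun n => norm_nonneg _
  calc _ ≤ C₁ ^ 2 * C₂ * (N : ℝ) ^ (4 * η - 1) * Z + 4 * (C₁ * (N : ℝ) ^ (2 * η - 1 / 2) * Z) ^ 2 +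
        4 * (C₁ ^ 2 * C₂ * (N : ℝ) ^ (4 * η - 1) * Z) := by gcongr
    _ = _ := by
      have : ((N : ℝ) ^ (2 * η - 1 / 2)) ^ 2 = (N : ℝ) ^ (4 * η - 1) := by
        rw [← Real.rpow_natCast, ← Real.rpow_mul hN0.le]
        congr 1; push_cast; ring
      rw [mul_pow, mul_pow, this]; ring

end WeightedDivisor

namespace WeightedDivisor

open MeasureTheory Filter Topology

/-- The weight `exp (2|v| - v²)` that dominates the smoothing kernels. -/
noncomputable def gaussWeight (v : ℝ) : ℝ := rexp (2 * |v|) * rexp (-v ^ 2)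

lemma gaussWeight_pos (v : ℝ) : 0 < gaussWeight v := by unfold gaussWeight; positivity

lemma continuous_gaussWeight : Continuous gaussWeight := by unfold gaussWeight; fun_prop

lemma integrable_gaussWeight : Integrable gaussWeight := by
  have h : Integrable fun v : ℝ => (gaussWeight v : ℂ) := by
    refine integrable_vertical_gauss (C := 1) (A := 2)
      (Complex.continuous_ofReal.comp continuous_gaussWeight) zero_le_one fun v _ => ?_
    rw [Complex.norm_real, norm_of_nonneg (gaussWeight_pos v).le, one_mul, gaussWeight]
  simpa using h.re

lemma integral_gaussWeight_pos : 0 < ∫ v, gaussWeight v := by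
  rw [integral_pos_iff_support_of_nonneg (fun v => (gaussWeight_pos v).le) integrable_gaussWeight]
  have : Function.support gaussWeight = Set.univ := by
    ext v; simp [(gaussWeight_pos v).ne']
  rw [this]; simp

/-- The average of `D` about `t` against the weight `gaussWeight`. -/
noncomputable def gaussAvg (D : ℝ → ℝ) (t : ℝ) : ℝ := ∫ v, gaussWeight v * D (t + v)

section Avg

variable {D : ℝ → ℝ} {M : ℝ}

lemma integrable_gaussWeight_mul (hD : Continuous D) (hM : ∀ t, |D t| ≤ M) (t : ℝ) :
    Integrable fun v => gaussWeight v * D (t + v) := by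
  refine (integrable_gaussWeight.mul_const M).mono'
    (by have := continuous_gaussWeight; fun_prop) (Eventually.of_forall fun v => ?_)
  rw [norm_mul, norm_of_nonneg (gaussWeight_pos v).le, norm_eq_abs]
  exact mul_le_mul_of_nonneg_left (hM _) (gaussWeight_pos v).le

lemma gaussAvg_nonneg (h0 : ∀ t, 0 ≤ D t) (t : ℝ) : 0 ≤ gaussAvg D t :=
  integral_nonneg fun v => mul_nonneg (gaussWeight_pos v).le (h0 _)

lemma continuous_gaussAvg (hD : Continuous D) (hM : ∀ t, |D t| ≤ M) : Continuous (gaussAvg D) := by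
  unfold gaussAvg
  refine continuous_of_dominated (bound := fun v => gaussWeight v * M)
    (fun t => (integrable_gaussWeight_mul hD hM t).aestronglyMeasurable)
    (fun t => Eventually.of_forall fun v => ?_) (integrable_gaussWeight.mul_const M)
    (Eventually.of_forall fun v => by fun_prop)
  rw [norm_mul, norm_of_nonneg (gaussWeight_pos v).le, norm_eq_abs]
  exact mul_le_mul_of_nonneg_left (hM _) (gaussWeight_pos v).le

lemma gaussAvg_sq_le (hD : Continuous D) (hM : ∀ t, |D t| ≤ M) (t : ℝ) :
    gaussAvg D t ^ 2 ≤ (∫ v, gaussWeight v) * gaussAvg (fun t => D t ^ 2) t := by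
  set A := ∫ v, gaussWeight v with hA
  have hA0 : 0 < A := integral_gaussWeight_pos
  have hM2 : ∀ t, |D t ^ 2| ≤ M ^ 2 := fun t => by rw [abs_pow]; gcongr; exact hM t
  have i1 := integrable_gaussWeight_mul hD hM t
  have i2 : Integrable fun v => gaussWeight v * D (t + v) ^ 2 :=
    integrable_gaussWeight_mul (hD.pow 2) hM2 t
  set u := gaussAvg D t with hu
  set q := gaussAvg (fun t => D t ^ 2) t with hq
  have h : 0 ≤ ∫ v, gaussWeight v * (A * D (t + v) - u) ^ 2 :=
    integral_nonneg fun v => mul_nonneg (gaussWeight_pos v).le (sq_nonneg _)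
  have e : (fun v => gaussWeight v * (A * D (t + v) - u) ^ 2) = fun v =>
      (A ^ 2 * (gaussWeight v * D (t + v) ^ 2) - 2 * A * u * (gaussWeight v * D (t + v))) +
        u ^ 2 * gaussWeight v := by
    ext v; ring
  have i3 : Integrable fun v => A ^ 2 * (gaussWeight v * D (t + v) ^ 2) -
      2 * A * u * (gaussWeight v * D (t + v)) := (i2.const_mul _).sub (i1.const_mul _)
  rw [e, integral_add i3 (integrable_gaussWeight.const_mul _),
    integral_sub (i2.const_mul _) (i1.const_mul _), integral_const_mul, integral_const_mul,
    integral_const_mul] at h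
  change 0 ≤ A ^ 2 * q - 2 * A * u * u + u ^ 2 * A at h
  have : 0 ≤ A * (A * q - u ^ 2) := by linarith
  have := nonneg_of_mul_nonneg_right this hA0
  linarith

lemma integral_gaussAvg_sq_le (hD : Continuous D) (hM : ∀ t, |D t| ≤ M) {L S : ℝ} (hL : 0 ≤ L)
    (hS : ∀ t₀, ∫ t in t₀..(t₀ + L), D t ^ 2 ≤ S) (t₁ : ℝ) :
    ∫ t in t₁..(t₁ + L), gaussAvg D t ^ 2 ≤ (∫ v, gaussWeight v) ^ 2 * S := by
  set A := ∫ v, gaussWeight v with hA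
  have hA0 : 0 < A := integral_gaussWeight_pos
  have hM2 : ∀ t, |D t ^ 2| ≤ M ^ 2 := fun t => by rw [abs_pow]; gcongr; exact hM t
  have hle : t₁ ≤ t₁ + L := by linarith
  calc ∫ t in t₁..(t₁ + L), gaussAvg D t ^ 2
      ≤ ∫ t in t₁..(t₁ + L), A * gaussAvg (fun t => D t ^ 2) t :=
        intervalIntegral.integral_mono_on hle
          (((continuous_gaussAvg hD hM).pow 2).intervalIntegrable _ _)
          (((continuous_gaussAvg (hD.pow 2) hM2).const_mul A).intervalIntegrable _ _)
          fun t _ => gaussAvg_sq_le hD hM t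
    _ = A * ∫ v, gaussWeight v * ∫ t in t₁..(t₁ + L), D (t + v) ^ 2 := by
      rw [intervalIntegral.integral_const_mul]
      congr 1
      unfold gaussAvg
      rw [intervalIntegral_integral_swap]
      · simp_rw [intervalIntegral.integral_const_mul]
      · have : IsFiniteMeasure (volume.restrict (Set.uIoc t₁ (t₁ + L))) := by
          rw [Set.uIoc_of_le hle]; infer_instance
        refine Integrable.mono' ((integrable_gaussWeight.mul_const (M ^ 2)).comp_snd _) ?_
          (Eventually.of_forall fun p => ?_)
        · refine Continuous.aestronglyMeasurable ?_
          have := continuous_gaussWeight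
          simp only [Function.uncurry_def]
          fun_prop
        · simp only [Function.uncurry_def]
          rw [norm_mul, norm_of_nonneg (gaussWeight_pos _).le, norm_eq_abs]
          exact mul_le_mul_of_nonneg_left (hM2 _) (gaussWeight_pos _).le
    _ ≤ A * ∫ v, gaussWeight v * S := by
      refine mul_le_mul_of_nonneg_left ?_ hA0.le
      have hb : ∀ v, ∫ t in t₁..(t₁ + L), D (t + v) ^ 2 ≤ S := by
        intro v
        rw [intervalIntegral.integral_comp_add_right (fun t => D t ^ 2) v, add_right_comm]
        exact hS _
      refine integral_mono_of_nonneg (Eventually.of_forall fun v => ?_)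
        (integrable_gaussWeight.mul_const S)
        (Eventually.of_forall fun v => mul_le_mul_of_nonneg_left (hb v) (gaussWeight_pos v).le)
      exact mul_nonneg (gaussWeight_pos v).le
        (intervalIntegral.integral_nonneg hle fun t _ => sq_nonneg _)
    _ = A ^ 2 * S := by rw [integral_mul_const]; ring

end Avg

/-- The smoothed Perron integral of `P`, centred at `s`, along the line of abscissa `c`. -/
noncomputable def gaussLine (P : ℂ → ℂ) (s : ℂ) (N : ℕ) (c : ℝ) : ℂ :=
  ∫ v : ℝ, P (s + (c + v * Complex.I)) * (N : ℂ) ^ (c + v * Complex.I : ℂ) *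
    Complex.exp ((c + v * Complex.I) ^ 2) / (c + v * Complex.I)

section Line

variable {P Q : ℂ → ℂ} {s : ℂ} {N : ℕ}

lemma norm_natCast_cpow_line (hN : 1 ≤ N) (c v : ℝ) :
    ‖(N : ℂ) ^ (c + v * Complex.I : ℂ)‖ = (N : ℝ) ^ c := by
  rw [Complex.norm_natCast_cpow_of_pos (by omega)]
  simp

lemma add_line_eq (s : ℂ) (c v : ℝ) :
    s + (c + v * Complex.I) = ((s.re + c : ℝ) : ℂ) + ((s.im + v : ℝ) : ℂ) * Complex.I := by
  apply Complex.ext <;> simp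

lemma exp_mul_abs_add_le {A : ℝ} (hA : 0 ≤ A) (x y : ℝ) :
    rexp (A * |x + y|) ≤ rexp (A * |x|) * rexp (A * |y|) := by
  rw [← Real.exp_add, ← mul_add]
  exact Real.exp_le_exp.2 (mul_le_mul_of_nonneg_left (abs_add_le x y) hA)

lemma natCast_rpow_le_rpow {N : ℕ} (hN : 1 ≤ N) {b x : ℝ} (hx' : x ≤ b) :
    (N : ℝ) ^ x ≤ (N : ℝ) ^ b :=
  Real.rpow_le_rpow_of_exponent_le (by exact_mod_cast hN) hx'

lemma gaussLine_full (hN : 1 ≤ N) {a b : ℝ} (ha : a < 0) (hb : 0 < b)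
    (hP : DifferentiableOn ℂ P {z | s.re + a ≤ z.re ∧ z.re ≤ s.re + b}) {C A : ℝ} (hC : 0 ≤ C)
    (hA : 0 ≤ A) (hB : ∀ x τ : ℝ, s.re + a ≤ x → x ≤ s.re + b →
      ‖P (x + τ * Complex.I)‖ ≤ C * rexp (A * |τ|)) :
    gaussLine P s N b - gaussLine P s N a = 2 * π * P s := by
  have hN0 : (N : ℂ) ≠ 0 := by exact_mod_cast (by omega : N ≠ 0)
  have h := integral_vertical_gauss_div (g := fun w => P (s + w) * (N : ℂ) ^ w) ha hb
    (C := C * rexp (A * |s.im|) * (N : ℝ) ^ b) (A := A) (by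
      refine DifferentiableOn.mul (hP.comp (by fun_prop) fun w hw => ?_)
        (fun w _ => (differentiableAt_id.const_cpow (Or.inl hN0)).differentiableWithinAt)
      simpa using hw) (by positivity) hA fun x v hx hx' => by
      rw [norm_mul, norm_natCast_cpow_line hN, add_line_eq]
      have h1 := hB (s.re + x) (s.im + v) (by linarith) (by linarith)
      calc _ ≤ C * (rexp (A * |s.im|) * rexp (A * |v|)) * (N : ℝ) ^ b := by
            gcongr
            · exact h1.trans (mul_le_mul_of_nonneg_left (exp_mul_abs_add_le hA _ _) hC)
            · exact_mod_cast hN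
        _ = _ := by ring
  simpa [gaussLine] using h

lemma norm_gaussLine_integrand_le (hN : 1 ≤ N) {c v δ : ℝ} (hδ : 0 < δ)
    (hc : δ ≤ ‖(c + v * Complex.I : ℂ)‖) {B : ℝ}
    (hB : ‖P (s + (c + v * Complex.I))‖ ≤ B) :
    ‖P (s + (c + v * Complex.I)) * (N : ℂ) ^ (c + v * Complex.I : ℂ) *
      Complex.exp ((c + v * Complex.I) ^ 2) / (c + v * Complex.I)‖ ≤
      rexp (c ^ 2) / δ * (N : ℝ) ^ c * (B * rexp (-v ^ 2)) := by
  rw [norm_div, norm_mul, norm_mul, norm_natCast_cpow_line hN, norm_cexp_sq]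
  have hB0 : 0 ≤ B := (norm_nonneg _).trans hB
  calc _ ≤ B * (N : ℝ) ^ c * (rexp (c ^ 2) * rexp (-v ^ 2)) / δ := by gcongr
    _ = _ := by ring

lemma le_norm_line {c v : ℝ} : |c| ≤ ‖(c + v * Complex.I : ℂ)‖ := by
  have := Complex.abs_re_le_norm (c + v * Complex.I : ℂ)
  simpa using this

lemma line_ne_zero {c v : ℝ} (hc : c ≠ 0) : (c + v * Complex.I : ℂ) ≠ 0 := by
  intro h
  have := congrArg Complex.re h
  simp at this
  exact hc this

lemma gaussLine_shift (hN : 1 ≤ N) {a b : ℝ} (hab : a ≤ b) (h0 : 0 < a ∨ b < 0)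
    (hP : DifferentiableOn ℂ P {z | s.re + a ≤ z.re ∧ z.re ≤ s.re + b}) {C A : ℝ} (hC : 0 ≤ C)
    (hA : 0 ≤ A) (hB : ∀ x τ : ℝ, s.re + a ≤ x → x ≤ s.re + b →
      ‖P (x + τ * Complex.I)‖ ≤ C * rexp (A * |τ|)) :
    gaussLine P s N a = gaussLine P s N b := by
  have hN0 : (N : ℂ) ≠ 0 := by exact_mod_cast (by omega : N ≠ 0)
  refine integral_vertical_gauss_eq
    (g := fun w => P (s + w) * (N : ℂ) ^ w * Complex.exp (w ^ 2) / w) hab ?_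
    (C := rexp (a ^ 2 + b ^ 2) * (N : ℝ) ^ b * (C * rexp (A * |s.im|))) (A := A) (by positivity)
    fun x v hx hx' hv => ?_
  · refine DifferentiableOn.div ((DifferentiableOn.mul (hP.comp (by fun_prop) fun w hw => ?_)
      (fun w _ => (differentiableAt_id.const_cpow (Or.inl hN0)).differentiableWithinAt)).mul
      (Differentiable.differentiableOn (by fun_prop))) differentiableOn_id fun w hw h => ?_
    · simpa using hw
    · have : w.re = 0 := by rw [show w = 0 from h]; simp
      rcases h0 with h0 | h0 <;> linarith [hw.1, hw.2]
  · have h1 : (1 : ℝ) ≤ ‖(x + v * Complex.I : ℂ)‖ := by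
      refine hv.trans ?_
      have := Complex.abs_im_le_norm (x + v * Complex.I : ℂ)
      simpa using this
    have h2 := hB (s.re + x) (s.im + v) (by linarith) (by linarith)
    rw [← add_line_eq] at h2
    refine (norm_gaussLine_integrand_le hN one_pos h1 (h2.trans
      (mul_le_mul_of_nonneg_left (exp_mul_abs_add_le hA _ _) hC))).trans ?_
    rw [div_one]
    calc _ ≤ rexp (a ^ 2 + b ^ 2) * (N : ℝ) ^ b *
          (C * (rexp (A * |s.im|) * rexp (A * |v|)) * rexp (-v ^ 2)) := by
          gcongr ?_ * ?_ * _
          · refine Real.exp_le_exp.2 ?_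
            rcases le_total 0 x with h | h <;> nlinarith [sq_nonneg a, sq_nonneg b]
          · exact natCast_rpow_le_rpow hN hx'
      _ = _ := by ring

lemma integrable_gaussLine (hN : 1 ≤ N) {c : ℝ} (hc : c ≠ 0)
    (hP : Continuous fun v : ℝ => P (s + (c + v * Complex.I))) {C A : ℝ} (hC : 0 ≤ C) (hA : 0 ≤ A)
    (hB : ∀ τ : ℝ, ‖P ((s.re + c : ℝ) + τ * Complex.I)‖ ≤ C * rexp (A * |τ|)) :
    Integrable fun v : ℝ => P (s + (c + v * Complex.I)) * (N : ℂ) ^ (c + v * Complex.I : ℂ) *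
      Complex.exp ((c + v * Complex.I) ^ 2) / (c + v * Complex.I) := by
  have hN0 : (N : ℂ) ≠ 0 := by exact_mod_cast (by omega : N ≠ 0)
  refine integrable_vertical_gauss (A := A)
    (C := rexp (c ^ 2) / |c| * (N : ℝ) ^ c * (C * rexp (A * |s.im|))) ?_ (by positivity)
    fun v _ => ?_
  · refine Continuous.div (Continuous.mul (hP.mul ?_) (by fun_prop)) (by fun_prop)
      fun v => line_ne_zero hc
    exact Continuous.const_cpow (by fun_prop) (Or.inl hN0)
  · have h2 := hB (s.im + v)
    rw [← add_line_eq] at h2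
    refine (norm_gaussLine_integrand_le hN (abs_pos.2 hc) le_norm_line (h2.trans
      (mul_le_mul_of_nonneg_left (exp_mul_abs_add_le hA _ _) hC))).trans (le_of_eq (by ring))

lemma gaussLine_sub (hN : 1 ≤ N) {c : ℝ} (hc : c ≠ 0)
    (hP : Continuous fun v : ℝ => P (s + (c + v * Complex.I)))
    (hQ : Continuous fun v : ℝ => Q (s + (c + v * Complex.I))) {C A : ℝ} (hC : 0 ≤ C) (hA : 0 ≤ A)
    (hB : ∀ τ : ℝ, ‖P ((s.re + c : ℝ) + τ * Complex.I)‖ ≤ C * rexp (A * |τ|))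
    (hB' : ∀ τ : ℝ, ‖Q ((s.re + c : ℝ) + τ * Complex.I)‖ ≤ C * rexp (A * |τ|)) :
    gaussLine (fun z => P z - Q z) s N c = gaussLine P s N c - gaussLine Q s N c := by
  rw [gaussLine, gaussLine, gaussLine, ← integral_sub (integrable_gaussLine hN hc hP hC hA hB)
    (integrable_gaussLine hN hc hQ hC hA hB')]
  exact integral_congr_ae (Eventually.of_forall fun v => by simp only; ring)

lemma norm_gaussLine_le (hN : 1 ≤ N) {c : ℝ} (hc : c ≠ 0) {D : ℝ → ℝ} {M B : ℝ}
    (hD : Continuous D) (hM : ∀ t, |D t| ≤ M)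
    (hB : ∀ v : ℝ, ‖P (s + (c + v * Complex.I))‖ ≤ B * (rexp (2 * |v|) * D (s.im + v))) :
    ‖gaussLine P s N c‖ ≤ rexp (c ^ 2) / |c| * (N : ℝ) ^ c * B * gaussAvg D s.im := by
  rw [gaussAvg, ← integral_const_mul]
  refine norm_integral_le_of_norm_le ((integrable_gaussWeight_mul hD hM _).const_mul _)
    (Eventually.of_forall fun v => ?_)
  refine (norm_gaussLine_integrand_le hN (abs_pos.2 hc) le_norm_line (hB v)).trans (le_of_eq ?_)
  rw [gaussWeight]; ring

end Line

end WeightedDivisor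

namespace WeightedDivisor

open MeasureTheory Filter Topology ComplexConjugate

lemma natCast_cpow_conj (n : ℕ) (z : ℂ) : (n : ℂ) ^ (conj z) = conj ((n : ℂ) ^ z) := by
  rw [Complex.cpow_conj _ _ (by rw [Complex.natCast_arg]; exact Real.pi_pos.ne),
      Complex.conj_natCast]

lemma zetaSqHead_conj (N : ℕ) (z : ℂ) : zetaSqHead N (conj z) = conj (zetaSqHead N z) := by
  simp only [zetaSqHead, map_sum, map_mul, Complex.conj_natCast, ← map_neg, natCast_cpow_conj]

lemma zetaSqTail_conj (N : ℕ) (z : ℂ) : zetaSqTail N (conj z) = conj (zetaSqTail N z) := by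
  rw [zetaSqTail, zetaSqTail, zetaSqHead_conj, riemannZeta_conj, map_sub, map_pow]

lemma conj_line (x τ : ℝ) : conj ((x : ℂ) + τ * Complex.I) = x - τ * Complex.I := by
  simp [sub_eq_add_neg]

/-- The factor that removes the pole of `ζ²` at `1`. -/
noncomputable def poleFactor (z : ℂ) : ℂ := ((z - 1) / (z + 2)) ^ 2

/-- `ζ²` with its pole removed by `poleFactor`. -/
noncomputable def zetaSqReg (z : ℂ) : ℂ := riemannZeta₁ z ^ 2 / (z + 2) ^ 2

lemma zetaSqReg_eq {z : ℂ} (hz : z ≠ 1) : zetaSqReg z = poleFactor z * riemannZeta z ^ 2 := by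
  have h : z - 1 ≠ 0 := sub_ne_zero.2 hz
  rw [riemannZeta_eq_inv_sub_mul hz, zetaSqReg, poleFactor]
  field_simp

lemma norm_poleFactor_le {z : ℂ} (hz : -(1 / 2) ≤ z.re) : ‖poleFactor z‖ ≤ 1 := by
  rw [poleFactor, norm_pow, norm_div]
  refine pow_le_one₀ (by positivity) (div_le_one_of_le₀ ?_ (norm_nonneg _))
  refine (sq_le_sq₀ (norm_nonneg _) (norm_nonneg _)).1 ?_
  rw [← Complex.normSq_eq_norm_sq, ← Complex.normSq_eq_norm_sq, Complex.normSq_apply,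
    Complex.normSq_apply]
  simp
  nlinarith

lemma add_two_ne_zero {z : ℂ} (hz : -(1 / 2) ≤ z.re) : z + 2 ≠ 0 := by
  intro h
  have := congrArg Complex.re h
  simp at this
  linarith

lemma differentiableAt_poleFactor {z : ℂ} (hz : -(1 / 2) ≤ z.re) :
    DifferentiableAt ℂ poleFactor z := by
  have h := add_two_ne_zero hz
  change DifferentiableAt ℂ (fun z : ℂ => ((z - 1) / (z + 2)) ^ 2) z
  fun_prop (disch := exact h)

lemma differentiableAt_zetaSqReg {z : ℂ} (hz : -(1 / 2) ≤ z.re) :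
    DifferentiableAt ℂ zetaSqReg z := by
  have h := pow_ne_zero 2 (add_two_ne_zero hz)
  have h1 := differentiable_riemannZeta₁ z
  change DifferentiableAt ℂ (fun z : ℂ => riemannZeta₁ z ^ 2 / (z + 2) ^ 2) z
  fun_prop (disch := exact h)

lemma exists_norm_zetaSqReg_le : ∃ C : ℝ, 0 ≤ C ∧ ∀ x τ : ℝ, -(1 / 2) ≤ x → x ≤ 3 / 2 →
    ‖zetaSqReg (x + τ * Complex.I)‖ ≤ C * rexp (6 * |τ|) := by
  obtain ⟨C₁, hC₁, hz⟩ := exists_norm_riemannZeta_le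
  obtain ⟨C₂, hC₂, hχ⟩ := exists_norm_chi_le
  have hK : IsCompact (Set.Icc (-(1 / 2) : ℝ) (3 / 2) ×ˢ Set.Icc (-1 : ℝ) 1) :=
    isCompact_Icc.prod isCompact_Icc
  obtain ⟨K, hK⟩ := hK.exists_bound_of_continuousOn
    (f := fun p : ℝ × ℝ => zetaSqReg (p.1 + p.2 * Complex.I)) (fun p hp => by
      refine ContinuousAt.continuousWithinAt ?_
      have h1 : ContinuousAt zetaSqReg (p.1 + p.2 * Complex.I) :=
        (differentiableAt_zetaSqReg (by simpa using hp.1.1)).continuousAt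
      exact ContinuousAt.comp (g := zetaSqReg) (f := fun p : ℝ × ℝ => (p.1 + p.2 * Complex.I : ℂ))
        h1 (by fun_prop))
  have hζ : ∀ x τ : ℝ, 1 / 2 ≤ x → x ≤ 3 → 1 ≤ |τ| →
      ‖riemannZeta (x + τ * Complex.I)‖ ≤ C₁ * rexp |τ| := by
    intro x τ hx hx' hτ
    refine (hz x τ hx hx' hτ).trans (mul_le_mul_of_nonneg_left ?_ (by linarith))
    calc |τ| ^ (0.17 : ℝ) ≤ |τ| ^ (1 : ℝ) := Real.rpow_le_rpow_of_exponent_le hτ (by norm_num)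
      _ ≤ _ := by rw [Real.rpow_one]; linarith [Real.add_one_le_exp |τ|]
  have hne : ∀ x τ : ℝ, 1 ≤ |τ| → (x + τ * Complex.I : ℂ) ≠ 1 := by
    intro x τ hτ h
    have := congrArg Complex.im h
    simp at this
    rw [this] at hτ; simp at hτ; linarith
  refine ⟨|K| + C₁ ^ 2 + C₂ ^ 2 * C₁ ^ 2, by positivity, fun x τ hx hx' => ?_⟩
  rcases le_total |τ| 1 with hτ | hτ
  · have := hK (x, τ) ⟨⟨hx, hx'⟩, abs_le.1 hτ⟩
    have h1 : (1 : ℝ) ≤ rexp (6 * |τ|) := Real.one_le_exp (by positivity)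
    calc _ ≤ K := this
      _ ≤ |K| * 1 := by rw [mul_one]; exact le_abs_self K
      _ ≤ (|K| + C₁ ^ 2 + C₂ ^ 2 * C₁ ^ 2) * rexp (6 * |τ|) := by
        gcongr
        have : 0 ≤ C₁ ^ 2 + C₂ ^ 2 * C₁ ^ 2 := by positivity
        linarith
  · have key : ‖riemannZeta (x + τ * Complex.I)‖ ^ 2 ≤
        (C₁ ^ 2 + C₂ ^ 2 * C₁ ^ 2) * rexp (6 * |τ|) := by
      rcases le_total (1 / 2) x with h | h
      · calc _ ≤ (C₁ * rexp |τ|) ^ 2 := by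
              gcongr; exact hζ x τ h (by linarith) hτ
          _ = C₁ ^ 2 * rexp (2 * |τ|) := by
            rw [mul_pow, ← Real.exp_nat_mul]; norm_num
          _ ≤ _ := by
            gcongr
            · have : 0 ≤ C₂ ^ 2 * C₁ ^ 2 := by positivity
              linarith
            · norm_num
      · have e : (x + τ * Complex.I : ℂ) = 1 -
            (((1 - x : ℝ) : ℂ) + ((-τ : ℝ) : ℂ) * Complex.I) := by
          push_cast; ring
        have hre : 0 < ((((1 - x : ℝ) : ℂ) + ((-τ : ℝ) : ℂ) * Complex.I)).re := by simp; linarith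
        rw [e, zeta_one_sub_eq_chi hre (hne _ _ (by simpa using hτ)), norm_mul]
        have h1 := hχ (1 - x) (-τ) (by linarith) (by linarith)
        have h2 := hζ (1 - x) (-τ) (by linarith) (by linarith) (by simpa using hτ)
        rw [abs_neg] at h1 h2
        calc _ ≤ (C₂ * rexp (2 * |τ|) * (C₁ * rexp |τ|)) ^ 2 := by gcongr
          _ = C₂ ^ 2 * C₁ ^ 2 * rexp (6 * |τ|) := by
            rw [show 6 * |τ| = (2 : ℕ) * (2 * |τ|) + (2 : ℕ) * |τ| by push_cast; ring, Real.exp_add,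
              Real.exp_nat_mul, Real.exp_nat_mul]
            ring
          _ ≤ _ := by
            gcongr
            have : 0 ≤ C₁ ^ 2 := by positivity
            linarith
    rw [zetaSqReg_eq (hne x τ hτ), norm_mul, norm_pow]
    calc _ ≤ 1 * ((C₁ ^ 2 + C₂ ^ 2 * C₁ ^ 2) * rexp (6 * |τ|)) := by
          gcongr
          exact norm_poleFactor_le (by simpa using hx)
      _ ≤ _ := by
        rw [one_mul]; gcongr
        have := abs_nonneg K
        linarith

lemma norm_zetaSqHead_sub (N : ℕ) (x τ : ℝ) :
    ‖zetaSqHead N (x - τ * Complex.I)‖ = ‖zetaSqHead N (x + τ * Complex.I)‖ := by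
  rw [← conj_line, zetaSqHead_conj, RCLike.norm_conj]

lemma norm_zetaSqTail_sub (N : ℕ) (x τ : ℝ) :
    ‖zetaSqTail N (x - τ * Complex.I)‖ = ‖zetaSqTail N (x + τ * Complex.I)‖ := by
  rw [← conj_line, zetaSqTail_conj, RCLike.norm_conj]

/-- The contribution of the partial sum of `ζ²` on the right of the critical line. -/
noncomputable def rightHead (N : ℕ) (z : ℂ) : ℂ := poleFactor z * zetaSqHead N z

/-- The contribution of the partial sum of `ζ²` on the left of the critical line. -/
noncomputable def leftHead (N : ℕ) (z : ℂ) : ℂ :=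
  poleFactor z * chi (1 - z) ^ 2 * zetaSqHead N (1 - z)

lemma differentiableAt_rightHead (N : ℕ) {z : ℂ} (hz : -(1 / 2) ≤ z.re) :
    DifferentiableAt ℂ (rightHead N) z :=
  (differentiableAt_poleFactor hz).mul (differentiable_zetaSqHead N z)

lemma differentiableAt_leftHead (N : ℕ) {z : ℂ} (hz : -(1 / 2) ≤ z.re) (hz' : z.re ≤ 1 / 2) :
    DifferentiableAt ℂ (leftHead N) z := by
  have h1 : DifferentiableAt ℂ (fun z : ℂ => 1 - z) z := by fun_prop
  have h2 : DifferentiableAt ℂ (fun z : ℂ => chi (1 - z)) z :=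
    (differentiableAt_chi (s := 1 - z) (by simp; linarith)).comp z h1
  have h3 : DifferentiableAt ℂ (fun z : ℂ => zetaSqHead N (1 - z)) z :=
    (differentiable_zetaSqHead N (1 - z)).comp z h1
  exact ((differentiableAt_poleFactor hz).mul (h2.pow 2)).mul h3

lemma exists_norm_heads_le (N : ℕ) : ∃ C : ℝ, 0 ≤ C ∧
    (∀ x τ : ℝ, 0 ≤ x → ‖rightHead N (x + τ * Complex.I)‖ ≤ C * rexp (6 * |τ|)) ∧
    ∀ x τ : ℝ, -(1 / 2) ≤ x → x ≤ 1 / 2 → ‖leftHead N (x + τ * Complex.I)‖ ≤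
        C * rexp (6 * |τ|) := by
  obtain ⟨C₂, hC₂, hχ⟩ := exists_norm_chi_le
  set H := ∑ n ∈ Finset.Icc 1 N, (dk 2 n : ℝ) * (n : ℝ) ^ (-0 : ℝ) with hH
  have hH0 : 0 ≤ H := Finset.sum_nonneg fun _ _ => by positivity
  refine ⟨H + C₂ ^ 2 * H, by positivity, fun x τ hx => ?_, fun x τ hx hx' => ?_⟩
  · rw [rightHead, norm_mul]
    calc _ ≤ 1 * H := by
          gcongr
          · exact norm_poleFactor_le (by simp; linarith)
          · exact norm_zetaSqHead_le N (by simpa using hx)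
      _ ≤ (H + C₂ ^ 2 * H) * 1 := by nlinarith [mul_nonneg (sq_nonneg C₂) hH0]
      _ ≤ _ := by gcongr; exact Real.one_le_exp (by positivity)
  · have e : (1 : ℂ) - (x + τ * Complex.I) = ((1 - x : ℝ) : ℂ) + ((-τ : ℝ) : ℂ) * Complex.I := by
      push_cast; ring
    have h1 := hχ (1 - x) (-τ) (by linarith) (by linarith)
    rw [abs_neg] at h1
    rw [leftHead, norm_mul, norm_mul, norm_pow, e]
    calc _ ≤ 1 * (C₂ * rexp (2 * |τ|)) ^ 2 * H := by
          gcongr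
          · exact norm_poleFactor_le (by simpa using hx)
          · exact norm_zetaSqHead_le N (by simp; linarith)
      _ = C₂ ^ 2 * H * rexp (4 * |τ|) := by
        rw [mul_pow, ← Real.exp_nat_mul, ← mul_assoc (((2 : ℕ) : ℝ))]; norm_num; ring
      _ ≤ _ := by
        gcongr
        · linarith
        · norm_num

lemma norm_zetaSqReg_sub_rightHead_le (N : ℕ) (τ : ℝ) :
    ‖zetaSqReg ((3 / 2 : ℝ) + τ * Complex.I) - rightHead N ((3 / 2 : ℝ) + τ * Complex.I)‖ ≤
      ‖zetaSqTail N ((3 / 2 : ℝ) + τ * Complex.I)‖ := by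
  set z : ℂ := (3 / 2 : ℝ) + τ * Complex.I with hz
  have hre : z.re = 3 / 2 := by simp [hz]
  have h1 : z ≠ 1 := by intro h; rw [h] at hre; norm_num at hre
  rw [zetaSqReg_eq h1, rightHead, ← mul_sub, norm_mul, ← zetaSqTail]
  exact mul_le_of_le_one_left (norm_nonneg _) (norm_poleFactor_le (by rw [hre]; norm_num))

lemma norm_zetaSqReg_sub_leftHead_le (N : ℕ) (τ : ℝ) :
    ‖zetaSqReg ((-(1 / 2) : ℝ) + τ * Complex.I) - leftHead N ((-(1 / 2) : ℝ) + τ * Complex.I)‖ ≤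
      (1 + |τ|) ^ 2 * ‖zetaSqTail N ((3 / 2 : ℝ) + τ * Complex.I)‖ := by
  set z : ℂ := (-(1 / 2) : ℝ) + τ * Complex.I with hz
  have hre : z.re = -(1 / 2) := by simp [hz]
  have h1 : z ≠ 1 := by intro h; rw [h] at hre; norm_num at hre
  have e : 1 - z = (3 / 2 : ℝ) - τ * Complex.I := by rw [hz]; push_cast; ring
  have e' : 1 - z = 3 / 2 + ((-τ : ℝ) : ℂ) * Complex.I := by rw [hz]; push_cast; ring
  have hne : 1 - z ≠ 1 := by
    intro h
    have := congrArg Complex.re h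
    simp [hre] at this
  have h2 : riemannZeta z = chi (1 - z) * riemannZeta (1 - z) := by
    rw [← zeta_one_sub_eq_chi (by simp [hre]; norm_num) hne]; congr 1; ring
  rw [zetaSqReg_eq h1, leftHead, h2, show poleFactor z * (chi (1 - z) * riemannZeta (1 - z)) ^ 2 -
    poleFactor z * chi (1 - z) ^ 2 * zetaSqHead N (1 - z) =
    poleFactor z * (chi (1 - z) ^ 2 * (riemannZeta (1 - z) ^ 2 - zetaSqHead N (1 - z))) by ring,
    ← zetaSqTail, norm_mul, norm_mul, norm_pow]
  refine (mul_le_of_le_one_left (by positivity) (norm_poleFactor_le hre.ge)).trans ?_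
  have h3 := norm_chi_three_half_le (-τ)
  rw [← e', abs_neg] at h3
  have h4 := norm_zetaSqTail_sub N (3 / 2) τ
  rw [← e] at h4
  rw [h4]
  gcongr

lemma norm_rightHead_le (N : ℕ) {x : ℝ} (hx : 0 ≤ x) (τ : ℝ) :
    ‖rightHead N (x + τ * Complex.I)‖ ≤ ‖zetaSqHead N (x + τ * Complex.I)‖ := by
  rw [rightHead, norm_mul]
  exact mul_le_of_le_one_left (norm_nonneg _) (norm_poleFactor_le (by simp; linarith))

lemma norm_leftHead_half_le (N : ℕ) (τ : ℝ) :
    ‖leftHead N ((1 / 2 : ℝ) + τ * Complex.I)‖ ≤ ‖zetaSqHead N ((1 / 2 : ℝ) + τ * Complex.I)‖ := by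
  set z : ℂ := (1 / 2 : ℝ) + τ * Complex.I with hz
  have e : 1 - z = (1 / 2 : ℝ) - τ * Complex.I := by rw [hz]; push_cast; ring
  have e' : 1 - z = 1 / 2 + ((-τ : ℝ) : ℂ) * Complex.I := by rw [hz]; push_cast; ring
  have h3 := norm_chi_half (-τ)
  rw [← e'] at h3
  have h4 := norm_zetaSqHead_sub N (1 / 2) τ
  rw [← e] at h4
  rw [leftHead, norm_mul, norm_mul, norm_pow, h3, h4, one_pow, mul_one]
  exact mul_le_of_le_one_left (norm_nonneg _) (norm_poleFactor_le (by simp [hz]))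

/-- The absolute value of the partial sum of `ζ²` on a vertical line. -/
noncomputable def headLine (N : ℕ) (x τ : ℝ) : ℝ := ‖zetaSqHead N (x + τ * Complex.I)‖

/-- The absolute value of the tail of `ζ²` on the line of abscissa `3/2`. -/
noncomputable def tailLine (N : ℕ) (τ : ℝ) : ℝ := ‖zetaSqTail N ((3 / 2 : ℝ) + τ * Complex.I)‖

lemma continuous_headLine (N : ℕ) (x : ℝ) : Continuous (headLine N x) := by
  have := (differentiable_zetaSqHead N).continuous
  unfold headLine
  fun_prop

lemma abs_headLine_le (N : ℕ) {x : ℝ} (hx : 0 ≤ x) (τ : ℝ) :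
    |headLine N x τ| ≤ ∑ n ∈ Finset.Icc 1 N, (dk 2 n : ℝ) * (n : ℝ) ^ (-0 : ℝ) := by
  rw [headLine, abs_norm]
  exact norm_zetaSqHead_le N (by simpa using hx)

lemma continuous_tailLine (N : ℕ) : Continuous (tailLine N) := by
  have h1 : Continuous fun τ : ℝ => zetaSqHead N ((3 / 2 : ℝ) + τ * Complex.I) :=
    (differentiable_zetaSqHead N).continuous.comp (by fun_prop)
  have h2 : Continuous fun τ : ℝ => riemannZeta ((3 / 2 : ℝ) + τ * Complex.I) := by
    refine continuous_iff_continuousAt.2 fun τ => ?_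
    refine ContinuousAt.comp (g := riemannZeta)
      (f := fun τ : ℝ => ((3 / 2 : ℝ) + τ * Complex.I : ℂ)) ?_ (by fun_prop)
    refine (differentiableAt_riemannZeta fun h => ?_).continuousAt
    have := congrArg Complex.re h
    simp at this
    norm_num at this
  exact ((h2.pow 2).sub h1).norm

lemma exists_abs_tailLine_le (N : ℕ) : ∃ M : ℝ, ∀ τ, |tailLine N τ| ≤ M := by
  have h : ∀ τ : ℝ, 1 < ((3 / 2 : ℝ) + τ * Complex.I : ℂ).re := fun τ => by simp; norm_num
  have hs : ∀ τ : ℝ, ∀ n : ℕ, ‖(if n ≤ N then 0 else (dk 2 n : ℂ)) *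
      (n : ℂ) ^ (-((3 / 2 : ℝ) + τ * Complex.I : ℂ))‖ =
      ‖(if n ≤ N then 0 else (dk 2 n : ℂ)) * (n : ℂ) ^
          (-((3 / 2 : ℝ) + (0 : ℝ) * Complex.I : ℂ))‖ := by
    intro τ n
    rcases Nat.eq_zero_or_pos n with rfl | hn
    · simp
    · rw [norm_mul, norm_mul, norm_natCast_cpow_neg hn, norm_natCast_cpow_neg hn]; simp
  refine ⟨∑' n : ℕ, ‖(if n ≤ N then 0 else (dk 2 n : ℂ)) *
    (n : ℂ) ^ (-((3 / 2 : ℝ) + (0 : ℝ) * Complex.I : ℂ))‖, fun τ => ?_⟩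
  rw [tailLine, abs_norm]
  exact tsum_of_norm_bounded (hasSum_zetaSqTail N (h 0)).summable.norm.hasSum
    (fun n => (hs τ n).le) |> fun h' => by rwa [(hasSum_zetaSqTail N (h τ)).tsum_eq] at h'

lemma exists_norm_zetaSqReg_half_le {ε : ℝ} (hε : 0 < ε) (hε' : ε ≤ 1 / 4) :
    ∃ K : ℝ, 0 ≤ K ∧ ∀ N : ℕ, 1 ≤ N → ∀ t : ℝ, (N : ℝ) ≤ t → t ≤ N + N →
      ‖zetaSqReg ((1 / 2 + ε : ℝ) + t * Complex.I)‖ ≤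
        K * ((N : ℝ) ^ ε * (gaussAvg (headLine N (1 / 2 + 2 * ε)) t +
            gaussAvg (headLine N (1 / 2)) t) +
          N * gaussAvg (tailLine N) t) := by
  obtain ⟨C₁, hC₁, hG⟩ := exists_norm_zetaSqReg_le
  set K₀ := rexp 4 / ε with hK₀
  have hK0 : 0 < K₀ := by positivity
  refine ⟨10 * K₀, by positivity, fun N hN t ht ht' => ?_⟩
  have hN1 : (1 : ℝ) ≤ N := by exact_mod_cast hN
  have hN0 : (0 : ℝ) < N := by linarith
  obtain ⟨C₂, hC₂, hR, hL⟩ := exists_norm_heads_le N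
  obtain ⟨M, hM⟩ := exists_abs_tailLine_le N
  set s : ℂ := (1 / 2 + ε : ℝ) + t * Complex.I with hs
  have hre : s.re = 1 / 2 + ε := by simp [hs]
  have him : s.im = t := by simp [hs]
  set C := C₁ + C₂
  have hC : 0 ≤ C := by positivity
  have hGC : ∀ x τ : ℝ, -(1 / 2) ≤ x → x ≤ 3 / 2 →
      ‖zetaSqReg (x + τ * Complex.I)‖ ≤ C * rexp (6 * |τ|) := fun x τ hx hx' =>
    (hG x τ hx hx').trans (by gcongr; exact le_add_of_nonneg_right hC₂)
  have hRC : ∀ x τ : ℝ, 0 ≤ x → ‖rightHead N (x + τ * Complex.I)‖ ≤ C * rexp (6 * |τ|) :=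
    fun x τ hx => (hR x τ hx).trans (by gcongr; exact le_add_of_nonneg_left hC₁)
  have hLC : ∀ x τ : ℝ, -(1 / 2) ≤ x → x ≤ 1 / 2 →
      ‖leftHead N (x + τ * Complex.I)‖ ≤ C * rexp (6 * |τ|) :=
    fun x τ hx hx' => (hL x τ hx hx').trans (by gcongr; exact le_add_of_nonneg_left hC₁)
  have hcG : ∀ c : ℝ, -1 - ε ≤ c → Continuous fun v : ℝ => zetaSqReg (s + (c + v * Complex.I)) := by
    intro c hc
    refine continuous_iff_continuousAt.2 fun v => ?_
    refine ContinuousAt.comp (g := zetaSqReg) (f := fun v : ℝ => s + (c + v * Complex.I)) ?_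
      (by fun_prop)
    exact (differentiableAt_zetaSqReg (by rw [add_line_eq, hre]; simp; linarith)).continuousAt
  have hcR : Continuous fun v : ℝ => rightHead N (s + ((1 - ε : ℝ) + v * Complex.I)) := by
    refine continuous_iff_continuousAt.2 fun v => ?_
    refine ContinuousAt.comp (g := rightHead N)
        (f := fun v : ℝ => s + ((1 - ε : ℝ) + v * Complex.I)) ?_
      (by fun_prop)
    exact (differentiableAt_rightHead N (by rw [add_line_eq, hre]; simp; linarith)).continuousAt
  have hcL : Continuous fun v : ℝ => leftHead N (s + ((-1 - ε : ℝ) + v * Complex.I)) := by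
    refine continuous_iff_continuousAt.2 fun v => ?_
    refine ContinuousAt.comp (g := leftHead N)
        (f := fun v : ℝ => s + ((-1 - ε : ℝ) + v * Complex.I)) ?_
      (by fun_prop)
    exact (differentiableAt_leftHead N (by rw [add_line_eq, hre]; simp; linarith)
      (by rw [add_line_eq, hre]; simp)).continuousAt
  have hfull := gaussLine_full (P := zetaSqReg) (s := s) hN (a := -1 - ε) (b := 1 - ε) (by linarith)
    (by linarith) (fun z hz => (differentiableAt_zetaSqReg
      (by rw [hre] at hz; linarith [hz.1])).differentiableWithinAt) hC₁ (by norm_num : (0 : ℝ) ≤ 6)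
    fun x τ hx hx' => hG x τ (by rw [hre] at hx; linarith) (by rw [hre] at hx'; linarith)
  have hshR := gaussLine_shift (P := rightHead N) (s := s) hN (a := ε) (b := 1 - ε) (by linarith)
    (Or.inl hε) (fun z hz => (differentiableAt_rightHead N
      (by rw [hre] at hz; linarith [hz.1])).differentiableWithinAt) hC (by norm_num : (0 : ℝ) ≤ 6)
    fun x τ hx hx' => hRC x τ (by rw [hre] at hx; linarith)
  have hshL := gaussLine_shift (P := leftHead N) (s := s) hN (a := -1 - ε) (b := -ε) (by linarith)
    (Or.inr (by linarith)) (fun z hz => (differentiableAt_leftHead N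
      (by rw [hre] at hz; linarith [hz.1])
      (by rw [hre] at hz; linarith [hz.2])).differentiableWithinAt)
    hC (by norm_num : (0 : ℝ) ≤ 6)
    fun x τ hx hx' => hLC x τ (by rw [hre] at hx; linarith) (by rw [hre] at hx'; linarith)
  have hsubR := gaussLine_sub (P := zetaSqReg) (Q := rightHead N) (s := s) hN (c := 1 - ε)
    (by linarith) (hcG _ (by linarith)) hcR hC (by norm_num : (0 : ℝ) ≤ 6)
    (fun τ => hGC _ τ (by rw [hre]; linarith) (by rw [hre]; linarith))
    (fun τ => hRC _ τ (by rw [hre]; linarith))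
  have hsubL := gaussLine_sub (P := zetaSqReg) (Q := leftHead N) (s := s) hN (c := -1 - ε)
    (by linarith) (hcG _ (by linarith)) hcL hC (by norm_num : (0 : ℝ) ≤ 6)
    (fun τ => hGC _ τ (by rw [hre]; linarith) (by rw [hre]; linarith))
    (fun τ => hLC _ τ (by rw [hre]; linarith) (by rw [hre]; linarith))
  have hone : ∀ v : ℝ, (1 : ℝ) ≤ rexp (2 * |v|) := fun v => Real.one_le_exp (by positivity)
  have nR := norm_gaussLine_le (P := rightHead N) (s := s) hN (c := ε) hε.ne' (B := 1)
    (continuous_headLine N (1 / 2 + 2 * ε)) (abs_headLine_le N (by positivity)) fun v => by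
      rw [add_line_eq, hre, show 1 / 2 + ε + ε = 1 / 2 + 2 * ε by ring, one_mul]
      refine (norm_rightHead_le N (by positivity) _).trans ?_
      exact le_mul_of_one_le_left (norm_nonneg _) (hone v)
  have nL := norm_gaussLine_le (P := leftHead N) (s := s) hN (c := -ε) (by linarith) (B := 1)
    (continuous_headLine N (1 / 2)) (abs_headLine_le N (by positivity)) fun v => by
      rw [add_line_eq, hre, show 1 / 2 + ε + -ε = 1 / 2 by ring, one_mul]
      refine (norm_leftHead_half_le N _).trans ?_
      exact le_mul_of_one_le_left (norm_nonneg _) (hone v)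
  have nRt := norm_gaussLine_le (P := fun z => zetaSqReg z - rightHead N z) (s := s) hN (c := 1 - ε)
    (by linarith) (B := 1) (continuous_tailLine N) hM fun v => by
      rw [add_line_eq, hre, show 1 / 2 + ε + (1 - ε) = 3 / 2 by ring, one_mul]
      refine (norm_zetaSqReg_sub_rightHead_le N _).trans ?_
      exact le_mul_of_one_le_left (norm_nonneg _) (hone v)
  have nLt := norm_gaussLine_le (P := fun z => zetaSqReg z - leftHead N z) (s := s) hN (c := -1 - ε)
    (by linarith) (B := 9 * N ^ 2) (continuous_tailLine N) hM fun v => by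
      rw [add_line_eq, hre, show 1 / 2 + ε + (-1 - ε) = -(1 / 2) by ring, him]
      refine (norm_zetaSqReg_sub_leftHead_le N _).trans ?_
      rw [← mul_assoc]
      refine mul_le_mul_of_nonneg_right ?_ (norm_nonneg _)
      have h1 : 1 + |t + v| ≤ 3 * N * rexp |v| := by
        have h2 := abs_add_le t v
        rw [abs_of_nonneg (by linarith : 0 ≤ t)] at h2
        have h3 := Real.add_one_le_exp |v|
        have h4 := abs_nonneg v
        nlinarith
      calc _ ≤ (3 * N * rexp |v|) ^ 2 := by gcongr
        _ = _ := by rw [mul_pow, ← Real.exp_nat_mul]; push_cast; ring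
  rw [him] at nR nL nRt nLt
  have a1 := gaussAvg_nonneg (D := headLine N (1 / 2 + 2 * ε)) (fun _ => norm_nonneg _) t
  have a2 := gaussAvg_nonneg (D := headLine N (1 / 2)) (fun _ => norm_nonneg _) t
  have a3 := gaussAvg_nonneg (D := tailLine N) (fun _ => norm_nonneg _) t
  have hk : ∀ c : ℝ, |c| ≤ 2 → ε ≤ |c| → rexp (c ^ 2) / |c| ≤ K₀ := by
    intro c hc hc'
    have : c ^ 2 ≤ 4 := by rw [← sq_abs]; nlinarith [abs_nonneg c]
    rw [hK₀]; gcongr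
  have k1 := hk ε (by rw [abs_of_pos hε]; linarith) (by rw [abs_of_pos hε])
  have k2 := hk (-ε) (by rw [abs_neg, abs_of_pos hε]; linarith) (by rw [abs_neg, abs_of_pos hε])
  have k3 := hk (1 - ε) (by rw [abs_of_pos (by linarith)]; linarith)
    (by rw [abs_of_pos (by linarith)]; linarith)
  have k4 := hk (-1 - ε) (by rw [abs_of_neg (by linarith)]; linarith)
    (by rw [abs_of_neg (by linarith)]; linarith)
  have p2 : (N : ℝ) ^ (-ε) ≤ (N : ℝ) ^ ε := natCast_rpow_le_rpow hN (by linarith)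
  have p3 : (N : ℝ) ^ (1 - ε) ≤ N := by
    simpa using natCast_rpow_le_rpow hN (by linarith : 1 - ε ≤ 1)
  have p4 : (N : ℝ) ^ (-1 - ε) * (9 * N ^ 2) ≤ 9 * N := by
    have : (N : ℝ) ^ (-1 - ε) ≤ (N : ℝ)⁻¹ := by
      rw [← Real.rpow_neg_one]; exact natCast_rpow_le_rpow hN (by linarith)
    calc _ ≤ (N : ℝ)⁻¹ * (9 * N ^ 2) := by gcongr
      _ = 9 * N := by field_simp
  have b1 : ‖gaussLine (rightHead N) s N ε‖ ≤ K₀ *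
      ((N : ℝ) ^ ε * gaussAvg (headLine N (1 / 2 + 2 * ε)) t) := by
    refine nR.trans ?_
    rw [mul_one, mul_assoc]; gcongr
  have b2 : ‖gaussLine (leftHead N) s N (-ε)‖ ≤
      K₀ * ((N : ℝ) ^ ε * gaussAvg (headLine N (1 / 2)) t) := by
    refine nL.trans ?_
    rw [mul_one, mul_assoc]; gcongr
  have b3 : ‖gaussLine (fun z => zetaSqReg z - rightHead N z) s N (1 - ε)‖ ≤
      K₀ * (N * gaussAvg (tailLine N) t) := by
    refine nRt.trans ?_
    rw [mul_one, mul_assoc]; gcongr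
  have b4 : ‖gaussLine (fun z => zetaSqReg z - leftHead N z) s N (-1 - ε)‖ ≤
      K₀ * (9 * N * gaussAvg (tailLine N) t) := by
    refine nLt.trans ?_
    rw [mul_assoc (rexp _ / _), mul_assoc (rexp _ / _)]; gcongr
  have e : 2 * π * zetaSqReg s = gaussLine (rightHead N) s N ε +
      gaussLine (fun z => zetaSqReg z - rightHead N z) s N (1 - ε) -
      (gaussLine (leftHead N) s N (-ε) +
        gaussLine (fun z => zetaSqReg z - leftHead N z) s N (-1 - ε)) := by
    rw [hsubR, hsubL, hshR, ← hshL, ← hfull]; ring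
  have hn : 2 * π * ‖zetaSqReg s‖ = ‖2 * π * zetaSqReg s‖ := by
    rw [norm_mul, norm_mul]; simp [abs_of_pos Real.pi_pos]
  have h2π : 1 ≤ 2 * π := by linarith [Real.pi_gt_three]
  calc ‖zetaSqReg s‖ ≤ 2 * π * ‖zetaSqReg s‖ := le_mul_of_one_le_left (norm_nonneg _) h2π
    _ ≤ K₀ * ((N : ℝ) ^ ε * gaussAvg (headLine N (1 / 2 + 2 * ε)) t) +
        K₀ * (N * gaussAvg (tailLine N) t) + (K₀ * ((N : ℝ) ^ ε * gaussAvg (headLine N (1 / 2)) t) +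
        K₀ * (9 * N * gaussAvg (tailLine N) t)) := by
      rw [hn, e]
      refine (norm_sub_le _ _).trans (add_le_add ((norm_add_le _ _).trans (add_le_add b1 b3))
        ((norm_add_le _ _).trans (add_le_add b2 b4)))
    _ ≤ _ := by
      have q1 : 0 ≤ K₀ * ((N : ℝ) ^ ε * gaussAvg (headLine N (1 / 2 + 2 * ε)) t) := by positivity
      have q2 : 0 ≤ K₀ * ((N : ℝ) ^ ε * gaussAvg (headLine N (1 / 2)) t) := by positivity
      linarith

end WeightedDivisor

namespace WeightedDivisor

open MeasureTheory in
/-- A fourth moment estimate for `ζ` just to the right of the critical line. -/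
lemma exists_fourth_moment_le {ε : ℝ} (hε : 0 < ε) (hε' : ε ≤ 1 / 4) :
    ∃ C : ℝ, 0 ≤ C ∧ ∀ N : ℕ, 1 ≤ N →
      ∫ t in (N : ℝ)..(N + N), ‖riemannZeta ((1 / 2 + ε : ℝ) + t * Complex.I)‖ ^ 4 ≤
        C * (N : ℝ) ^ (1 + 3 * ε) := by
  obtain ⟨K, hK, hG⟩ := exists_norm_zetaSqReg_half_le hε hε'
  obtain ⟨C₁, hC₁, hH⟩ := exists_integral_norm_sq_zetaSqHead_le (η := ε / 4) (by positivity)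
  obtain ⟨C₂, hC₂, hT⟩ := exists_integral_norm_sq_zetaSqTail_le (η := ε / 4) (by positivity)
    (by linarith)
  set A := ∫ v, gaussWeight v
  refine ⟨768 * K ^ 2 * A ^ 2 * (2 * C₁ + C₂), by positivity, fun N hN => ?_⟩
  have hN1 : (1 : ℝ) ≤ N := by exact_mod_cast hN
  have hN0 : (0 : ℝ) < N := by linarith
  obtain ⟨M, hM⟩ := exists_abs_tailLine_le N
  set u := gaussAvg (headLine N (1 / 2 + 2 * ε)) with hu
  set v := gaussAvg (headLine N (1 / 2)) with hv
  set w := gaussAvg (tailLine N) with hw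
  have cu : Continuous u := continuous_gaussAvg (continuous_headLine _ _)
      (abs_headLine_le N (by positivity))
  have cv : Continuous v := continuous_gaussAvg (continuous_headLine _ _)
      (abs_headLine_le N (by positivity))
  have cw : Continuous w := continuous_gaussAvg (continuous_tailLine _) hM
  have Iu : ∫ t in (N : ℝ)..(N + N), u t ^ 2 ≤ A ^ 2 * (C₁ * (N : ℝ) ^ (1 + 4 * (ε / 4))) :=
    integral_gaussAvg_sq_le (continuous_headLine _ _) (abs_headLine_le N (by positivity)) hN0.le
      (fun t₀ => hH N hN _ (by linarith) t₀) N
  have Iv : ∫ t in (N : ℝ)..(N + N), v t ^ 2 ≤ A ^ 2 * (C₁ * (N : ℝ) ^ (1 + 4 * (ε / 4))) :=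
    integral_gaussAvg_sq_le (continuous_headLine _ _) (abs_headLine_le N (by positivity)) hN0.le
      (fun t₀ => hH N hN _ le_rfl t₀) N
  have Iw : ∫ t in (N : ℝ)..(N + N), w t ^ 2 ≤ A ^ 2 * (C₂ * (N : ℝ) ^ (4 * (ε / 4) - 1)) :=
    integral_gaussAvg_sq_le (continuous_tailLine _) hM hN0.le (fun t₀ => hT N hN t₀) N
  have hpt : ∀ t ∈ Set.Icc (N : ℝ) (N + N),
      ‖riemannZeta ((1 / 2 + ε : ℝ) + t * Complex.I)‖ ^ 4 ≤
        768 * K ^ 2 * ((N : ℝ) ^ (2 * ε) * u t ^ 2 + (N : ℝ) ^ (2 * ε) * v t ^ 2 +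
            N ^ 2 * w t ^ 2) := by
    intro t ht
    have h := hG N hN t ht.1 ht.2
    set s : ℂ := (1 / 2 + ε : ℝ) + t * Complex.I with hs
    have ht1 : 1 ≤ t := hN1.trans ht.1
    have hre : s.re = 1 / 2 + ε := by simp [hs]
    have him : s.im = t := by simp [hs]
    have hs1 : s ≠ 1 := fun e => by
      have := congrArg Complex.im e
      rw [him] at this; simp at this; linarith
    have h4 : ‖s + 2‖ ≤ 4 * ‖s - 1‖ := by
      have h1 : 1 ≤ ‖s - 1‖ := by
        have := Complex.abs_im_le_norm (s - 1)
        simp only [Complex.sub_im, him, Complex.one_im, sub_zero,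
            abs_of_nonneg (by linarith : 0 ≤ t)] at this
        linarith
      calc ‖s + 2‖ = ‖(s - 1) + 3‖ := by ring_nf
        _ ≤ ‖s - 1‖ + 3 := (norm_add_le _ _).trans (by simp)
        _ ≤ _ := by linarith
    have hz2 : 0 < ‖s + 2‖ := norm_pos_iff.2 fun e => by
      have := congrArg Complex.im e
      simp [him] at this; linarith
    have h5 : ‖riemannZeta s‖ ^ 2 ≤ 16 * ‖zetaSqReg s‖ := by
      rw [zetaSqReg_eq hs1, norm_mul, poleFactor, norm_pow, norm_pow, norm_div,
          div_pow, ← mul_assoc]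
      refine le_mul_of_one_le_left (by positivity) ?_
      rw [← mul_div_assoc, le_div_iff₀ (by positivity), one_mul]
      calc ‖s + 2‖ ^ 2 ≤ (4 * ‖s - 1‖) ^ 2 := by gcongr
        _ = _ := by ring
    have e2 : (N : ℝ) ^ (2 * ε) = ((N : ℝ) ^ ε) ^ 2 := by
      rw [mul_comm, rpow_mul hN0.le]; norm_cast
    rw [e2]
    set P := (N : ℝ) ^ ε
    calc ‖riemannZeta s‖ ^ 4 = (‖riemannZeta s‖ ^ 2) ^ 2 := by ring
      _ ≤ (16 * (K * (P * (u t + v t) + N * w t))) ^ 2 := by gcongr; exact h5.trans (by gcongr)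
      _ ≤ _ := by
        have : (P * (u t + v t) + N * w t) ^ 2 ≤
            3 * (P ^ 2 * u t ^ 2 + P ^ 2 * v t ^ 2 + N ^ 2 * w t ^ 2) := by
          nlinarith [sq_nonneg (P * u t - P * v t), sq_nonneg (P * u t - N * w t),
            sq_nonneg (P * v t - N * w t)]
        calc _ = 256 * K ^ 2 * (P * (u t + v t) + N * w t) ^ 2 := by ring
          _ ≤ 256 * K ^ 2 * (3 * (P ^ 2 * u t ^ 2 + P ^ 2 * v t ^ 2 + N ^ 2 * w t ^ 2)) := by gcongr
          _ = _ := by ring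
  have hle : (N : ℝ) ≤ N + N := by linarith
  have cζ : ContinuousOn (fun t : ℝ => ‖riemannZeta ((1 / 2 + ε : ℝ) + t * Complex.I)‖ ^ 4)
      (Set.uIcc (N : ℝ) (N + N)) := by
    refine fun t ht => ContinuousAt.continuousWithinAt ?_
    rw [Set.uIcc_of_le hle] at ht
    have : ContinuousAt (fun t : ℝ => riemannZeta ((1 / 2 + ε : ℝ) + t * Complex.I)) t := by
      refine ContinuousAt.comp (g := riemannZeta)
        (f := fun t : ℝ => ((1 / 2 + ε : ℝ) + t * Complex.I : ℂ)) ?_ (by fun_prop)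
      refine (differentiableAt_riemannZeta fun e => ?_).continuousAt
      have := congrArg Complex.im e
      simp at this; linarith [ht.1]
    fun_prop
  have ii : ∀ f : ℝ → ℝ, Continuous f → IntervalIntegrable f volume N (N + N) :=
    fun f hf => hf.intervalIntegrable _ _
  calc ∫ t in (N : ℝ)..(N + N), ‖riemannZeta ((1 / 2 + ε : ℝ) + t * Complex.I)‖ ^ 4
      ≤ ∫ t in (N : ℝ)..(N + N), 768 * K ^ 2 *
        ((N : ℝ) ^ (2 * ε) * u t ^ 2 + (N : ℝ) ^ (2 * ε) * v t ^ 2 + N ^ 2 * w t ^ 2) :=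
        intervalIntegral.integral_mono_on hle cζ.intervalIntegrable (ii _ (by fun_prop)) hpt
    _ = 768 * K ^ 2 * ((N : ℝ) ^ (2 * ε) * (∫ t in (N : ℝ)..(N + N), u t ^ 2) +
        (N : ℝ) ^ (2 * ε) * (∫ t in (N : ℝ)..(N + N), v t ^ 2) +
        N ^ 2 * ∫ t in (N : ℝ)..(N + N), w t ^ 2) := by
        rw [intervalIntegral.integral_const_mul,
            intervalIntegral.integral_add (ii _ (by fun_prop)) (ii _ (by fun_prop)),
          intervalIntegral.integral_add (ii _ (by fun_prop)) (ii _ (by fun_prop)),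
          intervalIntegral.integral_const_mul, intervalIntegral.integral_const_mul,
          intervalIntegral.integral_const_mul]
    _ ≤ 768 * K ^ 2 * ((N : ℝ) ^ (2 * ε) * (A ^ 2 * (C₁ * (N : ℝ) ^ (1 + 4 * (ε / 4)))) +
        (N : ℝ) ^ (2 * ε) * (A ^ 2 * (C₁ * (N : ℝ) ^ (1 + 4 * (ε / 4)))) +
        N ^ 2 * (A ^ 2 * (C₂ * (N : ℝ) ^ (4 * (ε / 4) - 1)))) := by gcongr
    _ ≤ 768 * K ^ 2 * A ^ 2 * (2 * C₁ + C₂) * (N : ℝ) ^ (1 + 3 * ε) := by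
        have e1 : (N : ℝ) ^ (2 * ε) * (N : ℝ) ^ (1 + 4 * (ε / 4)) = (N : ℝ) ^ (1 + 3 * ε) := by
          rw [← rpow_add hN0]; ring_nf
        have e2 : (N : ℝ) ^ 2 * (N : ℝ) ^ (4 * (ε / 4) - 1) ≤ (N : ℝ) ^ (1 + 3 * ε) := by
          rw [← rpow_natCast, ← rpow_add hN0]
          exact rpow_le_rpow_of_exponent_le hN1 (by push_cast; linarith)
        have e3 := mul_le_mul_of_nonneg_left e2 (by positivity : 0 ≤ 768 * K ^ 2 * A ^ 2 * C₂)
        rw [← e1] at e3 ⊢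
        linarith

/-- The part of the Dirichlet series of `ζ` supported on `(2^j, 2^(j+1)]`. -/
noncomputable def dyadicBlock (j : ℕ) (s : ℂ) : ℂ :=
  ∑ n ∈ Finset.Ioc (2 ^ j : ℕ) (2 * 2 ^ j), (n : ℂ) ^ (-s)

lemma continuous_dyadicBlock (j : ℕ) : Continuous (dyadicBlock j) := by
  refine continuous_finsetSum _ fun n hn => ?_
  have : (n : ℂ) ≠ 0 := by
    have := (Finset.mem_Ioc.1 hn).1
    exact_mod_cast (Nat.zero_lt_of_lt this).ne'
  exact Continuous.const_cpow (by fun_prop) (Or.inl this)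

lemma sum_Icc_two_pow (J : ℕ) (s : ℂ) :
    ∑ n ∈ Finset.Icc 1 (2 ^ J : ℕ), (n : ℂ) ^ (-s) = 1 + ∑ j ∈ Finset.range J, dyadicBlock j s := by
  induction J with
  | zero => simp
  | succ J ih =>
    have h1 : Finset.Icc 1 (2 ^ (J + 1)) = Finset.Icc 1 (2 ^ J) ∪ Finset.Ioc (2 ^ J)
        (2 * 2 ^ J) := by
      ext n
      have := Nat.one_le_two_pow (n := J)
      simp only [Finset.mem_Icc, Finset.mem_union, Finset.mem_Ioc, pow_succ]
      omega
    have h2 : Disjoint (Finset.Icc 1 (2 ^ J)) (Finset.Ioc (2 ^ J) (2 * 2 ^ J)) := by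
      rw [Finset.disjoint_left]
      intro n h h'
      simp only [Finset.mem_Icc, Finset.mem_Ioc] at h h'
      omega
    rw [h1, Finset.sum_union h2, ih, Finset.sum_range_succ, dyadicBlock, add_assoc]

lemma norm_dyadicBlock_le (j : ℕ) {s : ℂ} (hs : 0.978287 ≤ s.re) :
    ‖dyadicBlock j s‖ ≤ ((2 : ℝ) ^ j) ^ (0.021713 : ℝ) := by
  have h2 : (0 : ℝ) < 2 ^ j := by positivity
  have h1 : (1 : ℝ) ≤ 2 ^ j := one_le_pow₀ (by norm_num)
  calc ‖dyadicBlock j s‖ ≤ ∑ n ∈ Finset.Ioc (2 ^ j : ℕ) (2 * 2 ^ j),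
      ((2 : ℝ) ^ j) ^ (-0.978287 : ℝ) := by
        refine norm_sum_le_of_le _ fun n hn => ?_
        have hn1 := (Finset.mem_Ioc.1 hn).1
        have hn2 : (2 : ℝ) ^ j ≤ n := by exact_mod_cast hn1.le
        rw [norm_natCast_cpow_neg (Nat.zero_lt_of_lt hn1)]
        calc (n : ℝ) ^ (-s.re) ≤ (2 ^ j : ℝ) ^ (-s.re) :=
              rpow_le_rpow_of_nonpos h2 hn2 (by linarith)
          _ ≤ _ := rpow_le_rpow_of_exponent_le h1 (by linarith)
    _ = (2 ^ j : ℝ) ^ (1 : ℝ) * ((2 : ℝ) ^ j) ^ (-0.978287 : ℝ) := by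
        simp only [Finset.sum_const, Nat.card_Ioc, nsmul_eq_mul, rpow_one]
        congr 1
        rw [two_mul, Nat.add_sub_cancel]; push_cast; rfl
    _ = _ := by rw [← rpow_add h2]; norm_num

lemma norm_riemannZeta_le_dyadic {N J : ℕ} (hN : 1 ≤ N) (hJ : (N : ℝ) ^ (1.1 : ℝ) ≤ 2 ^ J)
    (hJ' : (2 : ℝ) ^ J ≤ 2 * (N : ℝ) ^ (1.1 : ℝ)) {σ t : ℝ} (hσ : 0.978287 ≤ σ) (hσ' : σ ≤ 3)
    (ht : (N : ℝ) ≤ t) (ht' : t ≤ N + N) :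
    ‖riemannZeta (σ + t * Complex.I)‖ ≤
      10 + ∑ j ∈ Finset.range J, ‖dyadicBlock j (σ + t * Complex.I)‖ := by
  have hN1 : (1 : ℝ) ≤ N := by exact_mod_cast hN
  have hN0 : (0 : ℝ) < N := by linarith
  set s : ℂ := σ + t * Complex.I with hs
  have hre : s.re = σ := by simp [hs]
  have him : s.im = t := by simp [hs]
  have hs1 : s ≠ 1 := fun e => by
    have := congrArg Complex.im e
    rw [him] at this; simp at this; linarith
  have hP1 : (1 : ℝ) ≤ 2 ^ J := one_le_pow₀ (by norm_num)
  have hP0 : (0 : ℝ) < 2 ^ J := by positivity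
  have h := norm_riemannZeta_sub_sum_le (s := s) (by rw [hre]; linarith) hs1 (N := 2 ^ J)
    Nat.one_le_two_pow
  have e1 : ‖s‖ / s.re * ((2 ^ J : ℕ) : ℝ) ^ (-s.re) ≤ 6 := by
    have h1 : ‖s‖ ≤ 5 * N := by
      refine (Complex.norm_le_abs_re_add_abs_im s).trans ?_
      rw [hre, him, abs_of_nonneg (by linarith), abs_of_nonneg (by linarith)]
      linarith
    have h2 : ((2 ^ J : ℕ) : ℝ) ^ (-s.re) ≤ (N : ℝ) ^ (-1 : ℝ) := by
      push_cast
      rw [hre]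
      calc ((2 : ℝ) ^ J) ^ (-σ) ≤ (2 ^ J : ℝ) ^ (-0.978287 : ℝ) :=
            rpow_le_rpow_of_exponent_le hP1 (by linarith)
        _ ≤ ((N : ℝ) ^ (1.1 : ℝ)) ^ (-0.978287 : ℝ) :=
            rpow_le_rpow_of_nonpos (by positivity) hJ (by norm_num)
        _ ≤ _ := by
            rw [← rpow_mul hN0.le]
            exact rpow_le_rpow_of_exponent_le hN1 (by norm_num)
    rw [rpow_neg_one] at h2
    calc ‖s‖ / s.re * ((2 ^ J : ℕ) : ℝ) ^ (-s.re) ≤ (5 * N) / 0.9 * (N : ℝ)⁻¹ := by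
          gcongr
          rw [hre]; linarith
      _ ≤ 6 := by rw [div_mul_eq_mul_div, mul_assoc, mul_inv_cancel₀ hN0.ne']; norm_num
  have e2 : ‖((2 ^ J : ℕ) : ℂ) ^ (1 - s) / (s - 1)‖ ≤ 2 := by
    have h1 : (N : ℝ) ≤ ‖s - 1‖ := by
      have := Complex.abs_im_le_norm (s - 1)
      simp only [Complex.sub_im, him, Complex.one_im, sub_zero,
          abs_of_nonneg (by linarith : 0 ≤ t)] at this
      linarith
    have h2 : ‖((2 ^ J : ℕ) : ℂ) ^ (1 - s)‖ ≤ 2 * N := by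
      rw [Complex.norm_natCast_cpow_of_pos (by positivity)]
      push_cast
      simp only [Complex.sub_re, Complex.one_re, hre]
      calc ((2 : ℝ) ^ J) ^ (1 - σ) ≤ (2 ^ J : ℝ) ^ (1 / 2 : ℝ) :=
            rpow_le_rpow_of_exponent_le hP1 (by linarith)
        _ ≤ ((2 * N : ℝ) ^ 2) ^ (1 / 2 : ℝ) := by
            gcongr
            refine hJ'.trans ?_
            have : (N : ℝ) ^ (1.1 : ℝ) ≤ (N : ℝ) ^ (2 : ℝ) :=
              rpow_le_rpow_of_exponent_le hN1 (by norm_num)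
            rw [rpow_two] at this
            nlinarith
        _ = _ := by rw [← sqrt_eq_rpow, sqrt_sq (by positivity)]
    rw [norm_div, div_le_iff₀ (by linarith)]
    linarith
  rw [sum_Icc_two_pow] at h
  set S := ∑ j ∈ Finset.range J, dyadicBlock j s
  have hS : ‖S‖ ≤ ∑ j ∈ Finset.range J, ‖dyadicBlock j s‖ := norm_sum_le _ _
  set P := ((2 ^ J : ℕ) : ℂ) ^ (1 - s) / (s - 1)
  calc ‖riemannZeta s‖ = ‖(riemannZeta s - (1 + S) - P) + P + 1 + S‖ := by ring_nf
    _ ≤ ‖riemannZeta s - (1 + S) - P‖ + ‖P‖ + ‖(1 : ℂ)‖ + ‖S‖ := norm_add₄_le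
    _ ≤ 6 + 2 + 1 + ‖S‖ := by gcongr; exacts [h.trans e1, by simp]
    _ ≤ _ := by linarith

lemma exists_two_pow_near {N : ℕ} (hN : 1 ≤ N) :
    ∃ J : ℕ, (N : ℝ) ^ (1.1 : ℝ) ≤ 2 ^ J ∧ (2 : ℝ) ^ J ≤ 2 * (N : ℝ) ^ (1.1 : ℝ) := by
  have hN1 : (1 : ℝ) ≤ N := by exact_mod_cast hN
  obtain ⟨n, h1, h2⟩ := exists_nat_pow_near (one_le_rpow hN1 (by norm_num : (0 : ℝ) ≤ 1.1))
    (by norm_num : (1 : ℝ) < 2)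
  exact ⟨n + 1, h2.le, by rw [pow_succ, mul_comm]; gcongr⟩

/-- The number of dyadic blocks needed at height `N` is `O(N^η)`. -/
lemma exists_card_blocks_le {η : ℝ} (hη : 0 < η) :
    ∃ C : ℝ, 1 ≤ C ∧ ∀ N J : ℕ, 1 ≤ N → (2 : ℝ) ^ J ≤ 2 * (N : ℝ) ^ (1.1 : ℝ) →
      (J : ℝ) + 1 ≤ C * (N : ℝ) ^ η := by
  obtain ⟨C, hC, h⟩ := exists_one_add_log_le hη
  refine ⟨4 * C, by linarith, fun N J hN hJ => ?_⟩
  have hN1 : (1 : ℝ) ≤ N := by exact_mod_cast hN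
  have hN0 : (0 : ℝ) < N := by linarith
  have h1 := Real.log_le_log (by positivity) hJ
  rw [Real.log_pow, Real.log_mul (by norm_num) (by positivity), Real.log_rpow hN0] at h1
  have h2 := Real.log_two_gt_d9
  have h3 := Real.log_two_lt_d9
  have h4 := h N hN1
  have h5 := Real.log_nonneg hN1
  nlinarith

end WeightedDivisor

namespace WeightedDivisor

open MeasureTheory

lemma exists_pow_near_of_rpow_lt {N : ℕ} (hN : 1 ≤ N) {η B : ℝ} (hη : 0 < η) (hB : (N : ℝ) ^ η < B)
    (hB' : B ≤ (N : ℝ) ^ (1.1 : ℝ)) :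
    ∃ k : ℕ, 6 ≤ k ∧ k ≤ ⌈1 / η⌉₊ + 6 ∧ (N : ℝ) ≤ B ^ k ∧ B ^ k ≤ (N : ℝ) ^ (6.6 : ℝ) := by
  have hN1 : (1 : ℝ) ≤ N := by exact_mod_cast hN
  have hN0 : (0 : ℝ) < N := by linarith
  have hB1 : 1 ≤ B := (one_le_rpow hN1 hη.le).trans hB.le
  have hB0 : 0 < B := by linarith
  by_cases h6 : (N : ℝ) ≤ B ^ 6
  · refine ⟨6, le_rfl, by omega, h6, ?_⟩
    calc B ^ 6 ≤ ((N : ℝ) ^ (1.1 : ℝ)) ^ 6 := by gcongr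
      _ = _ := by rw [← rpow_natCast, ← rpow_mul hN0.le]; norm_num
  · have hex : ∃ k : ℕ, (N : ℝ) ≤ B ^ k := by
      refine ⟨⌈1 / η⌉₊, ?_⟩
      calc (N : ℝ) = (N : ℝ) ^ (η * (1 / η)) := by rw [mul_one_div_cancel hη.ne', rpow_one]
        _ ≤ (N : ℝ) ^ (η * ⌈1 / η⌉₊) := by
            refine rpow_le_rpow_of_exponent_le hN1 ?_
            gcongr; exact Nat.le_ceil _
        _ = ((N : ℝ) ^ η) ^ ⌈1 / η⌉₊ := by rw [rpow_mul hN0.le, rpow_natCast]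
        _ ≤ _ := by gcongr
    classical
    have hspec := Nat.find_spec hex
    have hmin : Nat.find hex ≤ ⌈1 / η⌉₊ := by
      refine Nat.find_min' hex ?_
      calc (N : ℝ) = (N : ℝ) ^ (η * (1 / η)) := by rw [mul_one_div_cancel hη.ne', rpow_one]
        _ ≤ (N : ℝ) ^ (η * ⌈1 / η⌉₊) := by
            refine rpow_le_rpow_of_exponent_le hN1 ?_
            gcongr; exact Nat.le_ceil _
        _ = ((N : ℝ) ^ η) ^ ⌈1 / η⌉₊ := by rw [rpow_mul hN0.le, rpow_natCast]
        _ ≤ _ := by gcongr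
    set k := Nat.find hex with hk
    have hk6 : 6 < k := by
      by_contra hle
      exact h6 (hspec.trans (pow_le_pow_right₀ hB1 (not_lt.1 hle)))
    have hpred : B ^ (k - 1) < N := not_le.1 (Nat.find_min hex (m := k - 1) (by omega))
    refine ⟨k, hk6.le, by omega, hspec, ?_⟩
    calc B ^ k = B ^ (k - 1) * B := by rw [← pow_succ, Nat.sub_add_cancel (by omega)]
      _ ≤ (N : ℝ) ^ (1 : ℝ) * (N : ℝ) ^ (1.1 : ℝ) := by rw [rpow_one]; gcongr
      _ = (N : ℝ) ^ (1 + 1.1 : ℝ) := by rw [rpow_add hN0]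
      _ ≤ _ := rpow_le_rpow_of_exponent_le hN1 (by norm_num)

lemma continuousOn_zeta_line (x : ℝ) {u v : ℝ} (hu : 0 < u) :
    ContinuousOn (fun t : ℝ => riemannZeta (x + t * Complex.I)) (Set.Icc u v) := by
  refine fun t ht => ContinuousAt.continuousWithinAt ?_
  refine ContinuousAt.comp (g := riemannZeta)
    (f := fun t : ℝ => (x + t * Complex.I : ℂ)) ?_ (by fun_prop)
  refine (differentiableAt_riemannZeta fun e => ?_).continuousAt
  have := congrArg Complex.im e
  simp at this; linarith [ht.1]

/-- The twelfth power of a dyadic block, weighted by the fourth power of `ζ`, in mean. -/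
lemma exists_weighted_block_le {ε : ℝ} (hε : 0 < ε) (hε' : ε ≤ 0.001) :
    ∃ C : ℝ, 0 ≤ C ∧ ∀ N : ℕ, 1 ≤ N → ∀ j : ℕ, (2 : ℝ) ^ j ≤ (N : ℝ) ^ (1.1 : ℝ) →
      ∀ σ : ℝ, 0.978287 ≤ σ →
      ∫ t in (N : ℝ)..(N + N), ‖riemannZeta ((1 / 2 + ε : ℝ) + t * Complex.I)‖ ^ 4 *
        ‖dyadicBlock j (σ + t * Complex.I)‖ ^ 12 ≤ C * (N : ℝ) ^ (1 + 15 * ε) := by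
  obtain ⟨C₄, hC₄, h4⟩ := exists_fourth_moment_le hε (by linarith)
  obtain ⟨Cz, hCz, hz⟩ := exists_norm_riemannZeta_le
  choose D hD hm using fun k => exists_moment_block_le k hε
  set K := ⌈1 / ε⌉₊ + 6
  set E := ∑ k ∈ Finset.range (K + 1), D k
  have hE : 0 ≤ E := Finset.sum_nonneg fun k _ => hD k
  refine ⟨C₄ + 16 * Cz ^ 4 * E, by positivity, fun N hN j hj σ hσ => ?_⟩
  have hN1 : (1 : ℝ) ≤ N := by exact_mod_cast hN
  have hN0 : (0 : ℝ) < N := by linarith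
  have hle : (N : ℝ) ≤ N + N := by linarith
  have h2 : (0 : ℝ) < 2 ^ j := by positivity
  have h1 : (1 : ℝ) ≤ 2 ^ j := one_le_pow₀ (by norm_num)
  have cz : ContinuousOn (fun t : ℝ => riemannZeta ((1 / 2 + ε : ℝ) + t * Complex.I))
      (Set.uIcc (N : ℝ) (N + N)) := by
    rw [Set.uIcc_of_le hle]; exact continuousOn_zeta_line _ hN0
  have cW : Continuous fun t : ℝ => dyadicBlock j (σ + t * Complex.I) :=
    (continuous_dyadicBlock j).comp (by fun_prop)
  set F : ℝ → ℝ := fun t => ‖riemannZeta ((1 / 2 + ε : ℝ) + t * Complex.I)‖ ^ 4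
  set W : ℝ → ℝ := fun t => ‖dyadicBlock j (σ + t * Complex.I)‖
  have cF : ContinuousOn F (Set.uIcc (N : ℝ) (N + N)) := cz.norm.pow 4
  have cW' : ContinuousOn W (Set.uIcc (N : ℝ) (N + N)) := cW.norm.continuousOn
  have hF0 : ∀ t, 0 ≤ F t := fun t => by positivity
  have hW0 : ∀ t, 0 ≤ W t := fun t => norm_nonneg _
  have h4N := h4 N hN
  change ∫ t in (N : ℝ)..(N + N), F t * W t ^ 12 ≤ _
  change ∫ t in (N : ℝ)..(N + N), F t ≤ _ at h4N
  rcases le_or_gt ((2 : ℝ) ^ j) ((N : ℝ) ^ ε) with hs | hl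
  · have hW : ∀ t, W t ^ 12 ≤ (N : ℝ) ^ (12 * ε) := fun t => by
      calc W t ^ 12 ≤ ((N : ℝ) ^ ε) ^ 12 := by
            refine pow_le_pow_left₀ (hW0 t) ?_ 12
            refine (norm_dyadicBlock_le j (by simpa using hσ)).trans ?_
            calc ((2 : ℝ) ^ j) ^ (0.021713 : ℝ) ≤ ((2 : ℝ) ^ j) ^ (1 : ℝ) :=
                  rpow_le_rpow_of_exponent_le h1 (by norm_num)
              _ ≤ _ := by rwa [rpow_one]
        _ = _ := by rw [← rpow_natCast, ← rpow_mul hN0.le]; push_cast; ring_nf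
    calc ∫ t in (N : ℝ)..(N + N), F t * W t ^ 12
        ≤ ∫ t in (N : ℝ)..(N + N), F t * (N : ℝ) ^ (12 * ε) :=
          intervalIntegral.integral_mono_on hle (cF.mul (cW'.pow 12)).intervalIntegrable
            (cF.mul continuousOn_const).intervalIntegrable
            fun t _ => mul_le_mul_of_nonneg_left (hW t) (hF0 t)
      _ = (∫ t in (N : ℝ)..(N + N), F t) * (N : ℝ) ^ (12 * ε) := by
          rw [intervalIntegral.integral_mul_const]
      _ ≤ (C₄ * (N : ℝ) ^ (1 + 3 * ε)) * (N : ℝ) ^ (12 * ε) := by gcongr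
      _ = C₄ * (N : ℝ) ^ (1 + 15 * ε) := by rw [mul_assoc, ← rpow_add hN0]; ring_nf
      _ ≤ _ := by gcongr; exact le_add_of_nonneg_right (by positivity)
  · obtain ⟨k, hk6, hkK, hNk, hkN⟩ := exists_pow_near_of_rpow_lt hN hε hl hj
    have hDk : D k ≤ E := Finset.single_le_sum (f := D) (fun i _ => hD i)
      (Finset.mem_range.2 (Nat.lt_succ_of_le hkK))
    have hmk := hm k (2 ^ j) Nat.one_le_two_pow σ (by linarith) N N hN0.le (by push_cast; exact hNk)
    have hWk : ∫ t in (N : ℝ)..(N + N), W t ^ (2 * k) ≤ E * (N : ℝ) ^ (0.3065 : ℝ) := by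
      refine hmk.trans ?_
      push_cast
      have hp : (1 : ℝ) ≤ (2 ^ j) ^ k := one_le_pow₀ h1
      calc D k * (((2 : ℝ) ^ j) ^ k) ^ (2 - 2 * σ + 3 * ε)
          ≤ E * (((2 : ℝ) ^ j) ^ k) ^ (0.046426 : ℝ) := by
            gcongr
            linarith
        _ ≤ E * ((N : ℝ) ^ (6.6 : ℝ)) ^ (0.046426 : ℝ) := by gcongr
        _ ≤ _ := by
            rw [← rpow_mul hN0.le]
            gcongr
            norm_num
    have hFs : ∀ t ∈ Set.Icc (N : ℝ) (N + N), F t ≤ 16 * Cz ^ 4 * (N : ℝ) ^ (0.68 : ℝ) := by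
      intro t ht
      have ht0 : 0 < t := hN0.trans_le ht.1
      have ht1 : (1 : ℝ) ≤ |t| := by rw [abs_of_pos ht0]; exact hN1.trans ht.1
      have := hz (1 / 2 + ε) t (by linarith) (by linarith) ht1
      rw [abs_of_pos ht0] at this
      have h3 : t ^ (0.17 : ℝ) ≤ 2 * (N : ℝ) ^ (0.17 : ℝ) := by
        calc t ^ (0.17 : ℝ) ≤ (2 * N) ^ (0.17 : ℝ) := by gcongr; linarith [ht.2]
          _ = 2 ^ (0.17 : ℝ) * (N : ℝ) ^ (0.17 : ℝ) := mul_rpow (by norm_num) hN0.le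
          _ ≤ 2 ^ (1 : ℝ) * (N : ℝ) ^ (0.17 : ℝ) := by
            gcongr
            · norm_num
            · norm_num
          _ = _ := by rw [rpow_one]
      calc F t ≤ (Cz * (2 * (N : ℝ) ^ (0.17 : ℝ))) ^ 4 := by
            refine pow_le_pow_left₀ (norm_nonneg _) (this.trans ?_) 4
            gcongr
        _ = 16 * Cz ^ 4 * ((N : ℝ) ^ (0.17 : ℝ)) ^ 4 := by ring
        _ = _ := by rw [← rpow_natCast ((N : ℝ) ^ (0.17 : ℝ)), ← rpow_mul hN0.le]; norm_num
    have hW12 : ∀ t, W t ^ 12 ≤ 1 + W t ^ (2 * k) := fun t => by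
      rcases le_total (W t) 1 with h | h
      · linarith [pow_le_one₀ (n := 12) (hW0 t) h, pow_nonneg (hW0 t) (2 * k)]
      · linarith [pow_le_pow_right₀ h (by omega : 12 ≤ 2 * k)]
    calc ∫ t in (N : ℝ)..(N + N), F t * W t ^ 12
        ≤ ∫ t in (N : ℝ)..(N + N), (F t + 16 * Cz ^ 4 * (N : ℝ) ^ (0.68 : ℝ) * W t ^ (2 * k)) := by
          refine intervalIntegral.integral_mono_on hle (cF.mul (cW'.pow 12)).intervalIntegrable
            (cF.add (continuousOn_const.mul (cW'.pow _))).intervalIntegrable fun t ht => ?_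
          calc F t * W t ^ 12 ≤ F t * (1 + W t ^ (2 * k)) := by gcongr; exact hW12 t
            _ = F t + F t * W t ^ (2 * k) := by ring
            _ ≤ _ := by
              gcongr
              exact hFs t ht
      _ = (∫ t in (N : ℝ)..(N + N), F t) +
          16 * Cz ^ 4 * (N : ℝ) ^ (0.68 : ℝ) * ∫ t in (N : ℝ)..(N + N), W t ^ (2 * k) := by
          have i2 : IntervalIntegrable (fun t => 16 * Cz ^ 4 * (N : ℝ) ^ (0.68 : ℝ) * W t ^ (2 * k))
              volume N (N + N) := (continuousOn_const.mul (cW'.pow _)).intervalIntegrable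
          rw [intervalIntegral.integral_add cF.intervalIntegrable i2,
              intervalIntegral.integral_const_mul]
      _ ≤ C₄ * (N : ℝ) ^ (1 + 3 * ε) +
          16 * Cz ^ 4 * (N : ℝ) ^ (0.68 : ℝ) * (E * (N : ℝ) ^ (0.3065 : ℝ)) := by gcongr
      _ = C₄ * (N : ℝ) ^ (1 + 3 * ε) +
          16 * Cz ^ 4 * E * (N : ℝ) ^ (0.68 + 0.3065 : ℝ) := by rw [rpow_add hN0 0.68]; ring
      _ ≤ C₄ * (N : ℝ) ^ (1 + 15 * ε) + 16 * Cz ^ 4 * E * (N : ℝ) ^ (1 + 15 * ε) := by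
          have q1 := rpow_le_rpow_of_exponent_le hN1 (by linarith : 1 + 3 * ε ≤ 1 + 15 * ε)
          have q2 := rpow_le_rpow_of_exponent_le hN1
            (by norm_num; linarith : (0.68 + 0.3065 : ℝ) ≤ 1 + 15 * ε)
          exact add_le_add (mul_le_mul_of_nonneg_left q1 hC₄)
            (mul_le_mul_of_nonneg_left q2 (by positivity))
      _ = _ := by ring

/-- The mixed moment of `ζ` over a dyadic interval. -/
lemma exists_mixed_moment_le {ε : ℝ} (hε : 0 < ε) (hε' : ε ≤ 0.001) :
    ∃ C : ℝ, 0 ≤ C ∧ ∀ N : ℕ, 1 ≤ N → ∀ ℓ : ℕ, ℓ ≤ 12 →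
      ∀ σ : ℝ, 0.978287 ≤ σ → σ ≤ 3 →
      ∫ t in (N : ℝ)..(N + N), ‖riemannZeta ((1 / 2 + ε : ℝ) + t * Complex.I)‖ ^ 4 *
        ‖riemannZeta (σ + t * Complex.I)‖ ^ ℓ ≤ C * (N : ℝ) ^ (1 + 27 * ε) := by
  obtain ⟨C₄, hC₄, h4⟩ := exists_fourth_moment_le hε (by linarith)
  obtain ⟨Cb, hCb, hb⟩ := exists_weighted_block_le hε hε'
  obtain ⟨Cj, hCj, hj⟩ := exists_card_blocks_le hε
  set A : ℝ := 1 + 2 ^ 11 * 10 ^ 12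
  refine ⟨A * C₄ + 2 ^ 11 * Cj ^ 12 * Cb, by positivity, fun N hN ℓ hℓ σ hσ hσ' => ?_⟩
  have hN1 : (1 : ℝ) ≤ N := by exact_mod_cast hN
  have hN0 : (0 : ℝ) < N := by linarith
  have hle : (N : ℝ) ≤ N + N := by linarith
  obtain ⟨J, hJ, hJ'⟩ := exists_two_pow_near hN
  have hJc : (J : ℝ) ≤ Cj * (N : ℝ) ^ ε := by linarith [hj N J hN hJ']
  set F : ℝ → ℝ := fun t => ‖riemannZeta ((1 / 2 + ε : ℝ) + t * Complex.I)‖ ^ 4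
  set Z : ℝ → ℝ := fun t => ‖riemannZeta (σ + t * Complex.I)‖
  set W : ℕ → ℝ → ℝ := fun j t => ‖dyadicBlock j (σ + t * Complex.I)‖
  have cF : ContinuousOn F (Set.uIcc (N : ℝ) (N + N)) := by
    rw [Set.uIcc_of_le hle]; exact (continuousOn_zeta_line _ hN0).norm.pow 4
  have cZ : ContinuousOn Z (Set.uIcc (N : ℝ) (N + N)) := by
    rw [Set.uIcc_of_le hle]; exact (continuousOn_zeta_line _ hN0).norm
  have cW : ∀ j, Continuous (W j) := fun j =>
    ((continuous_dyadicBlock j).comp (by fun_prop : Continuous fun t : ℝ =>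
        (σ + t * Complex.I : ℂ))).norm
  have hF0 : ∀ t, 0 ≤ F t := fun t => by positivity
  have hZ0 : ∀ t, 0 ≤ Z t := fun t => norm_nonneg _
  have hW0 : ∀ j t, 0 ≤ W j t := fun j t => norm_nonneg _
  have h4N : ∫ t in (N : ℝ)..(N + N), F t ≤ C₄ * (N : ℝ) ^ (1 + 3 * ε) := h4 N hN
  have hbN : ∀ j ∈ Finset.range J, ∫ t in (N : ℝ)..(N + N), F t * W j t ^ 12 ≤
      Cb * (N : ℝ) ^ (1 + 15 * ε) := fun j hj => hb N hN j (by
    have h1 : (2 : ℝ) ^ (j + 1) ≤ 2 ^ J :=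
      pow_le_pow_right₀ (by norm_num) (Finset.mem_range.1 hj)
    rw [pow_succ] at h1
    linarith) σ hσ
  have hpt : ∀ t ∈ Set.Icc (N : ℝ) (N + N), F t * Z t ^ ℓ ≤
      A * F t + 2 ^ 11 * (J : ℝ) ^ 11 * ∑ j ∈ Finset.range J, F t * W j t ^ 12 := by
    intro t ht
    have h1 : Z t ^ ℓ ≤ 1 + Z t ^ 12 := by
      rcases le_total (Z t) 1 with h | h
      · linarith [pow_le_one₀ (n := ℓ) (hZ0 t) h, pow_nonneg (hZ0 t) 12]
      · linarith [pow_le_pow_right₀ h hℓ]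
    have h2 : Z t ^ 12 ≤ 2 ^ 11 * (10 ^ 12 + (J : ℝ) ^ 11 * ∑ j ∈ Finset.range J, W j t ^ 12) := by
      calc Z t ^ 12 ≤ (10 + ∑ j ∈ Finset.range J, W j t) ^ 12 :=
            pow_le_pow_left₀ (hZ0 t) (norm_riemannZeta_le_dyadic hN hJ hJ' hσ hσ' ht.1 ht.2) 12
        _ ≤ 2 ^ (12 - 1) * (10 ^ 12 + (∑ j ∈ Finset.range J, W j t) ^ 12) :=
            add_pow_le (by norm_num) (Finset.sum_nonneg fun j _ => hW0 j t) 12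
        _ ≤ _ := by
            have := pow_sum_le_card_mul_sum_pow (s := Finset.range J) (f := fun j => W j t)
              (fun j _ => hW0 j t) 11
            rw [Finset.card_range] at this
            norm_num at this ⊢
            linarith
    calc F t * Z t ^ ℓ ≤ F t * (1 + 2 ^ 11 * (10 ^ 12 + (J : ℝ) ^ 11 *
          ∑ j ∈ Finset.range J, W j t ^ 12)) :=
          mul_le_mul_of_nonneg_left (by linarith) (hF0 t)
      _ = _ := by rw [← Finset.mul_sum]; ring
  have iW : ∀ j, IntervalIntegrable (fun t => F t * W j t ^ 12) volume N (N + N) := fun j =>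
    (cF.mul ((cW j).continuousOn.pow 12)).intervalIntegrable
  have iS : IntervalIntegrable (fun t => ∑ j ∈ Finset.range J, F t * W j t ^ 12) volume N (N + N) :=
    (continuousOn_finsetSum _ fun j _ => cF.mul ((cW j).continuousOn.pow 12)).intervalIntegrable
  calc ∫ t in (N : ℝ)..(N + N), F t * Z t ^ ℓ
      ≤ ∫ t in (N : ℝ)..(N + N), (A * F t +
        2 ^ 11 * (J : ℝ) ^ 11 * ∑ j ∈ Finset.range J, F t * W j t ^ 12) :=
        intervalIntegral.integral_mono_on hle (cF.mul (cZ.pow ℓ)).intervalIntegrable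
          ((cF.intervalIntegrable.const_mul A).add (iS.const_mul _)) hpt
    _ = A * (∫ t in (N : ℝ)..(N + N), F t) + 2 ^ 11 * (J : ℝ) ^ 11 *
        ∑ j ∈ Finset.range J, ∫ t in (N : ℝ)..(N + N), F t * W j t ^ 12 := by
        rw [intervalIntegral.integral_add (cF.intervalIntegrable.const_mul A) (iS.const_mul _),
          intervalIntegral.integral_const_mul, intervalIntegral.integral_const_mul,
          intervalIntegral.integral_finsetSum fun j _ => iW j]
    _ ≤ A * (C₄ * (N : ℝ) ^ (1 + 3 * ε)) + 2 ^ 11 * (J : ℝ) ^ 11 *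
        ∑ j ∈ Finset.range J, Cb * (N : ℝ) ^ (1 + 15 * ε) := by
        gcongr with j hj
        exact hbN j hj
    _ = A * C₄ * (N : ℝ) ^ (1 + 3 * ε) + 2 ^ 11 * (J : ℝ) ^ 12 * Cb * (N : ℝ) ^ (1 + 15 * ε) := by
        rw [Finset.sum_const, Finset.card_range, nsmul_eq_mul]; ring
    _ ≤ A * C₄ * (N : ℝ) ^ (1 + 27 * ε) +
        2 ^ 11 * (Cj * (N : ℝ) ^ ε) ^ 12 * Cb * (N : ℝ) ^ (1 + 15 * ε) := by
        have q1 := rpow_le_rpow_of_exponent_le hN1 (by linarith : 1 + 3 * ε ≤ 1 + 27 * ε)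
        exact add_le_add (mul_le_mul_of_nonneg_left q1 (by positivity)) (by gcongr)
    _ = _ := by
        have : ((N : ℝ) ^ ε) ^ 12 * (N : ℝ) ^ (1 + 15 * ε) = (N : ℝ) ^ (1 + 27 * ε) := by
          rw [← rpow_natCast, ← rpow_mul hN0.le, ← rpow_add hN0]; push_cast; ring_nf
        rw [mul_pow, ← this]; ring

/-- A pointwise bound for `ζ` close to the line of abscissa `1`. -/
lemma exists_norm_riemannZeta_pow_twelve_le :
    ∃ C : ℝ, 1 ≤ C ∧ ∀ σ t : ℝ, 0.978287 ≤ σ → σ ≤ 3 → 1 ≤ |t| →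
      ‖riemannZeta (σ + t * Complex.I)‖ ^ 12 ≤ C * |t| ^ (0.288 : ℝ) := by
  obtain ⟨Cj, hCj, hj⟩ := exists_card_blocks_le (η := 0.0001) (by norm_num)
  have hpos : ∀ σ t : ℝ, 0.978287 ≤ σ → σ ≤ 3 → 1 ≤ t →
      ‖riemannZeta (σ + t * Complex.I)‖ ^ 12 ≤ (20 * Cj) ^ 12 * t ^ (0.288 : ℝ) := by
    intro σ t hσ hσ' ht
    set N := ⌊t⌋₊
    have ht0 : 0 < t := by linarith
    have hN : 1 ≤ N := Nat.one_le_floor_iff _ |>.2 ht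
    have hN1 : (1 : ℝ) ≤ N := by exact_mod_cast hN
    have hN0 : (0 : ℝ) < N := by linarith
    have hNt : (N : ℝ) ≤ t := Nat.floor_le ht0.le
    obtain ⟨J, hJ, hJ'⟩ := exists_two_pow_near hN
    have h := norm_riemannZeta_le_dyadic hN hJ hJ' hσ hσ' hNt (by linarith [Nat.lt_floor_add_one t])
    have hB : ∀ j ∈ Finset.range J, ‖dyadicBlock j (σ + t * Complex.I)‖ ≤
        2 * (N : ℝ) ^ (0.02389 : ℝ) := by
      intro j hj
      refine (norm_dyadicBlock_le j (by simpa using hσ)).trans ?_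
      calc ((2 : ℝ) ^ j) ^ (0.021713 : ℝ) ≤ (2 * (N : ℝ) ^ (1.1 : ℝ)) ^ (0.021713 : ℝ) := by
            gcongr
            exact (pow_le_pow_right₀ (by norm_num) (Finset.mem_range.1 hj).le).trans hJ'
        _ = 2 ^ (0.021713 : ℝ) * (N : ℝ) ^ (1.1 * 0.021713 : ℝ) := by
            rw [mul_rpow (by norm_num) (by positivity), ← rpow_mul hN0.le]
        _ ≤ 2 ^ (1 : ℝ) * (N : ℝ) ^ (0.02389 : ℝ) := by
            gcongr
            · norm_num
            · norm_num
            · norm_num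
        _ = _ := by rw [rpow_one]
    have h2 : ‖riemannZeta (σ + t * Complex.I)‖ ≤ 20 * Cj * (N : ℝ) ^ (0.02399 : ℝ) := by
      have h3 := Finset.sum_le_sum hB
      rw [Finset.sum_const, Finset.card_range, nsmul_eq_mul] at h3
      have h4 := hj N J hN hJ'
      have h5 : (1 : ℝ) ≤ (N : ℝ) ^ (0.02389 : ℝ) := one_le_rpow hN1 (by norm_num)
      calc ‖riemannZeta (σ + t * Complex.I)‖
          ≤ 10 + J * (2 * (N : ℝ) ^ (0.02389 : ℝ)) := h.trans (by linarith)
        _ ≤ 20 * (J + 1) * (N : ℝ) ^ (0.02389 : ℝ) := by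
          have : (0 : ℝ) ≤ J := by positivity
          nlinarith
        _ ≤ 20 * (Cj * (N : ℝ) ^ (0.0001 : ℝ)) * (N : ℝ) ^ (0.02389 : ℝ) := by gcongr
        _ = 20 * Cj * (N : ℝ) ^ (0.0001 + 0.02389 : ℝ) := by rw [rpow_add hN0]; ring
        _ = _ := by norm_num
    calc ‖riemannZeta (σ + t * Complex.I)‖ ^ 12 ≤
          (20 * Cj * (N : ℝ) ^ (0.02399 : ℝ)) ^ 12 := by gcongr
      _ = (20 * Cj) ^ 12 * (N : ℝ) ^ (0.02399 * 12 : ℝ) := by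
          rw [mul_pow, rpow_mul hN0.le]; norm_cast
      _ ≤ (20 * Cj) ^ 12 * t ^ (0.02399 * 12 : ℝ) := by gcongr
      _ ≤ _ := by
          have := rpow_le_rpow_of_exponent_le ht (by norm_num : (0.02399 * 12 : ℝ) ≤ 0.288)
          gcongr
  refine ⟨(20 * Cj) ^ 12, one_le_pow₀ (by linarith), fun σ t hσ hσ' ht => ?_⟩
  rcases le_total 0 t with h | h
  · rw [abs_of_nonneg h] at ht ⊢
    exact hpos σ t hσ hσ' ht
  · rw [abs_of_nonpos h] at ht ⊢
    have e : (σ + t * Complex.I : ℂ) = (starRingEnd ℂ) (σ + (-t : ℝ) * Complex.I) := by simp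
    rw [e, riemannZeta_conj, RCLike.norm_conj]
    exact hpos σ (-t) hσ hσ' ht

end WeightedDivisor

namespace WeightedDivisor

open MeasureTheory Filter

lemma integrableOn_Ioi_of_dyadic {f : ℝ → ℝ} (hf : Continuous f) (h0 : ∀ t, 0 ≤ f t) {C b b' : ℝ}
    (hC : 0 ≤ C) (hb : b < b') (hb0 : 0 ≤ b)
    (h : ∀ N : ℕ, 1 ≤ N → ∫ t in (N : ℝ)..(N + N), f t ≤ C * (N : ℝ) ^ (1 + b)) :
    IntegrableOn (fun t => f t * (1 + |t|) ^ (-1 - b')) (Set.Ioi 1) := by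
  have cg : Continuous fun t : ℝ => f t * (1 + |t|) ^ (-1 - b') :=
    hf.mul (Continuous.rpow_const (by fun_prop) fun t => Or.inl (by positivity))
  set q : ℝ := (2 : ℝ) ^ (b - b') with hq
  have hq0 : 0 < q := by positivity
  have hq1 : q < 1 := rpow_lt_one_of_one_lt_of_neg (by norm_num) (by linarith)
  have hterm : ∀ m : ℕ, ∫ t in ((2 : ℝ) ^ m)..((2 : ℝ) ^ (m + 1)), f t * (1 + |t|) ^ (-1 - b') ≤
      C * q ^ m := by
    intro m
    have hp : (0 : ℝ) < 2 ^ m := by positivity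
    have hle : (2 : ℝ) ^ m ≤ 2 ^ (m + 1) := pow_le_pow_right₀ (by norm_num) (by omega)
    have hm := h (2 ^ m) Nat.one_le_two_pow
    push_cast at hm
    rw [← two_mul, ← pow_succ'] at hm
    calc ∫ t in ((2 : ℝ) ^ m)..((2 : ℝ) ^ (m + 1)), f t * (1 + |t|) ^ (-1 - b')
        ≤ ∫ t in ((2 : ℝ) ^ m)..((2 : ℝ) ^ (m + 1)), f t * ((2 : ℝ) ^ m) ^ (-1 - b') := by
          refine intervalIntegral.integral_mono_on hle (cg.intervalIntegrable _ _)
            ((hf.mul continuous_const).intervalIntegrable _ _) fun t ht => ?_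
          refine mul_le_mul_of_nonneg_left ?_ (h0 t)
          refine rpow_le_rpow_of_nonpos hp ?_ (by linarith)
          rw [abs_of_pos (hp.trans_le ht.1)]; linarith [ht.1]
      _ = (∫ t in ((2 : ℝ) ^ m)..((2 : ℝ) ^ (m + 1)), f t) * ((2 : ℝ) ^ m) ^ (-1 - b') := by
          rw [intervalIntegral.integral_mul_const]
      _ ≤ (C * ((2 : ℝ) ^ m) ^ (1 + b)) * ((2 : ℝ) ^ m) ^ (-1 - b') := by gcongr
      _ = _ := by
          rw [mul_assoc, ← rpow_add hp, hq, ← rpow_natCast, ← rpow_mul (by norm_num),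
            ← rpow_natCast, ← rpow_mul (by norm_num)]
          ring_nf
  refine integrableOn_Ioi_of_intervalIntegral_norm_bounded (C * (1 - q)⁻¹) 1
    (b := fun n : ℕ => (2 : ℝ) ^ n) (l := atTop)
    (fun n => cg.continuousOn.integrableOn_Icc.mono_set Set.Ioc_subset_Icc_self)
    (tendsto_pow_atTop_atTop_of_one_lt (by norm_num)) (Eventually.of_forall fun n => ?_)
  have e : ∫ t in (1 : ℝ)..((2 : ℝ) ^ n), ‖f t * (1 + |t|) ^ (-1 - b')‖ =
      ∑ m ∈ Finset.range n, ∫ t in ((2 : ℝ) ^ m)..((2 : ℝ) ^ (m + 1)),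
          f t * (1 + |t|) ^ (-1 - b') := by
    rw [intervalIntegral.sum_integral_adjacent_intervals fun m _ => cg.intervalIntegrable _ _,
        pow_zero]
    refine intervalIntegral.integral_congr fun t _ => ?_
    exact norm_of_nonneg (mul_nonneg (h0 t) (by positivity))
  rw [e]
  calc _ ≤ ∑ m ∈ Finset.range n, C * q ^ m := Finset.sum_le_sum fun m _ => hterm m
    _ = C * ∑ m ∈ Finset.range n, q ^ m := by rw [Finset.mul_sum]
    _ ≤ _ := by
      rw [← tsum_geometric_of_lt_one hq0.le hq1]
      exact mul_le_mul_of_nonneg_left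
        ((summable_geometric_of_lt_one hq0.le hq1).sum_le_tsum _ fun _ _ => by positivity) hC

lemma integrable_of_dyadic {f : ℝ → ℝ} (hf : Continuous f) (h0 : ∀ t, 0 ≤ f t) {C b b' : ℝ}
    (hC : 0 ≤ C) (hb : b < b') (hb0 : 0 ≤ b)
    (h : ∀ N : ℕ, 1 ≤ N → ∫ t in (N : ℝ)..(N + N), f t ≤ C * (N : ℝ) ^ (1 + b))
    (h' : ∀ N : ℕ, 1 ≤ N → ∫ t in (N : ℝ)..(N + N), f (-t) ≤ C * (N : ℝ) ^ (1 + b)) :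
    Integrable fun t => f t * (1 + |t|) ^ (-1 - b') := by
  have cg : Continuous fun t : ℝ => f t * (1 + |t|) ^ (-1 - b') :=
    hf.mul (Continuous.rpow_const (by fun_prop) fun t => Or.inl (by positivity))
  have h1 := integrableOn_Ioi_of_dyadic hf h0 hC hb hb0 h
  have h2 := integrableOn_Ioi_of_dyadic (f := fun t => f (-t)) (by fun_prop) (fun t => h0 _)
      hC hb hb0 h'
  have h3 : IntegrableOn (fun t => f t * (1 + |t|) ^ (-1 - b')) (Set.Iio (-1)) := by
    have := h2.comp_neg
    simpa using this
  have h4 : IntegrableOn (fun t => f t * (1 + |t|) ^ (-1 - b')) (Set.Icc (-1) 1) :=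
    cg.continuousOn.integrableOn_Icc
  rw [← integrableOn_univ]
  refine (h3.union (h4.union h1)).mono_set fun x _ => ?_
  rcases lt_or_ge x (-1) with hx | hx
  · exact Or.inl hx
  · rcases le_or_gt x 1 with hx' | hx'
    · exact Or.inr (Or.inl ⟨hx, hx'⟩)
    · exact Or.inr (Or.inr hx')

lemma exists_polar_part (p : ℂ) (n : ℕ) : ∀ {E : ℂ → ℂ}, Differentiable ℂ E →
    ∃ (c : ℕ → ℂ) (H : ℂ → ℂ), Differentiable ℂ H ∧ ∀ s, s ≠ p →
      E s / (s - p) ^ n = ∑ k ∈ Finset.range n, c k / (s - p) ^ (k + 1) + H s := by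
  induction n with
  | zero => exact fun {E} hE => ⟨0, E, hE, fun s _ => by simp⟩
  | succ n ih =>
    intro E hE
    have hd : Differentiable ℂ (dslope E p) := by
      rw [← differentiableOn_univ, Complex.differentiableOn_dslope univ_mem]
      exact hE.differentiableOn
    obtain ⟨c, H, hH, h⟩ := ih hd
    refine ⟨fun k => if k = n then E p else c k, H, hH, fun s hs => ?_⟩
    have h0 : s - p ≠ 0 := sub_ne_zero.2 hs
    have e : E s = E p + (s - p) * dslope E p s := by
      have := sub_smul_dslope E p s
      rw [smul_eq_mul] at this
      rw [this]; ring
    simp only []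
    rw [Finset.sum_range_succ, if_pos rfl, Finset.sum_congr rfl fun k hk => by
      rw [if_neg (Finset.mem_range.1 hk).ne]]
    have := h s hs
    rw [div_eq_iff (pow_ne_zero _ h0)] at this
    rw [e, this]
    field_simp
    ring

lemma exists_partial_fractions {p q : ℂ} (hpq : p ≠ q) (m n : ℕ) {E : ℂ → ℂ}
    (hE : Differentiable ℂ E) :
    ∃ (b b' : ℕ → ℂ) (H : ℂ → ℂ), Differentiable ℂ H ∧ ∀ s, s ≠ p → s ≠ q →
      E s / ((s - p) ^ m * (s - q) ^ n) = ∑ k ∈ Finset.range m, b k / (s - p) ^ (k + 1) +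
        ∑ k ∈ Finset.range n, b' k / (s - q) ^ (k + 1) + H s := by
  have hc : IsCoprime (Polynomial.X - Polynomial.C p) (Polynomial.X - Polynomial.C q) :=
    Polynomial.isCoprime_X_sub_C_of_isUnit_sub (sub_ne_zero.2 hpq).isUnit
  obtain ⟨u, v, huv⟩ := hc.pow (m := m) (n := n)
  obtain ⟨b', H', hH', h'⟩ := exists_polar_part q n (hE.mul u.differentiable)
  obtain ⟨b, H, hH, h⟩ := exists_polar_part p m (hE.mul v.differentiable)
  refine ⟨b, b', fun s => H s + H' s, hH.add hH', fun s hp hq => ?_⟩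
  have e := congrArg (Polynomial.eval s) huv
  simp only [Polynomial.eval_add, Polynomial.eval_mul, Polynomial.eval_pow, Polynomial.eval_sub,
    Polynomial.eval_X, Polynomial.eval_C, Polynomial.eval_one] at e
  have hp0 : s - p ≠ 0 := sub_ne_zero.2 hp
  have hq0 : s - q ≠ 0 := sub_ne_zero.2 hq
  have h1 := h s hp
  have h2 := h' s hq
  simp only [Pi.mul_apply] at h1 h2
  calc E s / ((s - p) ^ m * (s - q) ^ n)
      = E s * (Polynomial.eval s u * (s - p) ^ m + Polynomial.eval s v * (s - q) ^ n) /
        ((s - p) ^ m * (s - q) ^ n) := by rw [e, mul_one]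
    _ = E s * Polynomial.eval s v / (s - p) ^ m + E s * Polynomial.eval s u / (s - q) ^ n := by
        field_simp
        ring
    _ = _ := by rw [h1, h2]; ring

lemma exists_zeta_product_decomp (ℓ : ℕ) {a : ℝ} (ha : a ≠ 0) :
    ∃ (b b' : ℕ → ℂ) (H : ℂ → ℂ), Differentiable ℂ H ∧ ∀ s : ℂ, s ≠ 1 → s ≠ ((1 - a : ℝ) : ℂ) →
      riemannZeta s ^ 4 * riemannZeta (s + a) ^ ℓ =
        ∑ k ∈ Finset.range 4, b k / (s - (1 : ℝ)) ^ (k + 1) +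
        ∑ k ∈ Finset.range ℓ, b' k / (s - (1 - a : ℝ)) ^ (k + 1) + H s := by
  have hE : Differentiable ℂ fun s : ℂ => riemannZeta₁ s ^ 4 * riemannZeta₁ (s + a) ^ ℓ :=
    (differentiable_riemannZeta₁.pow 4).mul
      ((differentiable_riemannZeta₁.comp (differentiable_id.add_const (a : ℂ))).pow ℓ)
  obtain ⟨b, b', H, hH, h⟩ := exists_partial_fractions (p := ((1 : ℝ) : ℂ)) (q := ((1 - a : ℝ) : ℂ))
    (fun e => ha (by have := Complex.ofReal_injective e; linarith)) 4 ℓ hE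
  refine ⟨b, b', H, hH, fun s h1 h2 => ?_⟩
  rw [← h s (by simpa using h1) h2]
  have h3 : s + a ≠ 1 := fun e => h2 (by push_cast; rw [← e]; ring)
  have h10 : s - 1 ≠ 0 := sub_ne_zero.2 h1
  have h20 : s + a - 1 ≠ 0 := sub_ne_zero.2 h3
  have e : s - ((1 - a : ℝ) : ℂ) = s + a - 1 := by push_cast; ring
  rw [riemannZeta_eq_inv_sub_mul h1, riemannZeta_eq_inv_sub_mul h3, e, Complex.ofReal_one,
    mul_pow, mul_pow, inv_pow, inv_pow]
  field_simp

lemma norm_polar_le (b : ℕ → ℂ) (n : ℕ) (q : ℝ) {s : ℂ} (hs : 1 ≤ |s.im|) :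
    ‖∑ k ∈ Finset.range n, b k / (s - q) ^ (k + 1)‖ ≤ ∑ k ∈ Finset.range n, ‖b k‖ := by
  refine norm_sum_le_of_le _ fun k _ => ?_
  have h : 1 ≤ ‖s - q‖ := by
    have := Complex.abs_im_le_norm (s - q)
    simp only [Complex.sub_im, Complex.ofReal_im, sub_zero] at this
    linarith
  rw [norm_div, norm_pow]
  exact div_le_self (norm_nonneg _) (one_le_pow₀ h)

/-- The remainder `H` in the decomposition of `ζ(s)⁴ζ(s+a)^ℓ` is bounded by the product itself,
away from the real axis. -/
lemma norm_remainder_le {ℓ : ℕ} {a : ℝ} {b b' : ℕ → ℂ} {H : ℂ → ℂ}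
    (h : ∀ s : ℂ, s ≠ 1 → s ≠ ((1 - a : ℝ) : ℂ) →
      riemannZeta s ^ 4 * riemannZeta (s + a) ^ ℓ =
        ∑ k ∈ Finset.range 4, b k / (s - (1 : ℝ)) ^ (k + 1) +
        ∑ k ∈ Finset.range ℓ, b' k / (s - (1 - a : ℝ)) ^ (k + 1) + H s)
    {s : ℂ} (hs : 1 ≤ |s.im|) :
    ‖H s‖ ≤ ‖riemannZeta s‖ ^ 4 * ‖riemannZeta (s + a)‖ ^ ℓ +
      (∑ k ∈ Finset.range 4, ‖b k‖ + ∑ k ∈ Finset.range ℓ, ‖b' k‖) := by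
  have hne : ∀ x : ℝ, s ≠ x := fun x e => by
    rw [e] at hs; simp at hs; linarith
  have e := h s (by simpa using hne 1) (hne _)
  have : H s = riemannZeta s ^ 4 * riemannZeta (s + a) ^ ℓ -
      (∑ k ∈ Finset.range 4, b k / (s - (1 : ℝ)) ^ (k + 1) +
        ∑ k ∈ Finset.range ℓ, b' k / (s - (1 - a : ℝ)) ^ (k + 1)) := by rw [e]; ring
  rw [this, ← norm_pow, ← norm_pow, ← norm_mul]
  exact (norm_sub_le _ _).trans (add_le_add le_rfl ((norm_add_le _ _).trans
    (add_le_add (norm_polar_le b 4 1 hs) (norm_polar_le b' ℓ _ hs))))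

lemma hasMellin_max_one_sub {s : ℂ} (hs : 0 < s.re) :
    HasMellin (fun t : ℝ => ((max (1 - t) 0 : ℝ) : ℂ)) s (1 / (s * (s + 1))) := by
  have h1 := hasMellin_one_Ioc hs
  have h2 := hasMellin_cpow_Ioc 1 (s := s) (by simp; linarith)
  have h := hasMellin_sub h1.1 h2.1
  rw [h1.2, h2.2] at h
  have hs0 : s ≠ 0 := fun e => by simp [e] at hs
  have hs1 : s + 1 ≠ 0 := fun e => by
    have := congrArg Complex.re e
    simp at this; linarith
  have e : 1 / s - 1 / (s + 1) = 1 / (s * (s + 1)) := by field_simp; ring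
  rw [e] at h
  have hc : ∀ t ∈ Set.Ioi (0 : ℝ), (Set.Ioc (0 : ℝ) 1).indicator (fun _ => 1 : ℝ → ℂ) t -
      (Set.Ioc (0 : ℝ) 1).indicator (fun t => (t : ℂ) ^ (1 : ℂ) : ℝ → ℂ) t =
      ((max (1 - t) 0 : ℝ) : ℂ) := by
    intro t ht
    rcases le_or_gt t 1 with h1 | h1
    · have hm : t ∈ Set.Ioc (0 : ℝ) 1 := ⟨ht, h1⟩
      rw [Set.indicator_of_mem hm, Set.indicator_of_mem hm, max_eq_left (by linarith)]
      simp
    · have hm : t ∉ Set.Ioc (0 : ℝ) 1 := fun h => absurd h.2 (not_le.2 h1)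
      rw [Set.indicator_of_notMem hm, Set.indicator_of_notMem hm, max_eq_right (by linarith)]
      simp
  refine ⟨?_, ?_⟩
  · refine h.1.congr_fun (fun t ht => ?_) measurableSet_Ioi
    simp only [hc t ht]
  · rw [← h.2]
    refine setIntegral_congr_fun measurableSet_Ioi fun t ht => ?_
    simp only [hc t ht]

/-- The line of abscissa `2`, on which all Dirichlet series converge absolutely. -/
noncomputable def lineTwo (τ : ℝ) : ℂ := (2 : ℝ) + τ * Complex.I

@[simp] lemma lineTwo_re (τ : ℝ) : (lineTwo τ).re = 2 := by simp [lineTwo]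

@[simp] lemma lineTwo_im (τ : ℝ) : (lineTwo τ).im = τ := by simp [lineTwo]

@[fun_prop] lemma continuous_lineTwo : Continuous lineTwo := by
  unfold lineTwo; fun_prop

/-- The kernel of the smoothed Perron formula. -/
noncomputable def perronKernel (s : ℂ) : ℂ := 1 / (s * (s + 1))

lemma norm_perronKernel_le {s : ℂ} (h : 1 ≤ |s.im|) :
    ‖perronKernel s‖ ≤ 4 * (1 + |s.im|) ^ (-2 : ℝ) := by
  have h1 := Complex.abs_im_le_norm s
  have h2 := Complex.abs_im_le_norm (s + 1)
  simp only [Complex.add_im, Complex.one_im, add_zero] at h2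
  rw [perronKernel, norm_div, norm_mul, norm_one, rpow_neg (by positivity), rpow_two,
    ← div_eq_mul_inv, div_le_div_iff₀ (by nlinarith) (by positivity)]
  nlinarith

lemma differentiableAt_perronKernel {s : ℂ} (hs : 0 < s.re) :
    DifferentiableAt ℂ perronKernel s := by
  have hs0 : s ≠ 0 := fun e => by simp [e] at hs
  have hs1 : s + 1 ≠ 0 := fun e => by
    have := congrArg Complex.re e
    simp at this; linarith
  change DifferentiableAt ℂ (fun s => 1 / (s * (s + 1))) s
  fun_prop (disch := exact mul_ne_zero hs0 hs1)

lemma continuous_perronKernel_lineTwo : Continuous fun τ => perronKernel (lineTwo τ) :=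
  continuous_iff_continuousAt.2 fun τ => ContinuousAt.comp (g := perronKernel) (f := lineTwo)
    (differentiableAt_perronKernel (by simp)).continuousAt continuous_lineTwo.continuousAt

lemma integrable_perronKernel : Integrable fun τ => perronKernel (lineTwo τ) :=
  integrable_of_norm_le_rpow continuous_perronKernel_lineTwo (by norm_num : (1 : ℝ) < 2)
      fun τ h => by
    simpa using norm_perronKernel_le (s := lineTwo τ) (by simpa using h)

lemma norm_ofReal_cpow_lineTwo {u : ℝ} (hu : 0 < u) (τ : ℝ) :
    ‖(u : ℂ) ^ lineTwo τ‖ = u ^ (2 : ℝ) := by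
  rw [Complex.norm_cpow_eq_rpow_re_of_pos hu, lineTwo_re]

lemma norm_ofReal_cpow_neg_lineTwo {u : ℝ} (hu : 0 < u) (τ : ℝ) :
    ‖(u : ℂ) ^ (-lineTwo τ)‖ = u ^ (-2 : ℝ) := by
  rw [Complex.norm_cpow_eq_rpow_re_of_pos hu, Complex.neg_re, lineTwo_re]

lemma perron_formula {u X : ℝ} (hu : 0 < u) (hX : 0 < X) :
    ∫ τ : ℝ, perronKernel (lineTwo τ) * (X : ℂ) ^ lineTwo τ * (u : ℂ) ^ (-lineTwo τ) =
      2 * π * ((max (1 - u / X) 0 : ℝ) : ℂ) := by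
  have hm : ∀ τ : ℝ, mellin (fun t : ℝ => ((max (1 - t) 0 : ℝ) : ℂ)) (lineTwo τ) =
      perronKernel (lineTwo τ) := fun τ => (hasMellin_max_one_sub (by simp)).2
  have h := mellinInv_mellin_eq 2 (fun t : ℝ => ((max (1 - t) 0 : ℝ) : ℂ)) (x := u / X)
    (by positivity) (hasMellin_max_one_sub (by simp)).1
    (integrable_perronKernel.congr (Eventually.of_forall fun τ => (hm τ).symm))
    (by fun_prop)
  rw [← h, mellinInv, Complex.real_smul]
  push_cast
  rw [← mul_assoc, mul_one_div_cancel (by simp [Real.pi_ne_zero]), one_mul]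
  refine integral_congr_ae (Eventually.of_forall fun τ => ?_)
  have e1 := hm τ
  have e2 : (2 : ℂ) + τ * Complex.I = lineTwo τ := by simp [lineTwo]
  simp only [smul_eq_mul]
  rw [e2, e1]
  have e3 : ((u : ℂ) / X) ^ (-lineTwo τ) = (X : ℂ) ^ lineTwo τ * (u : ℂ) ^ (-lineTwo τ) := by
    have : ((u : ℂ) / X) = ((u : ℝ) : ℂ) * ((X⁻¹ : ℝ) : ℂ) := by push_cast; rw [div_eq_mul_inv]
    rw [this, Complex.mul_cpow_ofReal_nonneg hu.le (by positivity), mul_comm]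
    congr 1
    rw [Complex.ofReal_inv, Complex.inv_cpow _ _
        (by rw [Complex.arg_ofReal_of_nonneg hX.le]; exact pi_ne_zero.symm),
      ← Complex.cpow_neg, neg_neg]
  rw [e3]; ring

lemma integrable_perronKernel_mul_cpow {X : ℝ} (hX : 0 < X) :
    Integrable fun τ => perronKernel (lineTwo τ) * (X : ℂ) ^ lineTwo τ := by
  refine integrable_perronKernel.mul_bdd (c := X ^ (2 : ℝ)) ?_
    (Eventually.of_forall fun τ => (norm_ofReal_cpow_lineTwo hX τ).le)
  refine Continuous.aestronglyMeasurable (Continuous.const_cpow (by fun_prop) (Or.inl ?_))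
  exact_mod_cast hX.ne'

lemma hasSum_perron {f : ℕ → ℂ} {F : ℂ → ℂ} (hf : f 0 = 0)
    (hs : Summable fun n : ℕ => ‖f n‖ * (n : ℝ) ^ (-2 : ℝ))
    (hF : ∀ τ, HasSum (fun n : ℕ => f n * (n : ℂ) ^ (-lineTwo τ)) (F (lineTwo τ)))
    {X : ℝ} (hX : 0 < X) :
    HasSum (fun n : ℕ => 2 * π * (f n * ((max (1 - n / X) 0 : ℝ) : ℂ)))
      (∫ τ, perronKernel (lineTwo τ) * (X : ℂ) ^ lineTwo τ * F (lineTwo τ)) := by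
  have hK := integrable_perronKernel_mul_cpow hX
  set K : ℝ → ℂ := fun τ => perronKernel (lineTwo τ) * (X : ℂ) ^ lineTwo τ
  have hn : ∀ n : ℕ, ∀ τ, ‖K τ * (f n * (n : ℂ) ^ (-lineTwo τ))‖ =
      ‖K τ‖ * (‖f n‖ * (n : ℝ) ^ (-2 : ℝ)) := by
    intro n τ
    rcases Nat.eq_zero_or_pos n with rfl | h
    · simp [hf]
    · rw [norm_mul, norm_mul, ← norm_ofReal_cpow_neg_lineTwo (by exact_mod_cast h) τ]
      simp
  have hi : ∀ n : ℕ, Integrable fun τ => K τ * (f n * (n : ℂ) ^ (-lineTwo τ)) := by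
    intro n
    rcases Nat.eq_zero_or_pos n with rfl | h
    · simp [hf]
    · refine hK.mul_bdd (c := ‖f n‖ * (n : ℝ) ^ (-2 : ℝ)) ?_ (Eventually.of_forall fun τ => ?_)
      · refine Continuous.aestronglyMeasurable (continuous_const.mul
          (Continuous.const_cpow (by fun_prop) (Or.inl ?_)))
        exact_mod_cast h.ne'
      · rw [norm_mul, ← norm_ofReal_cpow_neg_lineTwo (by exact_mod_cast h) τ]
        simp
  have h := hasSum_integral_of_summable_integral_norm hi (by
    simp only [hn, integral_mul_const]
    exact hs.mul_left _)
  have e : ∀ τ, ∑' n : ℕ, K τ * (f n * (n : ℂ) ^ (-lineTwo τ)) = K τ * F (lineTwo τ) :=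
    fun τ => ((hF τ).mul_left (K τ)).tsum_eq
  simp only [e] at h
  refine h.congr_fun fun n => ?_
  rcases Nat.eq_zero_or_pos n with rfl | hn
  · simp [hf]
  · have hp := perron_formula (u := n) (by exact_mod_cast hn) hX
    calc 2 * π * (f n * ((max (1 - n / X) 0 : ℝ) : ℂ))
        = f n * (2 * π * ((max (1 - n / X) 0 : ℝ) : ℂ)) := by ring
      _ = ∫ τ, f n * (K τ * (n : ℂ) ^ (-lineTwo τ)) := by
        rw [integral_const_mul, ← hp]; simp [K]
      _ = _ := integral_congr_ae (Eventually.of_forall fun τ => by simp only []; ring)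

lemma integral_perron {g : ℝ → ℂ}
    (hg : IntegrableOn (fun u : ℝ => g u * (u : ℂ) ^ (-2 : ℂ)) (Set.Ioi 1))
    {X : ℝ} (hX : 0 < X) :
    Integrable (fun τ => perronKernel (lineTwo τ) * (X : ℂ) ^ lineTwo τ *
      ∫ u in Set.Ioi (1 : ℝ), g u * (u : ℂ) ^ (-lineTwo τ)) ∧
    ∫ τ, perronKernel (lineTwo τ) * (X : ℂ) ^ lineTwo τ *
        (∫ u in Set.Ioi (1 : ℝ), g u * (u : ℂ) ^ (-lineTwo τ)) =
      2 * π * ∫ u in Set.Ioi (1 : ℝ), g u * ((max (1 - u / X) 0 : ℝ) : ℂ) := by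
  have hK := integrable_perronKernel_mul_cpow hX
  set K : ℝ → ℂ := fun τ => perronKernel (lineTwo τ) * (X : ℂ) ^ lineTwo τ
  have h1 : Integrable (fun p : ℝ × ℝ => K p.1 * (g p.2 * (p.2 : ℂ) ^ (-2 : ℂ)))
      (volume.prod (volume.restrict (Set.Ioi 1))) := hK.mul_prod hg
  have h2 : Integrable (fun p : ℝ × ℝ => K p.1 * (g p.2 * (p.2 : ℂ) ^ (-2 : ℂ)) *
      Complex.exp ((-(p.1 * Real.log p.2) : ℝ) * Complex.I))
      (volume.prod (volume.restrict (Set.Ioi 1))) := by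
    refine h1.mul_bdd (c := 1) (Measurable.aestronglyMeasurable (by fun_prop))
      (Eventually.of_forall fun p => ?_)
    rw [Complex.norm_exp_ofReal_mul_I]
  have hc : ∀ τ : ℝ, ∀ u ∈ Set.Ioi (1 : ℝ), (u : ℂ) ^ (-lineTwo τ) = (u : ℂ) ^ (-2 : ℂ) *
      Complex.exp ((-(τ * Real.log u) : ℝ) * Complex.I) := by
    intro τ u hu
    have hu0 : (0 : ℝ) < u := lt_trans one_pos hu
    have hu' : (u : ℂ) ≠ 0 := by exact_mod_cast hu0.ne'
    have : -lineTwo τ = -2 + (-(τ * Complex.I)) := by simp [lineTwo]; ring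
    rw [this, Complex.cpow_add _ _ hu', Complex.cpow_def_of_ne_zero hu' (-(τ * Complex.I)),
      ← Complex.ofReal_log hu0.le]
    congr 2
    push_cast; ring
  have e1 : ∀ τ, K τ * (∫ u in Set.Ioi (1 : ℝ), g u * (u : ℂ) ^ (-lineTwo τ)) =
      ∫ u in Set.Ioi (1 : ℝ), K τ * (g u * (u : ℂ) ^ (-2 : ℂ)) *
      Complex.exp ((-(τ * Real.log u) : ℝ) * Complex.I) := by
    intro τ
    rw [← integral_const_mul]
    refine setIntegral_congr_fun measurableSet_Ioi fun u hu => ?_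
    rw [hc τ u hu]; ring
  refine ⟨?_, ?_⟩
  · exact h2.integral_prod_left.congr (Eventually.of_forall fun τ => (e1 τ).symm)
  · rw [integral_congr_ae (Eventually.of_forall e1), integral_integral_swap h2,
      ← integral_const_mul]
    refine setIntegral_congr_fun measurableSet_Ioi fun u hu => ?_
    have hu0 : (0 : ℝ) < u := lt_trans one_pos hu
    have hp := perron_formula hu0 hX
    calc ∫ τ, K τ * (g u * (u : ℂ) ^ (-2 : ℂ)) * Complex.exp ((-(τ * Real.log u) : ℝ) * Complex.I)
        = ∫ τ, g u * (K τ * (u : ℂ) ^ (-lineTwo τ)) :=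
          integral_congr_ae (Eventually.of_forall fun τ => by simp only []; rw [hc τ u hu]; ring)
      _ = _ := by rw [integral_const_mul, hp]; ring

/-- The density `u^{q-1} log^k u`, whose Mellin transform has a pole of order `k + 1` at `q`. -/
noncomputable def logDensity (q : ℝ) (k : ℕ) (u : ℝ) : ℝ := u ^ (q - 1) * log u ^ k

lemma logDensity_nonneg (q : ℝ) (k : ℕ) {u : ℝ} (hu : 1 ≤ u) : 0 ≤ logDensity q k u :=
  mul_nonneg (by positivity) (pow_nonneg (log_nonneg hu) k)

lemma continuousOn_logDensity (q : ℝ) (k : ℕ) : ContinuousOn (logDensity q k) (Set.Ici 1) := by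
  unfold logDensity
  have h0 : ∀ x ∈ Set.Ici (1 : ℝ), x ≠ 0 := fun x hx => (lt_of_lt_of_le one_pos hx).ne'
  exact (ContinuousOn.rpow_const (by fun_prop) fun x hx => Or.inl (h0 x hx)).mul
    ((ContinuousOn.log (by fun_prop) h0).pow k)

lemma exists_logDensity_le (k : ℕ) {q η : ℝ} (hq : q ≤ 1) (hη : 0 < η) :
    ∃ C, 0 ≤ C ∧ ∀ u : ℝ, 1 ≤ u → logDensity q k u ≤ C * u ^ η := by
  obtain ⟨C, hC, h⟩ := exists_one_add_log_le (η := η / (k + 1)) (by positivity)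
  refine ⟨C ^ k, by positivity, fun u hu => ?_⟩
  have hl := log_nonneg hu
  have h1 : u ^ (q - 1) ≤ 1 := rpow_le_one_of_one_le_of_nonpos hu (by linarith)
  calc logDensity q k u ≤ 1 * log u ^ k := by unfold logDensity; gcongr
    _ ≤ (C * u ^ (η / (k + 1))) ^ k := by
      rw [one_mul]; gcongr; linarith [h u hu]
    _ = C ^ k * u ^ (η / (k + 1) * k) := by
      rw [mul_pow, ← rpow_natCast (u ^ _), ← rpow_mul (by linarith)]
    _ ≤ C ^ k * u ^ η := by
      refine mul_le_mul_of_nonneg_left (rpow_le_rpow_of_exponent_le hu ?_) (by positivity)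
      rw [div_mul_eq_mul_div, div_le_iff₀ (by positivity)]
      nlinarith

lemma integrableOn_logDensity_mul_cpow (k : ℕ) {q : ℝ} (hq : q ≤ 1) {z : ℂ} (hz : z.re = -2) :
    IntegrableOn (fun u : ℝ => (logDensity q k u : ℂ) * (u : ℂ) ^ z) (Set.Ioi 1) := by
  obtain ⟨C, hC, h⟩ := exists_logDensity_le k hq (η := 1 / 2) (by norm_num)
  have hi : IntegrableOn (fun u : ℝ => C * u ^ (-3 / 2 : ℝ)) (Set.Ioi 1) :=
    (integrableOn_Ioi_rpow_of_lt (by norm_num) one_pos).const_mul C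
  refine Integrable.mono' hi ?_ ?_
  · refine ContinuousOn.aestronglyMeasurable (fun u hu => ?_) measurableSet_Ioi
    have hu0 : (0 : ℝ) < u := lt_trans one_pos hu
    refine ContinuousWithinAt.mul ?_ (ContinuousAt.continuousWithinAt
      (Complex.continuousAt_ofReal_cpow_const u z (Or.inr hu0.ne')))
    exact Complex.continuous_ofReal.continuousAt.comp_continuousWithinAt
      (((continuousOn_logDensity q k) u (Set.mem_Ici.2 (le_of_lt hu))).mono Set.Ioi_subset_Ici_self)
  · refine (ae_restrict_iff' measurableSet_Ioi).2 (Eventually.of_forall fun u hu => ?_)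
    have hu0 : (0 : ℝ) < u := lt_trans one_pos hu
    have hu1 : (1 : ℝ) ≤ u := le_of_lt hu
    rw [norm_mul, Complex.norm_real, norm_of_nonneg (logDensity_nonneg q k hu1),
      Complex.norm_cpow_eq_rpow_re_of_pos hu0, hz]
    calc logDensity q k u * u ^ (-2 : ℝ) ≤ C * u ^ (1 / 2 : ℝ) * u ^ (-2 : ℝ) := by
          gcongr; exact h u hu1
      _ = _ := by rw [mul_assoc, ← rpow_add hu0]; norm_num

lemma integrableOn_pow_mul_cexp (k : ℕ) {w : ℂ} (hw : 0 < w.re) :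
    IntegrableOn (fun x : ℝ => (x : ℂ) ^ k * Complex.exp (-w * x)) (Set.Ioi 0) := by
  have h := integrableOn_rpow_mul_exp_neg_mul_rpow (s := k) (p := 1) (b := w.re)
    (by linarith [Nat.cast_nonneg (α := ℝ) k]) one_pos hw
  refine Integrable.mono h (Continuous.aestronglyMeasurable (by fun_prop)) ?_
  refine (ae_restrict_iff' measurableSet_Ioi).2 (Eventually.of_forall fun x hx => le_of_eq ?_)
  rw [norm_mul, norm_mul, norm_pow, Complex.norm_exp, Complex.norm_real]
  simp

lemma integral_pow_mul_cexp (k : ℕ) {w : ℂ} (hw : 0 < w.re) :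
    ∫ x in Set.Ioi (0 : ℝ), (x : ℂ) ^ k * Complex.exp (-w * x) = k.factorial / w ^ (k + 1) := by
  have hw0 : w ≠ 0 := fun e => by simp [e] at hw
  have hd : ∀ k : ℕ, ∀ x : ℝ, HasDerivAt (fun x : ℝ => (x : ℂ) ^ k * Complex.exp (-w * x))
      (k * ((x : ℂ) ^ (k - 1) * Complex.exp (-w * x)) -
        w * ((x : ℂ) ^ k * Complex.exp (-w * x))) x := by
    intro k x
    have h0 : HasDerivAt (fun z : ℂ => z ^ k * Complex.exp (-w * z))
        (k * (x : ℂ) ^ (k - 1) * Complex.exp (-w * x) +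
          (x : ℂ) ^ k * (Complex.exp (-w * x) * (-w * 1))) (x : ℂ) :=
      (hasDerivAt_pow k (x : ℂ)).mul (((hasDerivAt_id (x : ℂ)).const_mul (-w)).cexp)
    exact h0.comp_ofReal.congr_deriv (by ring)
  have ht : ∀ k : ℕ, Tendsto (fun x : ℝ => (x : ℂ) ^ k * Complex.exp (-w * x)) atTop (nhds 0) := by
    intro k
    rw [tendsto_zero_iff_norm_tendsto_zero]
    refine (tendsto_rpow_mul_exp_neg_mul_atTop_nhds_zero k w.re hw).congr' ?_
    filter_upwards [eventually_gt_atTop 0] with x hx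
    rw [norm_mul, norm_pow, Complex.norm_exp, Complex.norm_real, norm_of_nonneg hx.le]
    simp
  have hcont : ∀ k : ℕ, Continuous fun x : ℝ => (x : ℂ) ^ k * Complex.exp (-w * x) :=
    fun k => by fun_prop
  induction k with
  | zero =>
    have h := integral_Ioi_of_hasDerivAt_of_tendsto (hcont 0).continuousWithinAt
      (fun x _ => hd 0 x)
      (by simpa [IntegrableOn] using (integrableOn_pow_mul_cexp 0 hw).const_mul (-w)) (ht 0)
    simp only [Nat.cast_zero, zero_mul, zero_sub, integral_neg, integral_const_mul,
      Complex.ofReal_zero, mul_zero, Complex.exp_zero, mul_one, pow_zero, neg_inj] at h ⊢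
    rw [Nat.factorial_zero, Nat.cast_one, zero_add, pow_one, eq_div_iff hw0, mul_comm, h]
  | succ k ih =>
    have i1 := (integrableOn_pow_mul_cexp k hw).const_mul ((k + 1 : ℕ) : ℂ)
    have i2 := (integrableOn_pow_mul_cexp (k + 1) hw).const_mul w
    have h := integral_Ioi_of_hasDerivAt_of_tendsto (hcont (k + 1)).continuousWithinAt
      (fun x _ => hd (k + 1) x) (i1.sub i2) (ht (k + 1))
    rw [integral_sub (by exact i1) (by exact i2)] at h
    simp only [Nat.add_sub_cancel, integral_const_mul, ih, Complex.ofReal_zero, zero_mul, sub_zero,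
      zero_pow (Nat.succ_ne_zero k)] at h
    rw [sub_eq_zero] at h
    rw [eq_div_iff (pow_ne_zero _ hw0), pow_succ w, Nat.factorial_succ]
    rw [mul_comm (w ^ (k + 1)), ← mul_assoc, mul_comm _ w, ← h]
    push_cast
    field_simp

lemma integral_logDensity_mul_cpow (q : ℝ) (k : ℕ) {s : ℂ} (hs : q < s.re) :
    ∫ u in Set.Ioi (1 : ℝ), (logDensity q k u : ℂ) * (u : ℂ) ^ (-s) =
      (k.factorial : ℂ) / (s - q) ^ (k + 1) := by
  have hi : Real.exp '' Set.Ioi 0 = Set.Ioi 1 := by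
    ext u
    constructor
    · rintro ⟨x, hx, rfl⟩
      exact one_lt_exp_iff.2 hx
    · intro hu
      have hu0 : (0 : ℝ) < u := lt_trans one_pos hu
      exact ⟨log u, log_pos hu, exp_log hu0⟩
  have h := integral_image_eq_integral_abs_deriv_smul (s := Set.Ioi (0 : ℝ)) measurableSet_Ioi
    (fun x _ => (Real.hasDerivAt_exp x).hasDerivWithinAt) Real.exp_injective.injOn
    (fun u : ℝ => (logDensity q k u : ℂ) * (u : ℂ) ^ (-s))
  rw [hi] at h
  rw [h, ← integral_pow_mul_cexp k (w := s - q) (by simpa using hs)]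
  refine setIntegral_congr_fun measurableSet_Ioi fun x hx => ?_
  simp only [logDensity, Real.log_exp, Complex.real_smul, abs_exp]
  rw [← Real.exp_mul, Complex.cpow_def_of_ne_zero (by exact_mod_cast (Real.exp_pos x).ne'),
    ← Complex.ofReal_log (Real.exp_pos x).le, Real.log_exp]
  push_cast
  rw [show ∀ A B C D : ℂ, A * (B * C * D) = C * (A * B * D) by intros; ring,
    ← Complex.exp_add, ← Complex.exp_add]
  congr 2
  ring

lemma exists_integral_logDensity {q : ℝ} (hq : 0 < q) {m : ℕ} : ∀ k : ℕ, k < m →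
    ∃ p ∈ Polynomial.degreeLT ℝ m, ∃ e : ℝ, ∀ X : ℝ, 1 ≤ X →
      ∫ u in (1 : ℝ)..X, logDensity q k u = X ^ q * p.eval (log X) + e := by
  have hii : ∀ k : ℕ, ∀ X : ℝ, 1 ≤ X → IntervalIntegrable (logDensity q k) volume 1 X := by
    intro k X hX
    refine ContinuousOn.intervalIntegrable ((continuousOn_logDensity q k).mono ?_)
    rw [Set.uIcc_of_le hX]
    exact Set.Icc_subset_Ici_self
  have hd : ∀ k : ℕ, ∀ u : ℝ, 0 < u → HasDerivAt (fun u : ℝ => u ^ q * log u ^ k)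
      (q * logDensity q k u + k * logDensity q (k - 1) u) u := by
    intro k u hu
    have h := (hasDerivAt_rpow_const (p := q) (Or.inl hu.ne')).mul ((hasDerivAt_log hu.ne').pow k)
    refine h.congr_deriv ?_
    have : u ^ q = u ^ (q - 1) * u := by rw [← rpow_add_one hu.ne']; simp
    unfold logDensity
    simp only [Pi.pow_apply]
    rw [this]
    field_simp
  intro k
  induction k with
  | zero =>
    intro hm
    refine ⟨Polynomial.C (1 / q), ?_, -(1 / q), fun X hX => ?_⟩
    · rw [Polynomial.mem_degreeLT]
      exact lt_of_le_of_lt Polynomial.degree_C_le (by exact_mod_cast hm)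
    · have h := intervalIntegral.integral_eq_sub_of_hasDerivAt (a := 1) (b := X) (fun u hu => by
        rw [Set.uIcc_of_le hX] at hu
        exact hd 0 u (by linarith [hu.1])) (by
        simpa using (hii 0 X hX).const_mul q)
      simp only [Nat.cast_zero, zero_mul, add_zero, intervalIntegral.integral_const_mul, pow_zero,
        mul_one, one_rpow] at h
      rw [Polynomial.eval_C]
      field_simp
      linarith
  | succ k ih =>
    intro hm
    obtain ⟨p, hp, e, h0⟩ := ih (by omega)
    refine ⟨(1 / q) • (Polynomial.X ^ (k + 1) : Polynomial ℝ) - ((k + 1 : ℝ) / q) • p, ?_,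
      -((k + 1) / q * e), fun X hX => ?_⟩
    · refine Submodule.sub_mem _ (Submodule.smul_mem _ _ ?_) (Submodule.smul_mem _ _ hp)
      rw [Polynomial.mem_degreeLT]
      exact lt_of_le_of_lt (Polynomial.degree_X_pow_le _) (by exact_mod_cast hm)
    · have i1 : IntervalIntegrable (fun u => q * logDensity q (k + 1) u) volume 1 X :=
        (hii (k + 1) X hX).const_mul q
      have i2 : IntervalIntegrable (fun u => ((k + 1 : ℕ) : ℝ) * logDensity q k u) volume 1 X :=
        (hii k X hX).const_mul _
      have h := intervalIntegral.integral_eq_sub_of_hasDerivAt (a := 1) (b := X) (fun u hu => by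
        rw [Set.uIcc_of_le hX] at hu
        exact hd (k + 1) u (by linarith [hu.1])) (by
        simpa using i1.add i2)
      simp only [Nat.add_sub_cancel] at h
      rw [intervalIntegral.integral_add i1 i2, intervalIntegral.integral_const_mul,
        intervalIntegral.integral_const_mul, h0 X hX] at h
      simp only [log_one, one_rpow, zero_pow (Nat.succ_ne_zero k), mul_zero, sub_zero,
        Nat.cast_add, Nat.cast_one] at h
      simp only [Polynomial.eval_sub, Polynomial.eval_smul, Polynomial.eval_pow,
        Polynomial.eval_X, smul_eq_mul]
      field_simp
      linarith

/-- The density of the main term attached to a polar part with coefficients `b`, `b'` at `1`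
and `1 - a`. -/
noncomputable def polarDensity (ℓ : ℕ) (a : ℝ) (b b' : ℕ → ℂ) (u : ℝ) : ℂ :=
  ∑ k ∈ Finset.range 4, b k / k.factorial * (logDensity 1 k u : ℂ) +
    ∑ k ∈ Finset.range ℓ, b' k / k.factorial * (logDensity (1 - a) k u : ℂ)

lemma continuousOn_polarDensity (ℓ : ℕ) (a : ℝ) (b b' : ℕ → ℂ) :
    ContinuousOn (polarDensity ℓ a b b') (Set.Ici 1) := by
  have h : ∀ (q : ℝ) (k : ℕ) (z : ℂ),
      ContinuousOn (fun u => z * (logDensity q k u : ℂ)) (Set.Ici 1) := fun q k z =>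
    continuousOn_const.mul (Complex.continuous_ofReal.comp_continuousOn
        (continuousOn_logDensity q k))
  unfold polarDensity
  exact (continuousOn_finsetSum _ fun k _ => h 1 k _).add
    (continuousOn_finsetSum _ fun k _ => h (1 - a) k _)

lemma exists_norm_polarDensity_le (ℓ : ℕ) {a : ℝ} (ha : 0 ≤ a) (b b' : ℕ → ℂ) {η : ℝ} (hη : 0 < η) :
    ∃ C, 0 ≤ C ∧ ∀ u : ℝ, 1 ≤ u → ‖polarDensity ℓ a b b' u‖ ≤ C * u ^ η := by
  have h : ∀ q : ℝ, q ≤ 1 → ∀ (m : ℕ) (z : ℕ → ℂ), ∃ C, 0 ≤ C ∧ ∀ u : ℝ, 1 ≤ u →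
      ‖∑ k ∈ Finset.range m, z k * (logDensity q k u : ℂ)‖ ≤ C * u ^ η := by
    intro q hq m z
    choose C hC hb using fun k => exists_logDensity_le k hq hη
    refine ⟨∑ k ∈ Finset.range m, ‖z k‖ * C k,
      Finset.sum_nonneg fun k _ => mul_nonneg (norm_nonneg _) (hC k), fun u hu => ?_⟩
    rw [Finset.sum_mul]
    refine (norm_sum_le _ _).trans (Finset.sum_le_sum fun k _ => ?_)
    rw [norm_mul, Complex.norm_real, norm_of_nonneg (logDensity_nonneg q k hu), mul_assoc]
    exact mul_le_mul_of_nonneg_left (hb k u hu) (norm_nonneg _)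
  obtain ⟨C, hC, h1⟩ := h 1 le_rfl 4 fun k => b k / k.factorial
  obtain ⟨C', hC', h2⟩ := h (1 - a) (by linarith) ℓ fun k => b' k / k.factorial
  refine ⟨C + C', by positivity, fun u hu => ?_⟩
  rw [add_mul]
  exact (norm_add_le _ _).trans (add_le_add (h1 u hu) (h2 u hu))

lemma integral_polarDensity_mul_cpow (ℓ : ℕ) {a : ℝ} (ha : 0 ≤ a) (b b' : ℕ → ℂ) {s : ℂ}
    (hs : s.re = 2) :
    IntegrableOn (fun u : ℝ => polarDensity ℓ a b b' u * (u : ℂ) ^ (-s)) (Set.Ioi 1) ∧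
    ∫ u in Set.Ioi (1 : ℝ), polarDensity ℓ a b b' u * (u : ℂ) ^ (-s) =
      ∑ k ∈ Finset.range 4, b k / (s - (1 : ℝ)) ^ (k + 1) +
        ∑ k ∈ Finset.range ℓ, b' k / (s - (1 - a : ℝ)) ^ (k + 1) := by
  have h : ∀ q : ℝ, q ≤ 1 → ∀ (m : ℕ) (z : ℕ → ℂ),
      IntegrableOn (fun u : ℝ => ∑ k ∈ Finset.range m,
        z k / k.factorial * ((logDensity q k u : ℂ) * (u : ℂ) ^ (-s))) (Set.Ioi 1) ∧
      ∫ u in Set.Ioi (1 : ℝ), ∑ k ∈ Finset.range m,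
        z k / k.factorial * ((logDensity q k u : ℂ) * (u : ℂ) ^ (-s)) =
        ∑ k ∈ Finset.range m, z k / (s - q) ^ (k + 1) := by
    intro q hq m z
    have hi : ∀ k ∈ Finset.range m, Integrable (fun u : ℝ =>
        z k / k.factorial * ((logDensity q k u : ℂ) * (u : ℂ) ^ (-s)))
        (volume.restrict (Set.Ioi 1)) := fun k _ =>
      (integrableOn_logDensity_mul_cpow k hq (z := -s) (by simp [hs])).const_mul _
    refine ⟨integrable_finsetSum _ hi, ?_⟩
    rw [integral_finsetSum _ hi]
    refine Finset.sum_congr rfl fun k _ => ?_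
    rw [integral_const_mul, integral_logDensity_mul_cpow q k (by linarith)]
    have : (k.factorial : ℂ) ≠ 0 := by exact_mod_cast k.factorial_ne_zero
    field_simp
  obtain ⟨i1, e1⟩ := h 1 le_rfl 4 b
  obtain ⟨i2, e2⟩ := h (1 - a) (by linarith) ℓ b'
  have e : (fun u : ℝ => polarDensity ℓ a b b' u * (u : ℂ) ^ (-s)) = fun u : ℝ =>
      ∑ k ∈ Finset.range 4, b k / k.factorial * ((logDensity 1 k u : ℂ) * (u : ℂ) ^ (-s)) +
      ∑ k ∈ Finset.range ℓ, b' k / k.factorial *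
          ((logDensity (1 - a) k u : ℂ) * (u : ℂ) ^ (-s)) := by
    funext u
    simp only [polarDensity, add_mul, Finset.sum_mul, mul_assoc]
  rw [e]
  exact ⟨i1.add i2, by rw [integral_add i1 i2, e1, e2]⟩

lemma exists_re_integral_polarDensity (ℓ : ℕ) {a : ℝ} (ha : a < 1) (b b' : ℕ → ℂ) :
    ∃ (c : Fin 4 → ℝ) (c' : Fin ℓ → ℝ) (e : ℝ), ∀ X : ℝ, 1 ≤ X →
      (∫ u in (1 : ℝ)..X, polarDensity ℓ a b b' u).re =
        X * ∑ k : Fin 4, c k * log X ^ (k : ℕ) + X ^ (1 - a) * ∑ k : Fin ℓ, c' k * log X ^ (k : ℕ) +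
          e := by
  have hii : ∀ (q : ℝ) (k : ℕ) (z : ℂ) (X : ℝ), 1 ≤ X →
      ContinuousOn (fun u => z * (logDensity q k u : ℂ)) (Set.uIcc 1 X) := by
    intro q k z X hX
    refine continuousOn_const.mul (Complex.continuous_ofReal.comp_continuousOn
      ((continuousOn_logDensity q k).mono ?_))
    rw [Set.uIcc_of_le hX]
    exact Set.Icc_subset_Ici_self
  have h : ∀ q : ℝ, 0 < q → ∀ (m : ℕ) (z : ℕ → ℂ), ∃ (c : Fin m → ℝ) (e : ℝ), ∀ X : ℝ, 1 ≤ X →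
      IntervalIntegrable (fun u => ∑ k ∈ Finset.range m, z k * (logDensity q k u : ℂ)) volume 1 X ∧
      (∫ u in (1 : ℝ)..X, ∑ k ∈ Finset.range m, z k * (logDensity q k u : ℂ)).re =
        X ^ q * ∑ k : Fin m, c k * log X ^ (k : ℕ) + e := by
    intro q hq m z
    have hex : ∀ k : ℕ, ∃ p ∈ Polynomial.degreeLT ℝ m, ∃ e : ℝ, k < m → ∀ X : ℝ, 1 ≤ X →
        ∫ u in (1 : ℝ)..X, logDensity q k u = X ^ q * p.eval (log X) + e := by
      intro k
      by_cases hk : k < m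
      · obtain ⟨p, hp, e, h⟩ := exists_integral_logDensity hq k hk
        exact ⟨p, hp, e, fun _ => h⟩
      · exact ⟨0, Submodule.zero_mem _, 0, fun h => absurd h hk⟩
    choose p hp e he using hex
    have hP : ∑ k ∈ Finset.range m, (z k).re • p k ∈ Polynomial.degreeLT ℝ m :=
      Submodule.sum_mem _ fun k _ => Submodule.smul_mem _ _ (hp k)
    refine ⟨fun k => (∑ k ∈ Finset.range m, (z k).re • p k).coeff k,
      ∑ k ∈ Finset.range m, (z k).re * e k, fun X hX => ?_⟩
    have hi : ∀ k ∈ Finset.range m, IntervalIntegrable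
        (fun u => z k * (logDensity q k u : ℂ)) volume 1 X := fun k _ =>
      (hii q k (z k) X hX).intervalIntegrable
    refine ⟨(continuousOn_finsetSum _ fun k _ => hii q k (z k) X hX).intervalIntegrable, ?_⟩
    rw [intervalIntegral.integral_finsetSum hi, Complex.re_sum,
      Fin.sum_univ_eq_sum_range (fun k => (∑ k ∈ Finset.range m, (z k).re • p k).coeff k *
          log X ^ k) m]
    have hev : ∑ i ∈ Finset.range m, (∑ k ∈ Finset.range m, (z k).re • p k).coeff i * log X ^ i =
        (∑ k ∈ Finset.range m, (z k).re • p k).eval (log X) := by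
      rcases Nat.eq_zero_or_pos m with rfl | hm
      · simp
      · refine (Polynomial.eval_eq_sum_range' ?_ _).symm
        rw [Polynomial.mem_degreeLT] at hP
        by_cases h0 : ∑ k ∈ Finset.range m, (z k).re • p k = 0
        · rw [h0]; simpa using hm
        · exact (Polynomial.natDegree_lt_iff_degree_lt h0).2 hP
    rw [hev, Polynomial.eval_finsetSum, Finset.mul_sum, ← Finset.sum_add_distrib]
    refine Finset.sum_congr rfl fun k hk => ?_
    rw [intervalIntegral.integral_const_mul, intervalIntegral.integral_ofReal,
      he k (Finset.mem_range.1 hk) X hX, Complex.re_mul_ofReal, Polynomial.eval_smul, smul_eq_mul]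
    ring
  obtain ⟨c, e, h1⟩ := h 1 one_pos 4 fun k => b k / k.factorial
  obtain ⟨c', e', h2⟩ := h (1 - a) (by linarith) ℓ fun k => b' k / k.factorial
  refine ⟨c, c', e + e', fun X hX => ?_⟩
  obtain ⟨i1, e1⟩ := h1 X hX
  obtain ⟨i2, e2⟩ := h2 X hX
  unfold polarDensity
  rw [intervalIntegral.integral_add i1 i2, Complex.add_re, e1, e2, rpow_one]
  ring

lemma smoothed_sum_sub_integral {ℓ : ℕ} {a : ℝ} (ha : 0 ≤ a) {b b' : ℕ → ℂ} {H : ℂ → ℂ}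
    (hdec : ∀ s : ℂ, s ≠ 1 → s ≠ ((1 - a : ℝ) : ℂ) → riemannZeta s ^ 4 * riemannZeta (s + a) ^ ℓ =
      ∑ k ∈ Finset.range 4, b k / (s - (1 : ℝ)) ^ (k + 1) +
        ∑ k ∈ Finset.range ℓ, b' k / (s - (1 - a : ℝ)) ^ (k + 1) + H s)
    {Z : ℝ} (hZ : 0 < Z)
    (hH : Integrable fun τ => perronKernel (lineTwo τ) * (Z : ℂ) ^ lineTwo τ * H (lineTwo τ))
    {M : ℕ} (hM : 1 ≤ M) (hZM : Z ≤ M) :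
    ∑ n ∈ Finset.Icc 1 M, (dWeighted ℓ a n : ℂ) * ((max (Z - n) 0 : ℝ) : ℂ) -
      ∫ u in (1 : ℝ)..M, polarDensity ℓ a b b' u * ((max (Z - u) 0 : ℝ) : ℂ) =
      (2 * (π : ℂ))⁻¹ * (Z * ∫ τ, perronKernel (lineTwo τ) * (Z : ℂ) ^ lineTwo τ * H
          (lineTwo τ)) := by
  have hZ0 : (Z : ℂ) ≠ 0 := by exact_mod_cast hZ.ne'
  have hpi : (π : ℂ) ≠ 0 := by exact_mod_cast pi_ne_zero
  have hmax : ∀ u : ℝ, ((max (Z - u) 0 : ℝ) : ℂ) = Z * ((max (1 - u / Z) 0 : ℝ) : ℂ) := by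
    intro u
    rw [← Complex.ofReal_mul, mul_max_of_nonneg _ _ hZ.le, mul_zero, mul_sub, mul_one,
      mul_div_cancel₀ _ hZ.ne']
  have hmax0 : ∀ u : ℝ, Z ≤ u → max (1 - u / Z) 0 = 0 := fun u hu =>
    max_eq_right (by rw [sub_nonpos, le_div_iff₀ hZ]; linarith)
  have hf0 : (dWeighted ℓ a 0 : ℂ) = 0 := by simp [dWeighted]
  obtain ⟨C, hC, hfC⟩ := exists_dWeighted_le ℓ ha (η := 1 / 2) (by norm_num)
  have hsum : Summable fun n : ℕ => ‖(dWeighted ℓ a n : ℂ)‖ * (n : ℝ) ^ (-2 : ℝ) := by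
    refine Summable.of_nonneg_of_le (fun n => by positivity) (fun n => ?_)
      ((Real.summable_nat_rpow (p := -3 / 2)).2 (by norm_num) |>.mul_left C)
    rcases Nat.eq_zero_or_pos n with rfl | hn
    · rw [hf0]; simp
    · rw [Complex.norm_real, norm_of_nonneg (dWeighted_nonneg ℓ a n)]
      have hn0 : (0 : ℝ) < n := by exact_mod_cast hn
      calc dWeighted ℓ a n * (n : ℝ) ^ (-2 : ℝ) ≤
          C * (n : ℝ) ^ (1 / 2 : ℝ) * (n : ℝ) ^ (-2 : ℝ) := by
            gcongr; exact hfC n hn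
        _ = _ := by rw [mul_assoc, ← rpow_add hn0]; norm_num
  have hF := hasSum_perron (F := fun s => riemannZeta s ^ 4 * riemannZeta (s + a) ^ ℓ) hf0 hsum
    (fun τ => LSeriesHasSum.hasSum_mul_cpow hf0
      (LSeriesHasSum_dWeighted ℓ ha (s := lineTwo τ) (by simp))) hZ
  have h1 := hF.unique (hasSum_sum_of_ne_finset_zero (s := Finset.Icc 1 M) fun n hn => by
    rcases Nat.eq_zero_or_pos n with rfl | h
    · rw [hf0]; simp
    · have : M < n := by
        rw [Finset.mem_Icc] at hn
        omega
      rw [hmax0 n (hZM.trans (by exact_mod_cast this.le))]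
      simp)
  obtain ⟨i2, h2⟩ := integral_perron (g := polarDensity ℓ a b b')
    (integral_polarDensity_mul_cpow ℓ ha b b' (s := 2) (by simp)).1 hZ
  have e3 : ∀ τ, perronKernel (lineTwo τ) * (Z : ℂ) ^ lineTwo τ *
      (riemannZeta (lineTwo τ) ^ 4 * riemannZeta (lineTwo τ + a) ^ ℓ) =
      perronKernel (lineTwo τ) * (Z : ℂ) ^ lineTwo τ *
      (∫ u in Set.Ioi (1 : ℝ), polarDensity ℓ a b b' u * (u : ℂ) ^ (-lineTwo τ)) +
      perronKernel (lineTwo τ) * (Z : ℂ) ^ lineTwo τ * H (lineTwo τ) := by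
    intro τ
    have hne : ∀ q : ℝ, q ≤ 1 → lineTwo τ ≠ q := fun q hq e => by
      have := congrArg Complex.re e
      simp at this; linarith
    rw [(integral_polarDensity_mul_cpow ℓ ha b b' (s := lineTwo τ) (by simp)).2,
      hdec _ (by simpa using hne 1 le_rfl) (hne (1 - a) (by linarith))]
    ring
  simp only [e3] at h1
  rw [integral_add i2 hH, h2] at h1
  have e4 : ∫ u in Set.Ioi (1 : ℝ), polarDensity ℓ a b b' u * ((max (1 - u / Z) 0 : ℝ) : ℂ) =
      ∫ u in (1 : ℝ)..M, polarDensity ℓ a b b' u * ((max (1 - u / Z) 0 : ℝ) : ℂ) := by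
    rw [intervalIntegral.integral_of_le (by exact_mod_cast hM)]
    refine setIntegral_eq_of_subset_of_forall_sdiff_eq_zero measurableSet_Ioi
      Set.Ioc_subset_Ioi_self fun u hu => ?_
    have : (M : ℝ) < u := not_le.1 fun h => hu.2 ⟨hu.1, h⟩
    rw [hmax0 u (hZM.trans this.le)]
    simp
  rw [e4] at h1
  simp only [hmax]
  rw [← Finset.mul_sum] at h1
  have e5 : ∀ u : ℝ, polarDensity ℓ a b b' u * (Z * ((max (1 - u / Z) 0 : ℝ) : ℂ)) =
      Z * (polarDensity ℓ a b b' u * ((max (1 - u / Z) 0 : ℝ) : ℂ)) := fun u => by ring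
  have e6 : ∀ n : ℕ, (dWeighted ℓ a n : ℂ) * (Z * ((max (1 - n / Z) 0 : ℝ) : ℂ)) =
      Z * ((dWeighted ℓ a n : ℂ) * ((max (1 - n / Z) 0 : ℝ) : ℂ)) := fun n => by ring
  have h7 := eq_sub_of_add_eq' h1
  simp only [e5, e6]
  rw [intervalIntegral.integral_const_mul, ← Finset.mul_sum, h7]
  field_simp

lemma exists_norm_remainder_strip_le {ℓ : ℕ} (hℓ : ℓ ≤ 12) {a : ℝ} (ha : 0.478287 ≤ a) (ha' : a ≤ 1)
    {b b' : ℕ → ℂ} {H : ℂ → ℂ}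
    (hdec : ∀ s : ℂ, s ≠ 1 → s ≠ ((1 - a : ℝ) : ℂ) → riemannZeta s ^ 4 * riemannZeta (s + a) ^ ℓ =
      ∑ k ∈ Finset.range 4, b k / (s - (1 : ℝ)) ^ (k + 1) +
        ∑ k ∈ Finset.range ℓ, b' k / (s - (1 - a : ℝ)) ^ (k + 1) + H s) :
    ∃ C, 0 ≤ C ∧ ∀ σ t : ℝ, 1 / 2 ≤ σ → σ ≤ 2 → 1 ≤ |t| →
      ‖H (σ + t * Complex.I)‖ ≤ C * (1 + |t|) ^ (0.968 : ℝ) := by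
  obtain ⟨C₁, hC₁, h1⟩ := exists_norm_riemannZeta_le
  obtain ⟨C₂, hC₂, h2⟩ := exists_norm_riemannZeta_pow_twelve_le
  set B := ∑ k ∈ Finset.range 4, ‖b k‖ + ∑ k ∈ Finset.range ℓ, ‖b' k‖ with hBdef
  have hB0 : 0 ≤ B := by positivity
  refine ⟨C₁ ^ 4 * (1 + C₂) + B, by positivity, fun σ t hσ hσ' ht => ?_⟩
  have ht0 : 0 < |t| := by linarith
  have h := norm_remainder_le hdec (s := σ + t * Complex.I) (by simpa using ht)
  rw [← hBdef] at h
  have e : (σ : ℂ) + t * Complex.I + a = ((σ + a : ℝ) : ℂ) + t * Complex.I := by push_cast; ring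
  rw [e] at h
  have z1 : ‖riemannZeta (σ + t * Complex.I)‖ ^ 4 ≤ C₁ ^ 4 * |t| ^ (0.68 : ℝ) := by
    calc ‖riemannZeta (σ + t * Complex.I)‖ ^ 4 ≤ (C₁ * |t| ^ (0.17 : ℝ)) ^ 4 := by
          gcongr; exact h1 σ t hσ (by linarith) ht
      _ = _ := by
        rw [mul_pow, ← rpow_natCast (|t| ^ (0.17 : ℝ)), ← rpow_mul ht0.le]
        norm_num
  have z2 : ‖riemannZeta ((σ + a : ℝ) + t * Complex.I)‖ ^ ℓ ≤ (1 + C₂) * |t| ^ (0.288 : ℝ) := by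
    have hb := h2 (σ + a) t (by linarith) (by linarith) ht
    have hp : 1 ≤ |t| ^ (0.288 : ℝ) := one_le_rpow ht (by norm_num)
    rcases le_total ‖riemannZeta ((σ + a : ℝ) + t * Complex.I)‖ 1 with hz | hz
    · have := pow_le_one₀ (norm_nonneg _) hz (n := ℓ)
      nlinarith
    · have := pow_le_pow_right₀ hz hℓ
      nlinarith
  have hp : 1 ≤ |t| ^ (0.968 : ℝ) := one_le_rpow ht (by norm_num)
  calc ‖H (σ + t * Complex.I)‖
      ≤ C₁ ^ 4 * |t| ^ (0.68 : ℝ) * ((1 + C₂) * |t| ^ (0.288 : ℝ)) + B * 1 := by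
        rw [mul_one]
        exact h.trans (by gcongr)
    _ ≤ C₁ ^ 4 * |t| ^ (0.68 : ℝ) * ((1 + C₂) * |t| ^ (0.288 : ℝ)) + B * |t| ^ (0.968 : ℝ) := by
        gcongr
    _ = (C₁ ^ 4 * (1 + C₂) + B) * |t| ^ (0.968 : ℝ) := by
        rw [show (0.968 : ℝ) = 0.68 + 0.288 by norm_num, rpow_add ht0]; ring
    _ ≤ _ := by gcongr; linarith

lemma integral_remainder_shift {H : ℂ → ℂ} (hH : Differentiable ℂ H) {C : ℝ}
    (hb : ∀ σ t : ℝ, 1 / 2 ≤ σ → σ ≤ 2 → 1 ≤ |t| →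
      ‖H (σ + t * Complex.I)‖ ≤ C * (1 + |t|) ^ (0.968 : ℝ))
    {σ : ℝ} (hσ : 1 / 2 ≤ σ) (hσ' : σ ≤ 2) {Z : ℝ} (hZ : 0 < Z) :
    (Integrable fun τ => perronKernel (lineTwo τ) * (Z : ℂ) ^ lineTwo τ * H (lineTwo τ)) ∧
    (Integrable fun τ : ℝ => perronKernel (σ + τ * Complex.I) * (Z : ℂ) ^ (σ + τ * Complex.I) *
      H (σ + τ * Complex.I)) ∧
    ∫ τ, perronKernel (lineTwo τ) * (Z : ℂ) ^ lineTwo τ * H (lineTwo τ) =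
      ∫ τ : ℝ, perronKernel (σ + τ * Complex.I) * (Z : ℂ) ^ (σ + τ * Complex.I) *
        H (σ + τ * Complex.I) := by
  set g : ℂ → ℂ := fun s => perronKernel s * (Z : ℂ) ^ s * H s with hg
  have hZ0 : (Z : ℂ) ≠ 0 := by exact_mod_cast hZ.ne'
  have hgd : ∀ s : ℂ, 0 < s.re → DifferentiableAt ℂ g s := fun s hs =>
    ((differentiableAt_perronKernel hs).mul
      (differentiableAt_id.const_cpow (Or.inl hZ0))).mul (hH s)
  have hB : ∀ x τ : ℝ, σ ≤ x → x ≤ 2 → 1 ≤ |τ| →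
      ‖g (x + τ * Complex.I)‖ ≤ 4 * (1 + Z) ^ (2 : ℝ) * C * (1 + |τ|) ^ (-1.032 : ℝ) := by
    intro x τ hx hx' hτ
    have k1 := norm_perronKernel_le (s := x + τ * Complex.I) (by simpa using hτ)
    have k2 := hb x τ (hσ.trans hx) hx' hτ
    have k3 : ‖(Z : ℂ) ^ (x + τ * Complex.I)‖ ≤ (1 + Z) ^ (2 : ℝ) := by
      rw [Complex.norm_cpow_eq_rpow_re_of_pos hZ]
      simp only [Complex.add_re, Complex.ofReal_re, Complex.mul_re, Complex.I_re, mul_zero,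
        Complex.ofReal_im, Complex.I_im, mul_one, sub_self, add_zero]
      exact (rpow_le_rpow hZ.le (by linarith) (by linarith)).trans
        (rpow_le_rpow_of_exponent_le (by linarith) hx')
    simp only [Complex.add_im, Complex.ofReal_im, Complex.mul_im, Complex.ofReal_re,
      Complex.I_im, mul_one, Complex.I_re, mul_zero, add_zero, zero_add] at k1
    calc ‖g (x + τ * Complex.I)‖ ≤ 4 * (1 + |τ|) ^ (-2 : ℝ) * (1 + Z) ^ (2 : ℝ) *
          (C * (1 + |τ|) ^ (0.968 : ℝ)) := by
          rw [hg]
          simp only [norm_mul]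
          gcongr
      _ = _ := by
        rw [show (-1.032 : ℝ) = -2 + 0.968 by norm_num, rpow_add (by positivity)]; ring
  have hcont : ∀ x : ℝ, 0 < x → Continuous fun τ : ℝ => g (x + τ * Complex.I) := fun x hx =>
    continuous_iff_continuousAt.2 fun τ => ContinuousAt.comp (g := g)
      (f := fun τ : ℝ => (x : ℂ) + τ * Complex.I) (hgd _ (by simpa using hx)).continuousAt
      (by fun_prop)
  refine ⟨?_, ?_, ?_⟩
  · exact integrable_of_norm_le_rpow (hcont 2 two_pos) (by norm_num : (1 : ℝ) < 1.032)
      fun τ hτ => hB 2 τ hσ' le_rfl hτ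
  · exact integrable_of_norm_le_rpow (hcont σ (by linarith)) (by norm_num : (1 : ℝ) < 1.032)
      fun τ hτ => hB σ τ le_rfl hσ' hτ
  · exact (integral_vertical_eq hσ' (fun s hs =>
        (hgd s (by linarith [hs.1])).differentiableWithinAt)
      (by norm_num : (1 : ℝ) < 1.032) hB).symm

lemma integrable_norm_remainder {ℓ : ℕ} (hℓ : ℓ ≤ 12) {a : ℝ} (ha : 0.478287 ≤ a) (ha' : a ≤ 1)
    {b b' : ℕ → ℂ} {H : ℂ → ℂ} (hH : Differentiable ℂ H)
    (hdec : ∀ s : ℂ, s ≠ 1 → s ≠ ((1 - a : ℝ) : ℂ) → riemannZeta s ^ 4 * riemannZeta (s + a) ^ ℓ =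
      ∑ k ∈ Finset.range 4, b k / (s - (1 : ℝ)) ^ (k + 1) +
        ∑ k ∈ Finset.range ℓ, b' k / (s - (1 - a : ℝ)) ^ (k + 1) + H s)
    {ε r : ℝ} (hε : 0 < ε) (hε' : ε ≤ 0.001) (hr : 27 * ε < r) :
    Integrable fun t : ℝ => ‖H ((1 / 2 + ε : ℝ) + t * Complex.I)‖ * (1 + |t|) ^ (-1 - r) := by
  obtain ⟨C, hC, hm⟩ := exists_mixed_moment_le hε hε'
  set B := ∑ k ∈ Finset.range 4, ‖b k‖ + ∑ k ∈ Finset.range ℓ, ‖b' k‖ with hBdef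
  have hB0 : 0 ≤ B := by positivity
  have hcH : Continuous fun t : ℝ => ‖H ((1 / 2 + ε : ℝ) + t * Complex.I)‖ :=
    (hH.continuous.comp (by fun_prop)).norm
  have hconj : ∀ (σ t : ℝ), ‖riemannZeta (σ + ((-t : ℝ) : ℂ) * Complex.I)‖ =
      ‖riemannZeta (σ + t * Complex.I)‖ := by
    intro σ t
    have e : (σ : ℂ) + ((-t : ℝ) : ℂ) * Complex.I = (starRingEnd ℂ) (σ + t * Complex.I) := by simp
    rw [e, riemannZeta_conj, RCLike.norm_conj]
  have hle : ∀ t : ℝ, 1 ≤ |t| → ‖H ((1 / 2 + ε : ℝ) + t * Complex.I)‖ ≤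
      ‖riemannZeta ((1 / 2 + ε : ℝ) + t * Complex.I)‖ ^ 4 *
        ‖riemannZeta ((1 / 2 + ε + a : ℝ) + t * Complex.I)‖ ^ ℓ + B := by
    intro t ht
    have h := norm_remainder_le hdec (s := (1 / 2 + ε : ℝ) + t * Complex.I) (by simpa using ht)
    have e : ((1 / 2 + ε : ℝ) : ℂ) + t * Complex.I + a =
      ((1 / 2 + ε + a : ℝ) : ℂ) + t * Complex.I := by push_cast; ring
    rwa [e, ← hBdef] at h
  have key : ∀ f : ℝ → ℝ, Continuous f → (∀ t, 1 ≤ t → f t ≤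
      ‖riemannZeta ((1 / 2 + ε : ℝ) + t * Complex.I)‖ ^ 4 *
        ‖riemannZeta ((1 / 2 + ε + a : ℝ) + t * Complex.I)‖ ^ ℓ + B) → ∀ N : ℕ, 1 ≤ N →
      ∫ t in (N : ℝ)..(N + N), f t ≤ (C + B) * (N : ℝ) ^ (1 + 27 * ε) := by
    intro f hf hfle N hN
    have hN1 : (1 : ℝ) ≤ N := by exact_mod_cast hN
    have hN0 : (0 : ℝ) < N := by linarith
    have hNN : (N : ℝ) ≤ N + N := by linarith
    have c1 : IntervalIntegrable (fun t : ℝ => ‖riemannZeta ((1 / 2 + ε : ℝ) + t * Complex.I)‖ ^ 4 *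
        ‖riemannZeta ((1 / 2 + ε + a : ℝ) + t * Complex.I)‖ ^ ℓ) volume N (N + N) := by
      refine ContinuousOn.intervalIntegrable ?_
      rw [Set.uIcc_of_le hNN]
      exact ((continuousOn_zeta_line (1 / 2 + ε) hN0).norm.pow 4).mul
        ((continuousOn_zeta_line (1 / 2 + ε + a) hN0).norm.pow ℓ)
    have c2 : IntervalIntegrable (fun _ : ℝ => B) volume N (N + N) := by simp
    calc ∫ t in (N : ℝ)..(N + N), f t
        ≤ ∫ t in (N : ℝ)..(N + N), (‖riemannZeta ((1 / 2 + ε : ℝ) + t * Complex.I)‖ ^ 4 *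
          ‖riemannZeta ((1 / 2 + ε + a : ℝ) + t * Complex.I)‖ ^ ℓ + B) :=
          intervalIntegral.integral_mono_on hNN (hf.intervalIntegrable _ _) (c1.add c2)
            fun t ht => hfle t (hN1.trans ht.1)
      _ = (∫ t in (N : ℝ)..(N + N), ‖riemannZeta ((1 / 2 + ε : ℝ) + t * Complex.I)‖ ^ 4 *
          ‖riemannZeta ((1 / 2 + ε + a : ℝ) + t * Complex.I)‖ ^ ℓ) + B * N := by
          rw [intervalIntegral.integral_add c1 c2, intervalIntegral.integral_const, smul_eq_mul]
          ring
      _ ≤ C * (N : ℝ) ^ (1 + 27 * ε) + B * (N : ℝ) ^ (1 + 27 * ε) := by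
          gcongr
          · exact hm N hN ℓ hℓ (1 / 2 + ε + a) (by linarith) (by linarith)
          · calc (N : ℝ) = (N : ℝ) ^ (1 : ℝ) := (rpow_one _).symm
              _ ≤ _ := rpow_le_rpow_of_exponent_le hN1 (by linarith)
      _ = _ := by ring
  refine integrable_of_dyadic hcH (fun t => norm_nonneg _) (by positivity : 0 ≤ C + B) hr
    (by positivity) (key _ hcH fun t ht => hle t (by rwa [abs_of_nonneg (by linarith)])) ?_
  refine key _ (hcH.comp continuous_neg) fun t ht => ?_
  have h := hle (-t) (by rwa [abs_neg, abs_of_nonneg (by linarith)])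
  rwa [hconj, hconj] at h

lemma norm_perronKernel_mul_sub_le {X Y σ τ r : ℝ} (hX : 0 < X) (hY : 0 < Y) (hYX : Y ≤ X)
    (hσ : 1 / 2 ≤ σ) (hσ' : σ ≤ 1) (hr : 0 ≤ r) (hr' : r ≤ 1) :
    ‖perronKernel (σ + τ * Complex.I) * (((X + Y : ℝ) : ℂ) * ((X + Y : ℝ) : ℂ) ^
        (σ + τ * Complex.I) -
      X * (X : ℂ) ^ (σ + τ * Complex.I))‖ ≤
      72 * Y * X ^ σ * (X / Y) ^ r * (1 + |τ|) ^ (-1 - r) := by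
  set s : ℂ := σ + τ * Complex.I with hs
  have hre : s.re = σ := by simp [hs]
  have him : s.im = τ := by simp [hs]
  have hs0 : s ≠ 0 := fun e => by rw [e] at hre; simp at hre; linarith
  have hs1 : s + 1 ≠ 0 := fun e => by
    have := congrArg Complex.re e
    rw [Complex.add_re, hre] at this
    simp at this; linarith
  have hn0 : (1 + |τ|) / 3 ≤ ‖s‖ := by
    have h1 := Complex.abs_re_le_norm s
    have h2 := Complex.abs_im_le_norm s
    rw [hre, abs_of_nonneg (by linarith)] at h1
    rw [him] at h2
    linarith
  have hn1 : (1 + |τ|) / 3 ≤ ‖s + 1‖ := by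
    have h1 := Complex.abs_re_le_norm (s + 1)
    have h2 := Complex.abs_im_le_norm (s + 1)
    rw [Complex.add_re, Complex.one_re, hre, abs_of_nonneg (by linarith)] at h1
    rw [Complex.add_im, Complex.one_im, add_zero, him] at h2
    linarith [abs_nonneg τ]
  have hT : 0 < 1 + |τ| := by positivity
  have hpow : ∀ u : ℝ, 0 < u → u ≤ X + Y → ‖(u : ℂ) ^ s‖ ≤ 2 * X ^ σ := by
    intro u hu hu'
    rw [Complex.norm_cpow_eq_rpow_re_of_pos hu, hre]
    calc u ^ σ ≤ (2 * X) ^ σ := rpow_le_rpow hu.le (by linarith) (by linarith)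
      _ = 2 ^ σ * X ^ σ := mul_rpow two_pos.le hX.le
      _ ≤ 2 ^ (1 : ℝ) * X ^ σ := by gcongr; norm_num
      _ = _ := by rw [rpow_one]
  set D : ℂ := ((X + Y : ℝ) : ℂ) * ((X + Y : ℝ) : ℂ) ^ s - X * (X : ℂ) ^ s with hD
  have hA : ‖D‖ ≤ ‖s + 1‖ * (2 * X ^ σ) * Y := by
    have hder : ∀ u ∈ Set.Icc X (X + Y), HasDerivWithinAt (fun u : ℝ => (u : ℂ) * (u : ℂ) ^ s)
        ((s + 1) * (u : ℂ) ^ s) (Set.Icc X (X + Y)) u := by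
      intro u hu
      have hu0 : (0 : ℝ) < u := lt_of_lt_of_le hX hu.1
      have hu' : (u : ℂ) ≠ 0 := by exact_mod_cast hu0.ne'
      have h := ((hasDerivAt_id (u : ℂ)).mul ((hasDerivAt_id (u : ℂ)).cpow_const (c := s)
        (Complex.ofReal_mem_slitPlane.2 hu0))).comp_ofReal
      refine (h.congr_deriv ?_).hasDerivWithinAt
      simp only [id]
      rw [Complex.cpow_sub _ _ hu', Complex.cpow_one]
      field_simp
      ring
    have h := (convex_Icc X (X + Y)).norm_image_sub_le_of_norm_hasDerivWithin_le hder
      (C := ‖s + 1‖ * (2 * X ^ σ)) (fun u hu => by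
        rw [norm_mul]
        exact mul_le_mul_of_nonneg_left (hpow u (lt_of_lt_of_le hX hu.1) hu.2) (norm_nonneg _))
      (Set.left_mem_Icc.2 (by linarith)) (Set.right_mem_Icc.2 (by linarith))
    rwa [add_sub_cancel_left, norm_of_nonneg hY.le] at h
  have hB : ‖D‖ ≤ 6 * X * X ^ σ := by
    refine (norm_sub_le _ _).trans ?_
    rw [norm_mul, norm_mul, Complex.norm_real, Complex.norm_real, norm_of_nonneg hX.le,
      norm_of_nonneg (by linarith : 0 ≤ X + Y)]
    have h1 := hpow X hX (by linarith)
    have h2 := hpow (X + Y) (by linarith) le_rfl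
    have := rpow_nonneg hX.le σ
    nlinarith [mul_le_mul_of_nonneg_left h1 hX.le,
      mul_le_mul_of_nonneg_left h2 (by linarith : 0 ≤ X + Y)]
  have hk : ‖perronKernel s * D‖ = ‖D‖ / (‖s‖ * ‖s + 1‖) := by
    rw [perronKernel, norm_mul, norm_div, norm_one, norm_mul, one_div_mul_eq_div]
  have hp0 : 0 < ‖s‖ := norm_pos_iff.2 hs0
  have hp1 : 0 < ‖s + 1‖ := norm_pos_iff.2 hs1
  have hXσ : 0 < X ^ σ := by positivity
  set x : ℝ := X / Y / (1 + |τ|) with hx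
  have hx0 : 0 < x := by positivity
  have hA' : ‖perronKernel s * D‖ ≤ 72 * Y * X ^ σ * (1 + |τ|)⁻¹ * 1 := by
    rw [hk, div_le_iff₀ (by positivity)]
    refine hA.trans ?_
    have : 1 ≤ 3 * (1 + |τ|)⁻¹ * ‖s‖ := by
      rw [show 3 * (1 + |τ|)⁻¹ * ‖s‖ = 3 * ‖s‖ / (1 + |τ|) by ring, le_div_iff₀ hT]
      linarith
    calc ‖s + 1‖ * (2 * X ^ σ) * Y = ‖s + 1‖ * (2 * X ^ σ) * Y * 1 := by ring
      _ ≤ ‖s + 1‖ * (2 * X ^ σ) * Y * (3 * (1 + |τ|)⁻¹ * ‖s‖) := by gcongr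
      _ = 6 * (Y * X ^ σ * (1 + |τ|)⁻¹ * (‖s‖ * ‖s + 1‖)) := by ring
      _ ≤ 72 * (Y * X ^ σ * (1 + |τ|)⁻¹ * (‖s‖ * ‖s + 1‖)) := by gcongr; norm_num
      _ = _ := by ring
  have hB' : ‖perronKernel s * D‖ ≤ 72 * Y * X ^ σ * (1 + |τ|)⁻¹ * x := by
    rw [hk, div_le_iff₀ (by positivity)]
    refine hB.trans ?_
    calc 6 * X * X ^ σ = 54 * X * X ^ σ * (1 + |τ|)⁻¹ * (1 + |τ|)⁻¹ *
          ((1 + |τ|) / 3 * ((1 + |τ|) / 3)) := by field_simp; norm_num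
      _ ≤ 72 * X * X ^ σ * (1 + |τ|)⁻¹ * (1 + |τ|)⁻¹ * (‖s‖ * ‖s + 1‖) := by
        gcongr; norm_num
      _ = _ := by rw [hx]; field_simp
  have hxr : min 1 x ≤ x ^ r := by
    rcases le_total 1 x with h | h
    · exact (min_le_left _ _).trans (one_le_rpow h hr)
    · refine (min_le_right _ _).trans ?_
      calc x = x ^ (1 : ℝ) := (rpow_one x).symm
        _ ≤ x ^ r := rpow_le_rpow_of_exponent_ge hx0 h hr'
  calc ‖perronKernel s * D‖ ≤ 72 * Y * X ^ σ * (1 + |τ|)⁻¹ * min 1 x := by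
        rcases min_choice 1 x with h | h <;> rw [h]
        · exact hA'
        · exact hB'
    _ ≤ 72 * Y * X ^ σ * (1 + |τ|)⁻¹ * x ^ r := by gcongr
    _ = _ := by
      rw [hx, div_rpow (by positivity) hT.le, sub_eq_add_neg, rpow_add hT, rpow_neg hT.le r,
        rpow_neg_one]
      ring

lemma exists_norm_smoothed_diff_le {ℓ : ℕ} (hℓ : ℓ ≤ 12) {a : ℝ} (ha : 0.478287 ≤ a) (ha' : a ≤ 1)
    {b b' : ℕ → ℂ} {H : ℂ → ℂ} (hH : Differentiable ℂ H)
    (hdec : ∀ s : ℂ, s ≠ 1 → s ≠ ((1 - a : ℝ) : ℂ) → riemannZeta s ^ 4 * riemannZeta (s + a) ^ ℓ =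
      ∑ k ∈ Finset.range 4, b k / (s - (1 : ℝ)) ^ (k + 1) +
        ∑ k ∈ Finset.range ℓ, b' k / (s - (1 - a : ℝ)) ^ (k + 1) + H s)
    {ε : ℝ} (hε : 0 < ε) (hε' : ε ≤ 0.001) :
    ∃ C, 0 ≤ C ∧ ∀ X Y : ℝ, 0 < Y → Y ≤ X → ∀ M : ℕ, 1 ≤ M → X + Y ≤ M →
      ‖∑ n ∈ Finset.Icc 1 M, (dWeighted ℓ a n : ℂ) *
          ((max (X + Y - n) 0 - max (X - n) 0 : ℝ) : ℂ) -
        ∫ u in (1 : ℝ)..M, polarDensity ℓ a b b' u *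
          ((max (X + Y - u) 0 - max (X - u) 0 : ℝ) : ℂ)‖ ≤
        C * (Y * X ^ (1 / 2 + ε) * (X / Y) ^ (28 * ε)) := by
  obtain ⟨C, hC, hb⟩ := exists_norm_remainder_strip_le hℓ ha ha' hdec
  have hJ := integrable_norm_remainder hℓ ha ha' hH hdec hε hε' (r := 28 * ε) (by linarith)
  set J := ∫ t : ℝ, ‖H ((1 / 2 + ε : ℝ) + t * Complex.I)‖ * (1 + |t|) ^ (-1 - 28 * ε) with hJdef
  have hJ0 : 0 ≤ J := integral_nonneg fun t => by positivity
  refine ⟨72 * J, by positivity, fun X Y hY hYX M hM hXM => ?_⟩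
  have hX : 0 < X := lt_of_lt_of_le hY hYX
  have hXY : 0 < X + Y := by linarith
  have hM' : (1 : ℝ) ≤ M := by exact_mod_cast hM
  obtain ⟨i1, j1, e1⟩ := integral_remainder_shift hH hb (σ := 1 / 2 + ε) (by linarith)
    (by linarith) hX
  obtain ⟨i2, j2, e2⟩ := integral_remainder_shift hH hb (σ := 1 / 2 + ε) (by linarith)
    (by linarith) hXY
  have h1 := smoothed_sum_sub_integral (by linarith : 0 ≤ a) hdec hX i1 hM (by linarith)
  have h2 := smoothed_sum_sub_integral (by linarith : 0 ≤ a) hdec hXY i2 hM hXM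
  have hci : ∀ Z : ℝ, IntervalIntegrable
      (fun u => polarDensity ℓ a b b' u * ((max (Z - u) 0 : ℝ) : ℂ)) volume 1 M := by
    intro Z
    refine ContinuousOn.intervalIntegrable (ContinuousOn.mul ?_ (by fun_prop))
    rw [Set.uIcc_of_le hM']
    exact (continuousOn_polarDensity ℓ a b b').mono Set.Icc_subset_Ici_self
  have hd : ∑ n ∈ Finset.Icc 1 M, (dWeighted ℓ a n : ℂ) *
          ((max (X + Y - n) 0 - max (X - n) 0 : ℝ) : ℂ) -
        ∫ u in (1 : ℝ)..M, polarDensity ℓ a b b' u *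
          ((max (X + Y - u) 0 - max (X - u) 0 : ℝ) : ℂ) =
      (2 * (π : ℂ))⁻¹ * ∫ τ : ℝ, perronKernel ((1 / 2 + ε : ℝ) + τ * Complex.I) *
        (((X + Y : ℝ) : ℂ) * ((X + Y : ℝ) : ℂ) ^ ((1 / 2 + ε : ℝ) + τ * Complex.I) -
          X * (X : ℂ) ^ ((1 / 2 + ε : ℝ) + τ * Complex.I)) *
        H ((1 / 2 + ε : ℝ) + τ * Complex.I) := by
    have e3 : ∀ τ : ℝ, perronKernel ((1 / 2 + ε : ℝ) + τ * Complex.I) *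
        (((X + Y : ℝ) : ℂ) * ((X + Y : ℝ) : ℂ) ^ ((1 / 2 + ε : ℝ) + τ * Complex.I) -
          X * (X : ℂ) ^ ((1 / 2 + ε : ℝ) + τ * Complex.I)) *
        H ((1 / 2 + ε : ℝ) + τ * Complex.I) =
        ((X + Y : ℝ) : ℂ) * (perronKernel ((1 / 2 + ε : ℝ) + τ * Complex.I) *
          ((X + Y : ℝ) : ℂ) ^ ((1 / 2 + ε : ℝ) + τ * Complex.I) *
          H ((1 / 2 + ε : ℝ) + τ * Complex.I)) -
        X * (perronKernel ((1 / 2 + ε : ℝ) + τ * Complex.I) *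
          (X : ℂ) ^ ((1 / 2 + ε : ℝ) + τ * Complex.I) *
          H ((1 / 2 + ε : ℝ) + τ * Complex.I)) := fun τ => by ring
    simp only [e3]
    rw [integral_sub (j2.const_mul _) (j1.const_mul _), integral_const_mul, integral_const_mul,
      ← e1, ← e2, mul_sub, ← h1, ← h2]
    simp only [Complex.ofReal_sub, mul_sub, Finset.sum_sub_distrib]
    rw [intervalIntegral.integral_sub (by exact_mod_cast hci (X + Y)) (by exact_mod_cast hci X)]
    ring
  rw [hd, norm_mul]
  have hpi : ‖(2 * (π : ℂ))⁻¹‖ ≤ 1 := by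
    rw [norm_inv, norm_mul, Complex.norm_real, norm_of_nonneg pi_pos.le]
    refine inv_le_one_of_one_le₀ ?_
    norm_num
    linarith [pi_gt_three]
  have hint : ‖∫ τ : ℝ, perronKernel ((1 / 2 + ε : ℝ) + τ * Complex.I) *
        (((X + Y : ℝ) : ℂ) * ((X + Y : ℝ) : ℂ) ^ ((1 / 2 + ε : ℝ) + τ * Complex.I) -
          X * (X : ℂ) ^ ((1 / 2 + ε : ℝ) + τ * Complex.I)) *
        H ((1 / 2 + ε : ℝ) + τ * Complex.I)‖ ≤
      72 * Y * X ^ (1 / 2 + ε) * (X / Y) ^ (28 * ε) * J := by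
    rw [hJdef, ← integral_const_mul]
    refine norm_integral_le_of_norm_le (hJ.const_mul _) (Eventually.of_forall fun τ => ?_)
    rw [norm_mul]
    calc _ ≤ 72 * Y * X ^ (1 / 2 + ε) * (X / Y) ^ (28 * ε) * (1 + |τ|) ^ (-1 - 28 * ε) *
          ‖H ((1 / 2 + ε : ℝ) + τ * Complex.I)‖ :=
          mul_le_mul_of_nonneg_right (norm_perronKernel_mul_sub_le hX hY hYX (by linarith)
            (by linarith) (by positivity) (by linarith)) (norm_nonneg _)
      _ = _ := by ring
  calc _ ≤ 1 * (72 * Y * X ^ (1 / 2 + ε) * (X / Y) ^ (28 * ε) * J) := by gcongr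
    _ = _ := by ring

lemma norm_sum_sub_integral_le {f : ℕ → ℝ} {g : ℝ → ℂ} (hf : ∀ n, 0 ≤ f n)
    (hg : ContinuousOn g (Set.Ici 1)) {X Y B B' : ℝ} (hX : 1 ≤ X) (hY : 0 < Y) {M : ℕ}
    (hM : X + Y ≤ M) (hfB : ∀ n, 1 ≤ n → n ≤ M → f n ≤ B)
    (hgB : ∀ u : ℝ, 1 ≤ u → u ≤ M → ‖g u‖ ≤ B') (hB : 0 ≤ B) :
    ‖∑ n ∈ Finset.Icc 1 ⌊X⌋₊, (f n : ℂ) - ∫ u in (1 : ℝ)..X, g u‖ ≤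
      Y⁻¹ * ‖∑ n ∈ Finset.Icc 1 M, (f n : ℂ) * ((max (X + Y - n) 0 - max (X - n) 0 : ℝ) : ℂ) -
        ∫ u in (1 : ℝ)..M, g u * ((max (X + Y - u) 0 - max (X - u) 0 : ℝ) : ℂ)‖ +
      ((M - X + 1) * B + (M - X) * B') := by
  set δ : ℝ → ℝ := fun u => max (X + Y - u) 0 - max (X - u) 0 with hδ
  have hδ1 : ∀ u, u ≤ X → δ u = Y := fun u hu => by
    simp only [hδ]
    rw [max_eq_left (by linarith), max_eq_left (by linarith)]; ring
  have hδ2 : ∀ u, |δ u| ≤ Y := by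
    intro u
    have := abs_max_sub_max_le_abs (X + Y - u) (X - u) 0
    rwa [show X + Y - u - (X - u) = Y by ring, abs_of_pos hY] at this
  have hδc : Continuous δ := by fun_prop
  set N := ⌊X⌋₊ with hN
  have hNX : (N : ℝ) ≤ X := Nat.floor_le (by linarith)
  have hXN : X < N + 1 := Nat.lt_floor_add_one X
  have hNM : N ≤ M := by exact_mod_cast (by linarith : (N : ℝ) ≤ M)
  have hXM : X ≤ M := by linarith
  have hsum : ∑ n ∈ Finset.Icc 1 M, (f n : ℂ) * (δ n : ℂ) =
      Y * ∑ n ∈ Finset.Icc 1 N, (f n : ℂ) + ∑ n ∈ Finset.Ioc N M, (f n : ℂ) * (δ n : ℂ) := by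
    rw [show Finset.Icc 1 M = Finset.Ioc 0 M from rfl,
      show Finset.Icc 1 N = Finset.Ioc 0 N from rfl,
      ← Finset.sum_Ioc_consecutive _ (Nat.zero_le N) hNM, Finset.mul_sum]
    congr 1
    refine Finset.sum_congr rfl fun n hn => ?_
    have : (n : ℝ) ≤ N := by exact_mod_cast (Finset.mem_Ioc.1 hn).2
    rw [hδ1 n (by linarith), mul_comm]
  have hgi : ∀ c d : ℝ, 1 ≤ c → c ≤ d → IntervalIntegrable (fun u => g u * (δ u : ℂ))
      volume c d := by
    intro c d hc hcd
    refine ContinuousOn.intervalIntegrable (ContinuousOn.mul ?_ (by fun_prop))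
    rw [Set.uIcc_of_le hcd]
    exact hg.mono fun u hu => hc.trans hu.1
  have hint : ∫ u in (1 : ℝ)..M, g u * (δ u : ℂ) =
      Y * (∫ u in (1 : ℝ)..X, g u) + ∫ u in X..M, g u * (δ u : ℂ) := by
    rw [← intervalIntegral.integral_add_adjacent_intervals (hgi 1 X le_rfl hX) (hgi X M hX hXM)]
    congr 1
    rw [← intervalIntegral.integral_const_mul]
    refine intervalIntegral.integral_congr fun u hu => ?_
    rw [Set.uIcc_of_le hX] at hu
    rw [hδ1 u hu.2, mul_comm]
  have b1 : ‖∑ n ∈ Finset.Ioc N M, (f n : ℂ) * (δ n : ℂ)‖ ≤ (M - X + 1) * B * Y := by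
    calc _ ≤ ∑ n ∈ Finset.Ioc N M, B * Y := by
          refine (norm_sum_le _ _).trans (Finset.sum_le_sum fun n hn => ?_)
          rw [Finset.mem_Ioc] at hn
          rw [norm_mul, Complex.norm_real, Complex.norm_real, norm_of_nonneg (hf n)]
          exact mul_le_mul (hfB n (by omega) hn.2) (hδ2 n) (abs_nonneg _) hB
      _ = (M - N) * B * Y := by
          rw [Finset.sum_const, Nat.card_Ioc, nsmul_eq_mul, Nat.cast_sub hNM]; ring
      _ ≤ _ := by gcongr; linarith
  have b2 : ‖∫ u in X..M, g u * (δ u : ℂ)‖ ≤ (M - X) * B' * Y := by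
    have h := intervalIntegral.norm_integral_le_of_norm_le_const (a := X) (b := M)
      (f := fun u => g u * (δ u : ℂ)) (C := B' * Y) (fun u hu => by
        rw [Set.uIoc_of_le hXM] at hu
        have hu1 : 1 ≤ u := by linarith [hu.1]
        rw [norm_mul, Complex.norm_real]
        have := hgB u hu1 hu.2
        exact mul_le_mul this (hδ2 u) (norm_nonneg _) ((norm_nonneg _).trans this))
    rw [abs_of_nonneg (by linarith)] at h
    linarith
  set S := ∑ n ∈ Finset.Icc 1 N, (f n : ℂ)
  set G := ∫ u in (1 : ℝ)..X, g u
  set D := ∑ n ∈ Finset.Icc 1 M, (f n : ℂ) * (δ n : ℂ) - ∫ u in (1 : ℝ)..M, g u * (δ u : ℂ) with hD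
  have hYc : (Y : ℂ) ≠ 0 := by exact_mod_cast hY.ne'
  have e : S - G = (Y : ℂ)⁻¹ * (D - ∑ n ∈ Finset.Ioc N M, (f n : ℂ) * (δ n : ℂ) +
      ∫ u in X..M, g u * (δ u : ℂ)) := by
    rw [hD, hsum, hint]
    field_simp
    ring
  rw [e, norm_mul, norm_inv, Complex.norm_real, norm_of_nonneg hY.le]
  calc _ ≤ Y⁻¹ * (‖D‖ + (M - X + 1) * B * Y + (M - X) * B' * Y) := by
        gcongr
        exact (norm_add_le _ _).trans (add_le_add ((norm_sub_le _ _).trans (by gcongr)) b2)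
    _ = _ := by field_simp; ring

lemma exists_norm_sum_sub_integral_le {ℓ : ℕ} (hℓ : ℓ ≤ 12) {a : ℝ} (ha : 0.478287 ≤ a)
    (ha' : a ≤ 1) {b b' : ℕ → ℂ} {H : ℂ → ℂ} (hH : Differentiable ℂ H)
    (hdec : ∀ s : ℂ, s ≠ 1 → s ≠ ((1 - a : ℝ) : ℂ) → riemannZeta s ^ 4 * riemannZeta (s + a) ^ ℓ =
      ∑ k ∈ Finset.range 4, b k / (s - (1 : ℝ)) ^ (k + 1) +
        ∑ k ∈ Finset.range ℓ, b' k / (s - (1 - a : ℝ)) ^ (k + 1) + H s)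
    {ε : ℝ} (hε : 0 < ε) (hε' : ε ≤ 0.001) :
    ∃ C, 0 ≤ C ∧ ∀ X : ℝ, 2 ≤ X →
      ‖∑ n ∈ Finset.Icc 1 ⌊X⌋₊, (dWeighted ℓ a n : ℂ) - ∫ u in (1 : ℝ)..X,
          polarDensity ℓ a b b' u‖ ≤
        C * X ^ (1 / 2 + 15 * ε) := by
  obtain ⟨C₁, hC₁, h1⟩ := exists_norm_smoothed_diff_le hℓ ha ha' hH hdec hε hε'
  obtain ⟨C₂, hC₂, h2⟩ := exists_dWeighted_le ℓ (by linarith : 0 ≤ a) hε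
  obtain ⟨C₃, hC₃, h3⟩ := exists_norm_polarDensity_le ℓ (by linarith : 0 ≤ a) b b' hε
  refine ⟨C₁ + 9 * C₂ + 6 * C₃, by positivity, fun X hX => ?_⟩
  have hX0 : 0 < X := by linarith
  have hX1 : 1 ≤ X := by linarith
  set Y := X ^ (1 / 2 : ℝ) with hY
  have hY1 : 1 ≤ Y := one_le_rpow hX1 (by norm_num)
  have hYX : Y ≤ X := by
    calc Y ≤ X ^ (1 : ℝ) := rpow_le_rpow_of_exponent_le hX1 (by norm_num)
      _ = X := rpow_one X
  have hXY : X / Y = X ^ (1 / 2 : ℝ) := by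
    rw [hY, div_eq_iff (by positivity), ← rpow_add hX0]; norm_num
  set M := ⌈X + Y⌉₊ with hM
  have hXM : X + Y ≤ M := Nat.le_ceil _
  have hM1 : (M : ℝ) < X + Y + 1 := Nat.ceil_lt_add_one (by linarith)
  have hM3 : (M : ℝ) ≤ 3 * X := by linarith
  have hM0 : 1 ≤ M := by exact_mod_cast (by linarith : (1 : ℝ) ≤ M)
  have h3ε : (3 * X) ^ ε ≤ 3 * X ^ ε := by
    rw [mul_rpow (by norm_num) hX0.le]
    gcongr
    calc (3 : ℝ) ^ ε ≤ 3 ^ (1 : ℝ) := rpow_le_rpow_of_exponent_le (by norm_num) (by linarith)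
      _ = 3 := rpow_one 3
  have hpow : ∀ u : ℝ, 1 ≤ u → u ≤ M → u ^ ε ≤ 3 * X ^ ε := fun u hu hu' =>
    (rpow_le_rpow (by linarith) (hu'.trans hM3) hε.le).trans h3ε
  have h := norm_sum_sub_integral_le (dWeighted_nonneg ℓ a) (continuousOn_polarDensity ℓ a b b')
    hX1 (by linarith : 0 < Y) hXM (B := C₂ * (3 * X ^ ε)) (B' := C₃ * (3 * X ^ ε))
    (fun n hn hn' => (h2 n hn).trans (mul_le_mul_of_nonneg_left
      (hpow n (by exact_mod_cast hn) (by exact_mod_cast hn')) (by linarith)))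
    (fun u hu hu' => (h3 u hu).trans (mul_le_mul_of_nonneg_left (hpow u hu hu') hC₃))
    (by positivity)
  have hs := h1 X Y (by linarith) hYX M hM0 hXM
  rw [hXY, ← rpow_mul hX0.le] at hs
  refine h.trans ?_
  have hXε : X ^ (1 / 2 + ε) ≤ X ^ (1 / 2 + 15 * ε) :=
    rpow_le_rpow_of_exponent_le hX1 (by linarith)
  have hYε : Y * X ^ ε = X ^ (1 / 2 + ε) := by rw [hY, ← rpow_add hX0]
  calc _ ≤ Y⁻¹ * (C₁ * (Y * X ^ (1 / 2 + ε) * X ^ (1 / 2 * (28 * ε)))) +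
        (3 * Y * (C₂ * (3 * X ^ ε)) + 2 * Y * (C₃ * (3 * X ^ ε))) := by
        gcongr <;> linarith
    _ = C₁ * X ^ (1 / 2 + 15 * ε) + (9 * C₂ + 6 * C₃) * X ^ (1 / 2 + ε) := by
        rw [show 1 / 2 + 15 * ε = 1 / 2 + ε + 1 / 2 * (28 * ε) by ring,
            rpow_add hX0 (1 / 2 + ε), ← hYε]
        field_simp
        ring
    _ ≤ C₁ * X ^ (1 / 2 + 15 * ε) + (9 * C₂ + 6 * C₃) * X ^ (1 / 2 + 15 * ε) := by gcongr
    _ = _ := by ring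

end WeightedDivisor

/-- Corollary 2 of Ivić–Zhai, case `ℓ ∈ {11, 12}`: for fixed `a` in the stated range, the
error term `E_{4,ℓ}(X)` in the asymptotic formula for `∑_{n ≤ X} d_{4,ℓ}(n;a)` is
`≪_ε X^{1/2+ε}`. -/
theorem weighted_divisor_error_l11_l12 (ℓ : ℕ) (hℓ : ℓ = 11 ∨ ℓ = 12)
    (a : ℝ) (ha₁ : 0.478287 ≤ a) (ha₂ : a < 1 / 2) :
    ∃ c : Fin 4 → ℝ, ∃ c' : Fin ℓ → ℝ, ∀ ε : ℝ, 0 < ε → ∃ C : ℝ, 0 < C ∧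
      ∀ X : ℝ, 2 ≤ X →
        |(∑ n ∈ Finset.Icc 1 ⌊X⌋₊, dWeighted ℓ a n) -
            X * ∑ k : Fin 4, c k * Real.log X ^ (k : ℕ) -
            X ^ (1 - a) * ∑ k : Fin ℓ, c' k * Real.log X ^ (k : ℕ)| ≤
          C * X ^ (1 / 2 + ε) := by
  have hℓ' : ℓ ≤ 12 := by omega
  obtain ⟨b, b', H, hH, hdec⟩ := WeightedDivisor.exists_zeta_product_decomp ℓ (a := a) (by linarith)
  obtain ⟨c, c', e, hG⟩ := WeightedDivisor.exists_re_integral_polarDensity ℓ (by linarith : a < 1)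
      b b'
  refine ⟨c, c', fun ε hε => ?_⟩
  obtain ⟨C, hC, h⟩ := WeightedDivisor.exists_norm_sum_sub_integral_le hℓ' ha₁ (by linarith) hH hdec
    (ε := min (ε / 15) 0.001) (lt_min (by positivity) (by norm_num)) (min_le_right _ _)
  refine ⟨C + |e| + 1, by positivity, fun X hX => ?_⟩
  have hX1 : 1 ≤ X := by linarith
  have hp : 1 ≤ X ^ (1 / 2 + ε) := one_le_rpow hX1 (by positivity)
  have hre := Complex.abs_re_le_norm (∑ n ∈ Finset.Icc 1 ⌊X⌋₊, (dWeighted ℓ a n : ℂ) -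
    ∫ u in (1 : ℝ)..X, WeightedDivisor.polarDensity ℓ a b b' u)
  rw [Complex.sub_re, hG X hX1, Complex.re_sum] at hre
  simp only [Complex.ofReal_re] at hre
  have hle : C * X ^ (1 / 2 + 15 * min (ε / 15) 0.001) ≤ C * X ^ (1 / 2 + ε) :=
    mul_le_mul_of_nonneg_left (rpow_le_rpow_of_exponent_le hX1
      (by linarith [min_le_left (ε / 15) (0.001 : ℝ)])) hC
  have hb := (hre.trans (h X hX)).trans hle
  set S := ∑ n ∈ Finset.Icc 1 ⌊X⌋₊, dWeighted ℓ a n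
  set P := X * ∑ k : Fin 4, c k * log X ^ (k : ℕ)
  set Q := X ^ (1 - a) * ∑ k : Fin ℓ, c' k * log X ^ (k : ℕ)
  calc |S - P - Q| = |(S - (P + Q + e)) + e| := by ring_nf
    _ ≤ C * X ^ (1 / 2 + ε) + |e| * 1 := by
      rw [mul_one]; exact (abs_add_le _ _).trans (by gcongr)
    _ ≤ C * X ^ (1 / 2 + ε) + |e| * X ^ (1 / 2 + ε) + 1 * X ^ (1 / 2 + ε) := by
      have := mul_le_mul_of_nonneg_left hp (abs_nonneg e)
      linarith
    _ = _ := by ring
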